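/- arXiv:1409.5540 — 2 statements merged into one kernel-verified Lean document; each statement's English description precedes it below -/
import Mathlib

section
/- Let p>1, let a∈C^1([0,1]) with a(x)>0 on [0,1], and let W satisfy (W1) and (W2). Let ε_n→0^+ and let u_n be solutions of (P_{ε_n}) whose energies E_n converge uniformly on [0,1] to a function E. Then E is C^1 and satisfies the differential equation E'(x) = (a'(x)/a(x)) K(E(x)) for every x∈[0,1]. -/
open Real Set Filter Topology MeasureTheory intervalIntegral Asymptotics

noncomputable section

/-- `φ_p(s) = |s|^{p-2} s`. -/
def phip (p s : ℝ) : ℝ := |s| ^ (p - 2) * s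

/-- `L(s) = |s|^p / p*` with `p* = p/(p-1)`. -/
def Lfun (p s : ℝ) : ℝ := |s| ^ p / (p / (p - 1))

/-- condition (W1) -/
def W1cond (p : ℝ) (W : ℝ → ℝ) (Cm1 C0 C1 W0 : ℝ) : Prop :=
  0 < Cm1 ∧ 0 < C0 ∧ 0 < C1 ∧ 0 < W0 ∧
  (fun u => W u - C1 / p * |u - 1| ^ p) =o[𝓝[Set.Icc (-1:ℝ) 1] 1] (fun u => |u - 1| ^ p) ∧
  (fun u => W u - Cm1 / p * |u + 1| ^ p) =o[𝓝[Set.Icc (-1:ℝ) 1] (-1)] (fun u => |u + 1| ^ p) ∧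
  (fun u => W u - (W0 - C0 / p * |u| ^ p)) =o[𝓝[Set.Icc (-1:ℝ) 1] 0] (fun u => |u| ^ p)

/-- condition (W2) -/
def W2cond (p : ℝ) (W : ℝ → ℝ) : Prop :=
  StrictAntiOn (fun u => deriv W u / phip p u) (Set.Ico (-1:ℝ) 0) ∧
  StrictMonoOn (fun u => deriv W u / phip p u) (Set.Ioc (0:ℝ) 1)

/-- `v` (with derivative `v'`) is a global solution of `-(φ_p(v'))' + a W'(v) = 0`. -/
def IsSolAuto (p aa : ℝ) (W v v' : ℝ → ℝ) : Prop :=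
  Continuous v' ∧ (∀ x, HasDerivAt v (v' x) x) ∧
  ∃ g : ℝ → ℝ, Continuous g ∧ (∀ x, HasDerivAt (fun y => phip p (v' y)) (g x) x) ∧
    ∀ x, g x = aa * deriv W (v x)

/-- `v` (with derivative `v'`) solves `-(φ_p(v'))' + a W'(v) = 0` on the open set `I`. -/
def IsSolAutoOn (p aa : ℝ) (W v v' : ℝ → ℝ) (I : Set ℝ) : Prop :=
  ContinuousOn v' I ∧ (∀ x ∈ I, HasDerivAt v (v' x) x) ∧
  ∃ g : ℝ → ℝ, ContinuousOn g I ∧ (∀ x ∈ I, HasDerivAt (fun y => phip p (v' y)) (g x) x) ∧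
    ∀ x ∈ I, g x = aa * deriv W (v x)

/-- `u` (with derivative `u'`) solves `-ε(φ_p(εu'))' + a(x) W'(u) = 0` on `S`. -/
def IsSolOn (p ε : ℝ) (a W u u' : ℝ → ℝ) (S : Set ℝ) : Prop :=
  ContinuousOn u' S ∧ (∀ x ∈ S, HasDerivWithinAt u (u' x) S x) ∧
  ∃ g : ℝ → ℝ, ContinuousOn g S ∧
    (∀ x ∈ S, HasDerivWithinAt (fun y => phip p (ε * u' y)) (g x) S x) ∧
    ∀ x ∈ S, ε * g x = a x * deriv W (u x)

/-- `u` is a solution of the Neumann problem `(P_ε)`. -/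
def IsNeumann (p ε : ℝ) (a W u u' : ℝ → ℝ) : Prop :=
  IsSolOn p ε a W u u' (Set.Icc 0 1) ∧ u' 0 = 0 ∧ u' 1 = 0

/-- energy of a solution of `(P_ε)` -/
def Ener (p ε : ℝ) (a W u u' : ℝ → ℝ) (x : ℝ) : ℝ :=
  -(1 / a x) * Lfun p (ε * u' x) + W (u x)

/-- `π_p` -/
def pip (p : ℝ) : ℝ := 2 * (p - 1) ^ (1 / p) * ∫ s in (0:ℝ)..1, ((1:ℝ) - s ^ p) ^ (-(1 / p))

lemma mul_phip {p : ℝ} (hp : 1 < p) (s : ℝ) : s * phip p s = |s| ^ p := by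
  rcases eq_or_ne s 0 with rfl | hs
  · simp [zero_rpow (by linarith : p ≠ 0)]
  · have h : |s| ^ p = |s| ^ (p - 2) * |s| ^ (2 : ℝ) := by
      rw [← rpow_add (abs_pos.2 hs)]; congr 1; ring
    rw [h, rpow_two, sq_abs, phip]; ring

lemma abs_phip {p : ℝ} (hp : 1 < p) (s : ℝ) : |phip p s| = |s| ^ (p - 1) := by
  rcases eq_or_ne s 0 with rfl | hs
  · simp [phip, zero_rpow (by linarith : p - 1 ≠ 0)]
  · rw [phip, abs_mul, abs_of_nonneg (rpow_nonneg (abs_nonneg s) _)]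
    nth_rewrite 2 [← rpow_one |s|]
    rw [← rpow_add (abs_pos.2 hs)]; congr 1; ring

lemma one_lt_conj {p : ℝ} (hp : 1 < p) : 1 < p / (p - 1) := by
  rw [lt_div_iff₀ (by linarith)]; linarith

lemma Lfun_eq_phip {p : ℝ} (hp : 1 < p) (s : ℝ) :
    Lfun p s = |phip p s| ^ (p / (p - 1)) / (p / (p - 1)) := by
  rw [Lfun, abs_phip hp, ← rpow_mul (abs_nonneg s), mul_div_cancel₀ _ (by linarith)]

lemma phip_conj_phip {p : ℝ} (hp : 1 < p) (s : ℝ) :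
    |phip p s| ^ (p / (p - 1) - 2) * phip p s = s := by
  rcases eq_or_ne s 0 with rfl | hs
  · simp [phip]
  · have h1 : p - 1 ≠ 0 := by linarith
    rw [abs_phip hp, ← rpow_mul (abs_nonneg s), phip, ← mul_assoc,
      ← rpow_add (abs_pos.2 hs)]
    have : (p - 1) * (p / (p - 1) - 2) + (p - 2) = 0 := by field_simp; ring
    rw [this]; simp

lemma HasDerivWithinAt.Lfun_of_phip {p : ℝ} (hp : 1 < p) {w : ℝ → ℝ} {d x : ℝ} {S : Set ℝ}
    (h : HasDerivWithinAt (fun y => phip p (w y)) d S x) :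
    HasDerivWithinAt (fun y => Lfun p (w y)) (w x * d) S x := by
  have h1 := one_lt_conj hp
  have h2 := ((hasDerivAt_abs_rpow (phip p (w x)) h1).comp_hasDerivWithinAt x h).div_const
    (p / (p - 1))
  simp only [Lfun_eq_phip hp]
  refine h2.congr_deriv ?_
  have h3 : p - 1 ≠ 0 := by linarith
  rw [mul_assoc (p / (p - 1)), phip_conj_phip hp]
  field_simp

lemma Lfun_nonneg {p : ℝ} (hp : 1 < p) (s : ℝ) : 0 ≤ Lfun p s :=
  div_nonneg (rpow_nonneg (abs_nonneg s) _) (by linarith [one_lt_conj hp])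

lemma mul_phip_eq_Lfun {p : ℝ} (hp : 1 < p) (s : ℝ) :
    s * phip p s = p / (p - 1) * Lfun p s := by
  have h1 : p - 1 ≠ 0 := by linarith
  rw [mul_phip hp, Lfun]; field_simp

/-- A double-well shape on `[-1, 1]`: zero at `±1`, maximum `W0` at `0`, strictly monotone in
between, and flat of order `p` at `1`. -/
structure DoubleWell (p : ℝ) (W : ℝ → ℝ) (W0 : ℝ) : Prop where
  contDiff : ContDiff ℝ 1 W
  pos : 0 < W0
  zero : W 0 = W0
  one : W 1 = 0
  neg_one : W (-1) = 0
  deriv_neg : ∀ u ∈ Ioo (0 : ℝ) 1, deriv W u < 0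
  deriv_pos : ∀ u ∈ Ioo (-1 : ℝ) 0, 0 < deriv W u
  deriv_one : deriv W 1 = 0
  deriv_neg_one : deriv W (-1) = 0
  flat : ∃ C > 0, ∃ r > 0, ∀ u ∈ Ioo (0 : ℝ) 1, 1 - r < u → W u ≤ C * (1 - u) ^ p

lemma eq_of_isLittleO_abs_rpow {p : ℝ} (hp : 1 < p) {f h : ℝ → ℝ} {c : ℝ} {S : Set ℝ}
    (hc : c ∈ S) (h0 : h c = 0) (hf : f =o[𝓝[S] c] fun u => |h u| ^ p) : f c = 0 := by
  have := (hf.def one_pos).self_of_nhdsWithin hc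
  simpa [h0, zero_rpow (by linarith : p ≠ 0)] using this

lemma deriv_eq_zero_of_isLittleO {p : ℝ} (hp : 1 < p) {W : ℝ → ℝ} {c C : ℝ} {S : Set ℝ}
    (hS : UniqueDiffWithinAt ℝ S c) (hW : DifferentiableAt ℝ W c) (hWc : W c = 0)
    (hf : (fun u => W u - C * |u - c| ^ p) =o[𝓝[S] c] fun u => |u - c| ^ p) :
    deriv W c = 0 := by
  have h1 : HasDerivAt (fun u => |u - c| ^ p) 0 c := by
    have := HasDerivAt.comp_sub_const c c (hasDerivAt_abs_rpow (c - c) hp)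
    simpa using this
  have h2 : (fun u => |u - c| ^ p) =o[𝓝[S] c] fun u => u - c := by
    have := hasDerivWithinAt_iff_isLittleO.1 (h1.hasDerivWithinAt (s := S))
    simpa [zero_rpow (by linarith : p ≠ 0)] using this
  have h3 : W =o[𝓝[S] c] fun u => u - c := by
    have := (hf.trans h2).add (h2.const_mul_left C)
    simpa using this
  have h4 : HasDerivWithinAt W 0 S c := by
    rw [hasDerivWithinAt_iff_isLittleO]; simpa [hWc] using h3
  exact hS.eq_deriv S hW.hasDerivAt.hasDerivWithinAt h4

lemma W1cond.doubleWell {p : ℝ} (hp : 1 < p) {W : ℝ → ℝ} {Cm1 C0 C1 W0 : ℝ}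
    (hW : ContDiff ℝ 1 W) (hW1 : W1cond p W Cm1 C0 C1 W0) (hW2 : W2cond p W) :
    DoubleWell p W W0 := by
  obtain ⟨-, -, hC1, hW0, h1, h2, h3⟩ := hW1
  have hp0 : p ≠ 0 := by linarith
  have hd : Differentiable ℝ W := hW.differentiable (by norm_num)
  have e0 : W 0 = W0 := by
    have := eq_of_isLittleO_abs_rpow (h := fun u => u) hp (by norm_num) rfl h3
    simp [zero_rpow hp0] at this; linarith
  have e1 : W 1 = 0 := by
    have := eq_of_isLittleO_abs_rpow (h := fun u => u - 1) hp (by norm_num) (by norm_num) h1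
    simpa [zero_rpow hp0] using this
  have em1 : W (-1) = 0 := by
    have := eq_of_isLittleO_abs_rpow (h := fun u => u + 1) hp (by norm_num) (by norm_num) h2
    simpa [zero_rpow hp0] using this
  have hu := uniqueDiffOn_Icc (show (-1 : ℝ) < 1 by norm_num)
  have d1 : deriv W 1 = 0 :=
    deriv_eq_zero_of_isLittleO hp (hu 1 (by norm_num)) (hd 1) e1 h1
  have dm1 : deriv W (-1) = 0 :=
    deriv_eq_zero_of_isLittleO hp (hu (-1) (by norm_num)) (hd (-1)) em1
      (by simpa only [sub_neg_eq_add] using h2)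
  refine ⟨hW, hW0, e0, e1, em1, fun u hu => ?_, fun u hu => ?_, d1, dm1, ?_⟩
  · have := hW2.2 ⟨hu.1, hu.2.le⟩ ⟨one_pos, le_rfl⟩ hu.2
    simp only [d1, zero_div] at this
    have hphi : 0 < phip p u := mul_pos (rpow_pos_of_pos (abs_pos.2 hu.1.ne') _) hu.1
    by_contra! hcon
    exact absurd this (not_lt.2 (div_nonneg hcon hphi.le))
  · have := hW2.1 ⟨le_rfl, by norm_num⟩ ⟨hu.1.le, hu.2⟩ hu.1
    simp only [dm1, zero_div] at this
    have hphi : phip p u < 0 :=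
      mul_neg_of_pos_of_neg (rpow_pos_of_pos (abs_pos.2 hu.2.ne) _) hu.2
    by_contra! hcon
    exact absurd this (not_lt.2 (div_nonneg_of_nonpos hcon hphi.le))
  · have h := h1.def one_pos
    rw [eventually_nhdsWithin_iff, Metric.eventually_nhds_iff] at h
    obtain ⟨r, hr, h⟩ := h
    have hCp : 0 < C1 / p := div_pos hC1 (by linarith)
    refine ⟨C1 / p + 1, by linarith, r, hr, fun u hu hur => ?_⟩
    have hab : |u - 1| = 1 - u := by rw [abs_of_neg (by linarith [hu.2])]; ring
    have := h (y := u) (by rw [Real.dist_eq, hab]; linarith) ⟨by linarith [hu.1], hu.2.le⟩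
    rw [hab, Real.norm_eq_abs, Real.norm_eq_abs,
      abs_of_nonneg (rpow_nonneg (by linarith [hu.2]) _)] at this
    have := (abs_le.1 this).2
    linarith

namespace DoubleWell

variable {p : ℝ} {W : ℝ → ℝ} {W0 : ℝ}

lemma continuous (h : DoubleWell p W W0) : Continuous W := h.contDiff.continuous

lemma continuous_deriv (h : DoubleWell p W W0) : Continuous (deriv W) :=
  h.contDiff.continuous_deriv le_rfl

lemma hasDerivAt (h : DoubleWell p W W0) (u : ℝ) : HasDerivAt W (deriv W u) u :=
  (h.contDiff.differentiable (by norm_num) u).hasDerivAt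

lemma strictMonoOn (h : DoubleWell p W W0) : StrictMonoOn W (Icc (-1) 0) :=
  strictMonoOn_of_deriv_pos (convex_Icc _ _) h.continuous.continuousOn
    (by rw [interior_Icc]; exact h.deriv_pos)

lemma strictAntiOn (h : DoubleWell p W W0) : StrictAntiOn W (Icc 0 1) :=
  strictAntiOn_of_deriv_neg (convex_Icc _ _) h.continuous.continuousOn
    (by rw [interior_Icc]; exact h.deriv_neg)

lemma mem_range (h : DoubleWell p W W0) {u : ℝ} (hu : u ∈ Icc (-1 : ℝ) 1) :
    W u ∈ Icc 0 W0 := by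
  rw [← h.zero]
  rcases le_total u 0 with h0 | h0
  · refine ⟨?_, h.strictMonoOn.monotoneOn ⟨hu.1, h0⟩ ⟨by norm_num, le_rfl⟩ h0⟩
    rw [← h.neg_one]
    exact h.strictMonoOn.monotoneOn ⟨le_rfl, by norm_num⟩ ⟨hu.1, h0⟩ hu.1
  · refine ⟨?_, h.strictAntiOn.antitoneOn ⟨le_rfl, by norm_num⟩ ⟨h0, hu.2⟩ h0⟩
    rw [← h.one]
    exact h.strictAntiOn.antitoneOn ⟨h0, hu.2⟩ ⟨by norm_num, le_rfl⟩ hu.2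

lemma pos_of_mem_Ioo (h : DoubleWell p W W0) {u : ℝ} (hu : u ∈ Ioo (-1 : ℝ) 1) : 0 < W u := by
  rcases le_total u 0 with h0 | h0
  · rw [← h.neg_one]
    exact h.strictMonoOn ⟨le_rfl, by norm_num⟩ ⟨hu.1.le, h0⟩ hu.1
  · rw [← h.one]
    exact h.strictAntiOn ⟨h0, hu.2.le⟩ ⟨by norm_num, le_rfl⟩ hu.2

end DoubleWell
lemma hasDerivAt_integral_of_continuous {k : ℝ → ℝ} (hk : Continuous k) (a x : ℝ) :
    HasDerivAt (fun u => ∫ t in a..u, k t) (k x) x :=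
  integral_hasDerivAt_right (hk.intervalIntegrable _ _)
    hk.stronglyMeasurable.stronglyMeasurableAtFilter hk.continuousAt

/-- Solvability, with a free constant `κ`, of the linear equation `p* G f' + G' f = G - κ` on
`[α, β]` by a `C¹` function `f` that is constant outside `[α, β]`. -/
lemma exists_corrector {p : ℝ} (hp : 1 < p) {G G' : ℝ → ℝ} (hG : ∀ u, HasDerivAt G (G' u) u)
    (hG' : Continuous G') {α β : ℝ} (hαβ : α < β) (hpos : ∀ u ∈ Icc α β, 0 < G u)
    (hα : 0 < G' α) (hβ : G' β < 0) :
    ∃ (κ : ℝ) (f f' : ℝ → ℝ), Continuous f' ∧ (∀ u, HasDerivAt f (f' u) u) ∧ 0 ≤ κ ∧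
      κ ≤ max (G α) (G β) +
        (∫ u in α..β, G u ^ (1 - 1 / p)) / ∫ u in α..β, G u ^ (-(1 / p)) ∧
      (∀ u ∈ Icc α β, p / (p - 1) * G u * f' u + G' u * f u = G u - κ) ∧
      (∀ u ≤ α, f u = (G α - κ) / G' α ∧ f' u = 0) ∧
      (∀ u, β ≤ u → f u = (G β - κ) / G' β ∧ f' u = 0) := by
  have hGc : Continuous G := continuous_iff_continuousAt.2 fun u => (hG u).continuousAt
  set q : ℝ := p / (p - 1) with hq
  have hq1 : 1 < q := one_lt_conj hp
  have hq0 : q ≠ 0 := by linarith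
  have hpq : 1 - 1 / p = 1 / q := by
    have : p - 1 ≠ 0 := by linarith
    rw [hq]; field_simp
  let pr : ℝ → ℝ := fun u => max α (min β u)
  have hprc : Continuous pr := by fun_prop
  have hpr : ∀ u, pr u ∈ Icc α β := fun u =>
    ⟨le_max_left _ _, max_le hαβ.le (min_le_left _ _)⟩
  have hpr_id : ∀ u ∈ Icc α β, pr u = u := fun u hu => by
    simp only [pr]; rw [min_eq_right hu.2, max_eq_right hu.1]
  have hpr_le : ∀ u ≤ α, pr u = α := fun u hu => by
    simp only [pr]; rw [min_eq_right (hu.trans hαβ.le), max_eq_left hu]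
  have hpr_ge : ∀ u, β ≤ u → pr u = β := fun u hu => by
    simp only [pr]; rw [min_eq_left hu, max_eq_right hαβ.le]
  have hGpos : ∀ u, 0 < G (pr u) := fun u => hpos _ (hpr u)
  have hGprc : Continuous fun u => G (pr u) := hGc.comp hprc
  have hpow : ∀ c : ℝ, Continuous fun u => G (pr u) ^ c := fun c =>
    hGprc.rpow_const fun u => Or.inl (hGpos u).ne'
  set I0 := ∫ u in α..β, G u ^ (-(1 / p)) with hI0
  set I1 := ∫ u in α..β, G u ^ (1 - 1 / p) with hI1
  have hintegral : ∀ c : ℝ, ∫ u in α..β, G u ^ c = ∫ u in α..β, G (pr u) ^ c := fun c => by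
    refine integral_congr fun u hu => ?_
    rw [uIcc_of_le hαβ.le] at hu
    simp only [hpr_id u hu]
  have hI0pos : 0 < I0 := by
    rw [hI0, hintegral]
    exact intervalIntegral_pos_of_pos ((hpow _).intervalIntegrable _ _)
      (fun u => rpow_pos_of_pos (hGpos u) _) hαβ
  have hI1pos : 0 < I1 := by
    rw [hI1, hintegral]
    exact intervalIntegral_pos_of_pos ((hpow _).intervalIntegrable _ _)
      (fun u => rpow_pos_of_pos (hGpos u) _) hαβ
  have hGα := hpos α ⟨le_rfl, hαβ.le⟩
  have hGβ := hpos β ⟨hαβ.le, le_rfl⟩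
  set A1 := q * G α ^ (1 / q) / G' α with hA1
  set A2 := -(q * G β ^ (1 / q) / G' β) with hA2
  have hA1pos : 0 < A1 := by
    have := rpow_pos_of_pos hGα (1 / q)
    positivity
  have hA2pos : 0 < A2 := by
    have := rpow_pos_of_pos hGβ (1 / q)
    rw [hA2]
    exact neg_pos.2 (div_neg_of_pos_of_neg (by positivity) hβ)
  set κ := (G α * A1 + I1 + G β * A2) / (A1 + I0 + A2) with hκ
  have hD : 0 < A1 + I0 + A2 := by positivity
  have hκD : κ * (A1 + I0 + A2) = G α * A1 + I1 + G β * A2 := by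
    rw [hκ]; field_simp
  -- the exact solution on `[α, β]`
  let cα := (G α - κ) / G' α
  let cβ := (G β - κ) / G' β
  let h : ℝ → ℝ := fun u => 1 / q * (G (pr u) ^ (1 / q) - κ * G (pr u) ^ (-(1 / p)))
  have hh : Continuous h := by
    have := hpow (1 / q)
    have := hpow (-(1 / p))
    fun_prop
  let F : ℝ → ℝ := fun u => cα * G α ^ (1 / q) + ∫ t in α..u, h t
  have hF : ∀ u, HasDerivAt F (h u) u := fun u =>
    (hasDerivAt_integral_of_continuous hh α u).const_add _
  have hFc : Continuous F := continuous_iff_continuousAt.2 fun u => (hF u).continuousAt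
  have hFα : F α = cα * G α ^ (1 / q) := by simp [F]
  have hFβ : F β = cβ * G β ^ (1 / q) := by
    have e : ∫ t in α..β, h t = 1 / q * (I1 - κ * I0) := by
      rw [hI1, hI0, hintegral, hintegral, hpq]
      simp only [h]
      rw [intervalIntegral.integral_const_mul, intervalIntegral.integral_sub ((hpow _).intervalIntegrable _ _)
        (((hpow _).const_mul _).intervalIntegrable _ _), intervalIntegral.integral_const_mul]
    have e1 : cα * G α ^ (1 / q) = (G α - κ) * A1 / q := by
      simp only [cα, hA1]; field_simp
    have e2 : cβ * G β ^ (1 / q) = -((G β - κ) * A2 / q) := by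
      have := hβ.ne
      simp only [cβ, hA2]; field_simp
    simp only [F]
    rw [e, e1, e2]
    field_simp
    linarith
  let f0 : ℝ → ℝ := fun u => F u * G (pr u) ^ (-(1 / q))
  have hf0c : Continuous f0 := hFc.mul (hpow _)
  have hcancel : ∀ x : ℝ, 0 < x → x ^ (1 / q) * x ^ (-(1 / q)) = 1 := fun x hx => by
    rw [← rpow_add hx]; simp
  have hf0α : f0 α = cα := by
    simp only [f0]
    rw [hFα, hpr_id α ⟨le_rfl, hαβ.le⟩, mul_assoc, hcancel _ hGα, mul_one]
  have hf0β : f0 β = cβ := by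
    simp only [f0]
    rw [hFβ, hpr_id β ⟨hαβ.le, le_rfl⟩, mul_assoc, hcancel _ hGβ, mul_one]
  let k : ℝ → ℝ := fun u =>
    (G (pr u) - κ - G' (pr u) * f0 (pr u)) / (q * G (pr u))
  have hk : Continuous k := by
    refine Continuous.div ?_ ?_ fun u => mul_ne_zero hq0 (hGpos u).ne'
    · exact (hGprc.sub continuous_const).sub ((hG'.comp hprc).mul (hf0c.comp hprc))
    · exact continuous_const.mul hGprc
  have hk_le : ∀ u ≤ α, k u = 0 := fun u hu => by
    simp only [k, hpr_le u hu, hf0α, cα]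
    field_simp; simp
  have hk_ge : ∀ u, β ≤ u → k u = 0 := fun u hu => by
    have := hβ.ne
    simp only [k, hpr_ge u hu, hf0β, cβ]
    field_simp; simp
  have hf0d : ∀ u ∈ Ioo α β, HasDerivAt f0 (k u) u := fun u hu => by
    have hloc : (fun u => G (pr u)) =ᶠ[𝓝 u] G := by
      filter_upwards [Icc_mem_nhds hu.1 hu.2] with y hy
      rw [hpr_id y hy]
    have h1 : HasDerivAt (fun u => G (pr u)) (G' u) u := (hG u).congr_of_eventuallyEq hloc
    have h2 := (hF u).mul (h1.rpow_const (p := -(1 / q)) (Or.inl (hGpos u).ne'))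
    refine h2.congr_deriv ?_
    have hid := hpr_id u (Ioo_subset_Icc_self hu)
    have hx := hGpos u
    simp only [h, k, f0, hid] at hx ⊢
    have r1 : G u ^ (-(1 / q) - 1) = G u ^ (-(1 / q)) / G u := by
      rw [rpow_sub hx, rpow_one]
    have r2 : G u ^ (-(1 / p)) = G u ^ (1 / q) / G u := by
      rw [← hpq, ← rpow_sub_one hx.ne']; congr 1; ring
    have r3 := hcancel _ hx
    rw [r1, r2]
    field_simp
    have r4 : G u ^ (1 / q) * (G u - κ) * G u ^ (-(1 / q)) = G u - κ := by
      calc _ = (G u ^ (1 / q) * G u ^ (-(1 / q))) * (G u - κ) := by ring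
        _ = _ := by rw [r3, one_mul]
    simp only [one_div] at r4 ⊢
    linear_combination r4
  let f : ℝ → ℝ := fun u => cα + ∫ t in α..u, k t
  have hf_eq : ∀ u ∈ Icc α β, f u = f0 u := fun u hu => by
    have := integral_eq_sub_of_hasDerivAt_of_le hu.1 hf0c.continuousOn
      (fun x hx => hf0d x ⟨hx.1, hx.2.trans_le hu.2⟩) (hk.intervalIntegrable _ _)
    simp only [f]
    rw [this, hf0α]; ring
  have hfβ : f β = cβ := by rw [hf_eq β ⟨hαβ.le, le_rfl⟩, hf0β]
  refine ⟨κ, f, k, hk, fun u => (hasDerivAt_integral_of_continuous hk α u).const_add _,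
    by positivity, ?_, fun u hu => ?_, fun u hu => ⟨?_, hk_le u hu⟩, fun u hu => ⟨?_, hk_ge u hu⟩⟩
  · rw [hκ, div_le_iff₀ hD]
    have m1 := le_max_left (G α) (G β)
    have m2 := le_max_right (G α) (G β)
    set m := max (G α) (G β)
    have hm : 0 < m := hGα.trans_le m1
    have e : I1 = I1 / I0 * I0 := by field_simp
    have hr : 0 < I1 / I0 := by positivity
    nlinarith [mul_le_mul_of_nonneg_right m1 hA1pos.le, mul_le_mul_of_nonneg_right m2 hA2pos.le,
      mul_pos hm hI0pos, mul_pos hr hA1pos, mul_pos hr hA2pos]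
  · rw [hf_eq u hu]
    have hx := hpos u hu
    simp only [k, hpr_id u hu]
    field_simp
    ring
  · have : ∫ t in α..u, k t = 0 := by
      rw [integral_symm, neg_eq_zero]
      exact integral_zero_ae (ae_of_all _ fun t ht => hk_le t (by
        rw [uIoc_of_le hu] at ht; exact ht.2))
    simp only [f]
    rw [this, add_zero]
  · have : ∫ t in β..u, k t = 0 :=
      integral_zero_ae (ae_of_all _ fun t ht => hk_ge t (by
        rw [uIoc_of_le hu] at ht; exact ht.1.le))
    have h2 : f u = f β + ∫ t in β..u, k t := by
      simp only [f]
      rw [add_assoc, integral_add_adjacent_intervals (hk.intervalIntegrable _ _)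
        (hk.intervalIntegrable _ _)]
    rw [h2, this, hfβ, add_zero]
lemma exists_ratio_near_one {D : ℝ → ℝ} (hD : Continuous D) {c : ℝ} (hc : D c ≠ 0) {θ : ℝ}
    (hθ : 0 < θ) :
    ∃ r > 0, ∀ u v, |u - c| < r → |v - c| < r → |1 - D u / D v| ≤ θ := by
  have h1 : ContinuousAt (fun z : ℝ × ℝ => |1 - D z.1 / D z.2|) (c, c) := by
    have hdiv : ContinuousAt (fun z : ℝ × ℝ => D z.1 / D z.2) (c, c) :=
      ContinuousAt.div (hD.comp continuous_fst).continuousAt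
        (hD.comp continuous_snd).continuousAt hc
    exact (continuousAt_const.sub hdiv).abs
  have h2 : ∀ᶠ z in 𝓝 ((c, c) : ℝ × ℝ), |1 - D z.1 / D z.2| < θ :=
    h1.eventually_lt continuousAt_const (by simpa [div_self hc] using hθ)
  obtain ⟨r, hr, h⟩ := Metric.eventually_nhds_iff.1 h2
  refine ⟨r, hr, fun u v hu hv => (h (y := (u, v)) ?_).le⟩
  rw [Prod.dist_eq]
  exact max_lt hu hv

lemma exists_forall_abs_sub_lt_le {D : ℝ → ℝ} (hD : Continuous D) (c : ℝ) {η : ℝ} (hη : 0 < η) :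
    ∃ r > 0, ∀ u, |u - c| < r → D u - D c ≤ η := by
  obtain ⟨r, hr, h⟩ := Metric.continuousAt_iff.1 (hD.continuousAt (x := c)) η hη
  exact ⟨r, hr, fun u hu => (le_abs_self _).trans (h hu).le⟩

namespace DoubleWell

variable {p : ℝ} {W : ℝ → ℝ} {W0 : ℝ}

lemma exists_approx_corrector (h : DoubleWell p W W0) (hp : 1 < p) {ξ m α β M η B θ : ℝ}
    (hm : -1 ≤ m) (hmα : m < α) (hα : α < 0) (hβ : 0 < β) (hβM : β < M) (hM : M ≤ 1)
    (hWm : W m = ξ) (hWM : W M = ξ) (hWα : W α - ξ ≤ η) (hWβ : W β - ξ ≤ η)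
    (hB : max (W α - ξ) (W β - ξ) + (∫ u in α..β, (W u - ξ) ^ (1 - 1 / p)) /
      (∫ u in α..β, (W u - ξ) ^ (-(1 / p))) ≤ B)
    (hθ : θ ≤ 1) (hBθ : B * θ ≤ η)
    (hρα : ∀ u ∈ Icc m α, |1 - deriv W u / deriv W α| ≤ θ)
    (hρβ : ∀ u ∈ Icc β M, |1 - deriv W u / deriv W β| ≤ θ) :
    ∃ (κ : ℝ) (f f' : ℝ → ℝ), Continuous f' ∧ (∀ u, HasDerivAt f (f' u) u) ∧ 0 ≤ κ ∧ κ ≤ B ∧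
      ∀ u ∈ Icc m M, |p / (p - 1) * (W u - ξ) * f' u + deriv W u * f u - (W u - ξ - κ)|
        ≤ 4 * η := by
  have hleft : ∀ u ∈ Icc m 0, ξ ≤ W u := fun u hu => by
    rw [← hWm]
    exact h.strictMonoOn.monotoneOn ⟨hm, hu.1.trans hu.2⟩ ⟨hm.trans hu.1, hu.2⟩ hu.1
  have hright : ∀ u ∈ Icc 0 M, ξ ≤ W u := fun u hu => by
    rw [← hWM]
    exact h.strictAntiOn.antitoneOn ⟨hu.1, hu.2.trans hM⟩ ⟨hu.1.trans hu.2, hM⟩ hu.2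
  have hpos : ∀ u ∈ Icc α β, 0 < W u - ξ := fun u hu => by
    rw [sub_pos]
    rcases le_total u 0 with h0 | h0
    · rw [← hWm]
      exact h.strictMonoOn ⟨hm, by linarith⟩ ⟨by linarith [hu.1], h0⟩ (by linarith [hu.1])
    · rw [← hWM]
      exact h.strictAntiOn ⟨h0, by linarith [hu.2]⟩ ⟨by linarith, hM⟩ (by linarith [hu.2])
  obtain ⟨κ, f, f', hf'c, hf, hκ0, hκ, hmid, hl, hr⟩ :=
    exists_corrector hp (G := fun u => W u - ξ) (fun u => (h.hasDerivAt u).sub_const ξ)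
      h.continuous_deriv (hα.trans hβ) hpos (h.deriv_pos α ⟨by linarith, hα⟩)
      (h.deriv_neg β ⟨hβ, by linarith⟩)
  have hκB : κ ≤ B := hκ.trans hB
  have key : ∀ ρ g gα : ℝ, |1 - ρ| ≤ θ → 0 ≤ g → g ≤ gα → gα ≤ η →
      |ρ * (gα - κ) - (g - κ)| ≤ 4 * η := fun ρ g gα hρ hg hgα hη => by
    have e : ρ * (gα - κ) - (g - κ) = (ρ * gα - g) + κ * (1 - ρ) := by ring
    have b1 : |κ * (1 - ρ)| ≤ η := by
      rw [abs_mul, abs_of_nonneg hκ0]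
      exact (mul_le_mul hκB hρ (abs_nonneg _) (hκ0.trans hκB)).trans hBθ
    obtain ⟨b2, b3⟩ := abs_le.1 (hρ.trans hθ)
    have hgα0 : 0 ≤ gα := hg.trans hgα
    have b4 : |ρ * gα - g| ≤ 3 * η := by
      rw [abs_le]; constructor <;> nlinarith
    rw [e]
    exact (abs_add_le _ _).trans (by linarith)
  refine ⟨κ, f, f', hf'c, hf, hκ0, hκB, fun u hu => ?_⟩
  rcases le_total u α with h1 | h1
  · obtain ⟨e1, e2⟩ := hl u h1
    have := key (deriv W u / deriv W α) (W u - ξ) (W α - ξ) (hρα u ⟨hu.1, h1⟩)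
      (by linarith [hleft u ⟨hu.1, by linarith⟩]) (by
        have := h.strictMonoOn.monotoneOn ⟨hm.trans hu.1, by linarith⟩ ⟨by linarith, hα.le⟩ h1
        linarith) hWα
    rw [e1, e2]
    convert this using 2
    ring
  rcases le_total u β with h2 | h2
  · have hη : 0 ≤ η := by linarith [hpos α ⟨le_rfl, by linarith⟩]
    rw [hmid u ⟨h1, h2⟩, sub_self, abs_zero]; linarith
  · obtain ⟨e1, e2⟩ := hr u h2
    have := key (deriv W u / deriv W β) (W u - ξ) (W β - ξ) (hρβ u ⟨h2, hu.2⟩)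
      (by linarith [hright u ⟨by linarith, hu.2⟩]) (by
        have := h.strictAntiOn.antitoneOn ⟨hβ.le, by linarith⟩
          ⟨by linarith, hu.2.trans hM⟩ h2
        linarith) hWβ
    rw [e1, e2]
    convert this using 2
    ring

lemma exists_corrector_of_mem_Ioo (h : DoubleWell p W W0) (hp : 1 < p) {ξ : ℝ}
    (hξ : ξ ∈ Ioo 0 W0) {η : ℝ} (hη : 0 < η) :
    ∃ (κ : ℝ) (f f' : ℝ → ℝ), Continuous f' ∧ (∀ u, HasDerivAt f (f' u) u) ∧
      ∀ u ∈ Icc (-1 : ℝ) 1, ξ ≤ W u →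
        |p / (p - 1) * (W u - ξ) * f' u + deriv W u * f u - (W u - ξ - κ)| ≤ η := by
  have hW0 := h.pos
  obtain ⟨m, hm, hWm⟩ : ∃ m ∈ Ioo (-1 : ℝ) 0, W m = ξ :=
    intermediate_value_Ioo (by norm_num) h.continuous.continuousOn
      (by rw [h.neg_one, h.zero]; exact hξ)
  obtain ⟨M, hM, hWM⟩ : ∃ M ∈ Ioo (0 : ℝ) 1, W M = ξ :=
    intermediate_value_Ioo' (by norm_num) h.continuous.continuousOn
      (by rw [h.one, h.zero]; exact hξ)
  set η' := η / 4 with hη'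
  have hη'0 : 0 < η' := by positivity
  set θ := min 1 (η' / (2 * W0)) with hθ
  have hθ0 : 0 < θ := lt_min one_pos (by positivity)
  obtain ⟨r1, hr1, h1⟩ := exists_ratio_near_one h.continuous_deriv (h.deriv_pos m hm).ne' hθ0
  obtain ⟨r2, hr2, h2⟩ := exists_ratio_near_one h.continuous_deriv (h.deriv_neg M hM).ne hθ0
  obtain ⟨r3, hr3, h3⟩ := exists_forall_abs_sub_lt_le h.continuous m hη'0
  obtain ⟨r4, hr4, h4⟩ := exists_forall_abs_sub_lt_le h.continuous M hη'0
  obtain ⟨α, hmα, hα⟩ : ∃ α, m < α ∧ α < min (min (m + r1) (m + r3)) 0 :=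
    exists_between (lt_min (lt_min (by linarith) (by linarith)) hm.2)
  obtain ⟨β, hβ, hβM⟩ : ∃ β, max (max (M - r2) (M - r4)) 0 < β ∧ β < M :=
    exists_between (max_lt (max_lt (by linarith) (by linarith)) hM.1)
  simp only [lt_min_iff] at hα
  simp only [max_lt_iff] at hβ
  have habs : ∀ u ∈ Icc m α, |u - m| = u - m := fun u hu => abs_of_nonneg (by linarith [hu.1])
  have habs' : ∀ u ∈ Icc β M, |u - M| = M - u := fun u hu => by
    rw [abs_of_nonpos (by linarith [hu.2])]; ring
  have hαm : α ∈ Icc m α := ⟨hmα.le, le_rfl⟩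
  have hβm : β ∈ Icc β M := ⟨le_rfl, hβM.le⟩
  have hWα : W α - ξ ≤ η' := by
    rw [← hWm]; exact h3 α (by rw [habs α hαm]; linarith)
  have hWβ : W β - ξ ≤ η' := by
    rw [← hWM]; exact h4 β (by rw [habs' β hβm]; linarith)
  have hlt : α < β := hα.2.trans hβ.2
  have hpos : ∀ u ∈ Icc α β, 0 < W u - ξ := fun u hu => by
    rw [sub_pos]
    rcases le_total u 0 with h0 | h0
    · rw [← hWm]
      exact h.strictMonoOn ⟨hm.1.le, hm.2.le⟩ ⟨by linarith [hu.1, hm.1], h0⟩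
        (by linarith [hu.1])
    · rw [← hWM]
      exact h.strictAntiOn ⟨h0, by linarith [hu.2, hM.2]⟩ ⟨hM.1.le, hM.2.le⟩
        (by linarith [hu.2])
  have hc : ∀ c : ℝ, ContinuousOn (fun u => (W u - ξ) ^ c) (Icc α β) := fun c =>
    (h.continuous.sub continuous_const).continuousOn.rpow_const
      fun u hu => Or.inl (hpos u hu).ne'
  have hcI : ∀ c : ℝ, IntervalIntegrable (fun u => (W u - ξ) ^ c) volume α β := fun c =>
    (hc c).intervalIntegrable_of_Icc hlt.le
  have hle : ∀ u ∈ Icc α β, W u - ξ ≤ W0 := fun u hu => by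
    have := (h.mem_range (u := u) ⟨by linarith [hu.1, hm.1], by linarith [hu.2, hM.2]⟩).2
    linarith [hξ.1]
  have hI : (∫ u in α..β, (W u - ξ) ^ (1 - 1 / p)) ≤
      W0 * ∫ u in α..β, (W u - ξ) ^ (-(1 / p)) := by
    rw [← intervalIntegral.integral_const_mul]
    refine integral_mono_on hlt.le (hcI _) ((hcI _).const_mul _) fun u hu => ?_
    have e : (W u - ξ) ^ (1 - 1 / p) = (W u - ξ) * (W u - ξ) ^ (-(1 / p)) := by
      rw [sub_eq_add_neg 1, rpow_add (hpos u hu), rpow_one]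
    rw [e]
    exact mul_le_mul_of_nonneg_right (hle u hu) (rpow_nonneg (hpos u hu).le _)
  have hI0 : 0 < ∫ u in α..β, (W u - ξ) ^ (-(1 / p)) :=
    intervalIntegral_pos_of_pos_on (hcI _)
      (fun u hu => rpow_pos_of_pos (hpos u (Ioo_subset_Icc_self hu)) _) hlt
  obtain ⟨κ, f, f', hf', hf, -, -, hmain⟩ := h.exists_approx_corrector hp (B := 2 * W0) (θ := θ)
    hm.1.le hmα hα.2 hβ.2 hβM hM.2.le hWm hWM hWα hWβ
    (by
      have b1 := max_le (hle α ⟨le_rfl, hlt.le⟩) (hle β ⟨hlt.le, le_rfl⟩)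
      have b2 := (div_le_iff₀ hI0).2 hI
      linarith)
    (min_le_left _ _)
    (by
      have : θ ≤ η' / (2 * W0) := min_le_right _ _
      rw [le_div_iff₀ (by positivity)] at this
      linarith)
    (fun u hu => h1 u α (by rw [habs u hu]; linarith [hu.2]) (by rw [habs α hαm]; linarith))
    (fun u hu => h2 u β (by rw [habs' u hu]; linarith [hu.1]) (by rw [habs' β hβm]; linarith))
  refine ⟨κ, f, f', hf', hf, fun u hu hξu => (hmain u ⟨?_, ?_⟩).trans (by rw [hη']; linarith)⟩
  · by_contra! hlt
    have := h.strictMonoOn ⟨hu.1, by linarith [hm.2]⟩ ⟨hm.1.le, hm.2.le⟩ hlt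
    linarith
  · by_contra! hlt
    have := h.strictAntiOn ⟨hM.1.le, hM.2.le⟩ ⟨by linarith [hM.1], hu.2⟩ hlt
    linarith

lemma exists_le_integral (h : DoubleWell p W W0) (hp : 1 < p) (B : ℝ) :
    ∃ τ₀ ∈ Ioo (0 : ℝ) 1, ∀ τ ∈ Ioo τ₀ 1, B ≤ ∫ u in (0 : ℝ)..τ, W u ^ (-(1 / p)) := by
  obtain ⟨C, hC, r, hr, hflat⟩ := h.flat
  set s := max (1 - r) (1 / 2) with hs
  have hs0 : 0 < s := lt_max_of_lt_right (by norm_num)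
  have hs1 : s < 1 := max_lt (by linarith) (by norm_num)
  set c := C ^ (-(1 / p)) with hc
  have hc0 : 0 < c := rpow_pos_of_pos hC _
  have he : 0 < (1 - s) * exp (-(|B| / c)) := mul_pos (by linarith) (exp_pos _)
  have he1 : (1 - s) * exp (-(|B| / c)) ≤ 1 - s :=
    mul_le_of_le_one_right (by linarith) (exp_le_one_iff.2 (by
      have : 0 ≤ |B| / c := by positivity
      linarith))
  refine ⟨1 - (1 - s) * exp (-(|B| / c)), ⟨by linarith, by linarith⟩, fun τ hτ => ?_⟩
  have hsτ : s < τ := by linarith [hτ.1]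
  have hWpos : ∀ u ∈ Icc 0 τ, 0 < W u := fun u hu =>
    h.pos_of_mem_Ioo ⟨by linarith [hu.1], by linarith [hu.2, hτ.2]⟩
  have hcont : ContinuousOn (fun u => W u ^ (-(1 / p))) (Icc 0 τ) :=
    h.continuous.continuousOn.rpow_const fun u hu => Or.inl (hWpos u hu).ne'
  have i1 : IntervalIntegrable (fun u => W u ^ (-(1 / p))) volume 0 s :=
    (hcont.mono (Icc_subset_Icc_right hsτ.le)).intervalIntegrable_of_Icc hs0.le
  have i2 : IntervalIntegrable (fun u => W u ^ (-(1 / p))) volume s τ :=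
    (hcont.mono (Icc_subset_Icc_left hs0.le)).intervalIntegrable_of_Icc hsτ.le
  have i3 : ContinuousOn (fun u => c * (1 - u)⁻¹) (Icc s τ) := by
    refine continuousOn_const.mul (ContinuousOn.inv₀ (by fun_prop) fun u hu => ?_)
    linarith [hu.2, hτ.2]
  have b1 : 0 ≤ ∫ u in (0 : ℝ)..s, W u ^ (-(1 / p)) :=
    integral_nonneg hs0.le fun u hu =>
      rpow_nonneg (hWpos u ⟨hu.1, hu.2.trans hsτ.le⟩).le _
  have b2 : (∫ u in s..τ, c * (1 - u)⁻¹) ≤ ∫ u in s..τ, W u ^ (-(1 / p)) := by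
    refine integral_mono_on_of_le_Ioo hsτ.le (i3.intervalIntegrable_of_Icc hsτ.le) i2
      fun u hu => ?_
    have hu1 : 0 < 1 - u := by linarith [hu.2, hτ.2]
    have hu0 : 0 < u := hs0.trans hu.1
    have := hflat u ⟨hu0, by linarith⟩ ((le_max_left _ _).trans_lt hu.1)
    have h2 := rpow_le_rpow_of_nonpos (z := -(1 / p)) (hWpos u ⟨hu0.le, hu.2.le⟩) this
      (by rw [neg_nonpos]; positivity)
    refine le_of_eq_of_le ?_ h2
    rw [mul_rpow hC.le (rpow_nonneg hu1.le _), ← rpow_mul hu1.le]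
    have : p * (-(1 / p)) = -1 := by field_simp
    rw [this, rpow_neg_one]
  have b3 : ∫ u in s..τ, c * (1 - u)⁻¹ = -(c * log (1 - τ)) - -(c * log (1 - s)) := by
    refine integral_eq_sub_of_hasDerivAt (f := fun u => -(c * log (1 - u))) (fun u hu => ?_)
      (i3.intervalIntegrable_of_Icc hsτ.le)
    rw [uIcc_of_le hsτ.le] at hu
    have hne : 1 - u ≠ 0 := by linarith [hu.2, hτ.2]
    have := ((((hasDerivAt_id u).const_sub 1).log hne).const_mul c).neg
    refine this.congr_deriv ?_
    simp only [id]; field_simp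
  have b4 : log (1 - τ) ≤ log (1 - s) - |B| / c := by
    have := log_le_log (by linarith [hτ.2]) (show 1 - τ ≤ (1 - s) * exp (-(|B| / c)) by
      linarith [hτ.1])
    rw [log_mul (by linarith) (exp_pos _).ne', log_exp] at this
    linarith
  have b5 : c * log (1 - τ) ≤ c * log (1 - s) - |B| := by
    have := mul_le_mul_of_nonneg_left b4 hc0.le
    rwa [mul_sub, mul_div_cancel₀ _ hc0.ne'] at this
  rw [← integral_add_adjacent_intervals i1 i2]
  linarith [le_abs_self B]

lemma exists_corrector_zero (h : DoubleWell p W W0) (hp : 1 < p) {η : ℝ} (hη : 0 < η) :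
    ∃ f f' : ℝ → ℝ, Continuous f' ∧ (∀ u, HasDerivAt f (f' u) u) ∧
      ∀ u ∈ Icc (-1 : ℝ) 1,
        |p / (p - 1) * W u * f' u + deriv W u * f u - W u| ≤ η := by
  have hW0 := h.pos
  set η' := η / 10 with hη'
  have hη'0 : 0 < η' := by positivity
  set J := 2 * W0 ^ (1 - 1 / p) with hJ
  have hJ0 : 0 < J := by positivity
  obtain ⟨τ₀, hτ₀, hτint⟩ := h.exists_le_integral hp (J / η')
  obtain ⟨r3, hr3, h3⟩ := exists_forall_abs_sub_lt_le h.continuous (-1) hη'0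
  obtain ⟨r4, hr4, h4⟩ := exists_forall_abs_sub_lt_le h.continuous 1 hη'0
  obtain ⟨τ, hτ, hτ1⟩ : ∃ τ, max (max (1 - r3) (1 - r4)) τ₀ < τ ∧ τ < 1 :=
    exists_between (max_lt (max_lt (by linarith) (by linarith)) hτ₀.2)
  simp only [max_lt_iff] at hτ
  have hτ0 : 0 < τ := hτ₀.1.trans hτ.2
  obtain ⟨α, hα, hαmax⟩ := isCompact_Icc.exists_isMaxOn
    (nonempty_Icc.2 (show (-1 : ℝ) ≤ -τ by linarith)) h.continuous_deriv.continuousOn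
  obtain ⟨β, hβ, hβmin⟩ := isCompact_Icc.exists_isMinOn
    (nonempty_Icc.2 (show τ ≤ (1 : ℝ) by linarith)) h.continuous_deriv.continuousOn
  have hdα : 0 < deriv W α := (h.deriv_pos (-τ) ⟨by linarith, by linarith⟩).trans_le
    (hαmax (show -τ ∈ Icc (-1) (-τ) from ⟨by linarith, le_rfl⟩))
  have hdβ : deriv W β < 0 :=
    lt_of_le_of_lt (hβmin (show τ ∈ Icc τ 1 from ⟨le_rfl, by linarith⟩))
      (h.deriv_neg τ ⟨by linarith, by linarith⟩)
  have hα1 : -1 < α := lt_of_le_of_ne hα.1 fun e => by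
    rw [← e, h.deriv_neg_one] at hdα; exact hdα.false
  have hβ1 : β < 1 := lt_of_le_of_ne hβ.2 fun e => by
    rw [e, h.deriv_one] at hdβ; exact hdβ.false
  have hα0 : α < 0 := by linarith [hα.2]
  have hβ0 : 0 < β := by linarith [hβ.1]
  have hWα : W α - 0 ≤ η' := by
    have := h3 α (by rw [abs_of_nonneg (by linarith)]; linarith [hα.2])
    rwa [h.neg_one] at this
  have hWβ : W β - 0 ≤ η' := by
    have := h4 β (by rw [abs_of_nonpos (by linarith)]; linarith [hβ.1])
    rwa [h.one] at this
  have hlt : α < β := hα0.trans hβ0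
  have hpos : ∀ u ∈ Icc α β, 0 < W u := fun u hu =>
    h.pos_of_mem_Ioo ⟨by linarith [hu.1], by linarith [hu.2]⟩
  have hcI : ∀ c : ℝ, ∀ s ∈ Icc α β, ∀ t ∈ Icc α β, s ≤ t →
      IntervalIntegrable (fun u => W u ^ c) volume s t := fun c s hs t ht hst =>
    (h.continuous.continuousOn.rpow_const
      fun u hu => Or.inl (hpos u ⟨hs.1.trans hu.1, hu.2.trans ht.2⟩).ne').intervalIntegrable_of_Icc
        hst
  have mα : α ∈ Icc α β := ⟨le_rfl, hlt.le⟩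
  have mβ : β ∈ Icc α β := ⟨hlt.le, le_rfl⟩
  have m0 : (0 : ℝ) ∈ Icc α β := ⟨hα0.le, hβ0.le⟩
  have mτ : τ ∈ Icc α β := ⟨by linarith, hβ.1⟩
  have hI1 : (∫ u in α..β, W u ^ (1 - 1 / p)) ≤ J := by
    have hp1 : 0 ≤ 1 - 1 / p := by
      rw [sub_nonneg, div_le_one (by linarith)]; exact hp.le
    calc (∫ u in α..β, W u ^ (1 - 1 / p)) ≤ ∫ _ in α..β, W0 ^ (1 - 1 / p) := by
          refine integral_mono_on hlt.le (hcI _ α mα β mβ hlt.le) intervalIntegrable_const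
            fun u hu => rpow_le_rpow (hpos u hu).le ?_ hp1
          exact (h.mem_range ⟨by linarith [hu.1], by linarith [hu.2]⟩).2
      _ = (β - α) * W0 ^ (1 - 1 / p) := by
          rw [intervalIntegral.integral_const, smul_eq_mul]
      _ ≤ J := mul_le_mul_of_nonneg_right (by linarith) (rpow_nonneg hW0.le _)
  have hnn : ∀ s ∈ Icc α β, ∀ t ∈ Icc α β, s ≤ t → 0 ≤ ∫ u in s..t, W u ^ (-(1 / p)) :=
    fun s hs t ht hst => integral_nonneg hst fun u hu =>
      rpow_nonneg (hpos u ⟨hs.1.trans hu.1, hu.2.trans ht.2⟩).le _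
  have hI0 : J / η' ≤ ∫ u in α..β, W u ^ (-(1 / p)) := by
    rw [← integral_add_adjacent_intervals (hcI _ α mα 0 m0 hα0.le) (hcI _ 0 m0 β mβ hβ0.le),
      ← integral_add_adjacent_intervals (hcI _ 0 m0 τ mτ hτ0.le) (hcI _ τ mτ β mβ hβ.1)]
    have := hτint τ ⟨hτ.2, hτ1⟩
    linarith [hnn α mα 0 m0 hα0.le, hnn τ mτ β mβ hβ.1]
  have hratio : (∫ u in α..β, W u ^ (1 - 1 / p)) / (∫ u in α..β, W u ^ (-(1 / p))) ≤ η' := by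
    have h0 : 0 < J / η' := by positivity
    rw [div_le_iff₀ (h0.trans_le hI0)]
    refine hI1.trans ?_
    rwa [div_le_iff₀ hη'0, mul_comm] at hI0
  obtain ⟨κ, f, f', hf', hf, hκ0, hκ, hmain⟩ := h.exists_approx_corrector hp (ξ := 0)
    (η := 2 * η') (B := 2 * η') (θ := 1) le_rfl hα1 hα0 hβ0 hβ1 le_rfl h.neg_one h.one
    (by linarith) (by linarith)
    (by
      have := max_le hWα hWβ
      simp only [sub_zero] at this ⊢
      linarith)
    le_rfl (by linarith)
    (fun u hu => by
      have a1 : deriv W u ≤ deriv W α := hαmax (show u ∈ Icc (-1) (-τ) from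
        ⟨hu.1, hu.2.trans hα.2⟩)
      have a2 : 0 ≤ deriv W u := by
        rcases hu.1.eq_or_lt with e | e
        · rw [← e, h.deriv_neg_one]
        · exact (h.deriv_pos u ⟨e, by linarith [hu.2]⟩).le
      have b1 := div_nonneg a2 hdα.le
      have b2 := (div_le_one hdα).2 a1
      rw [abs_of_nonneg (by linarith)]; linarith)
    (fun u hu => by
      have a1 : deriv W β ≤ deriv W u := hβmin (show u ∈ Icc τ 1 from
        ⟨hβ.1.trans hu.1, hu.2⟩)
      have a2 : deriv W u ≤ 0 := by
        rcases hu.2.eq_or_lt with e | e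
        · rw [e, h.deriv_one]
        · exact (h.deriv_neg u ⟨by linarith [hu.1], e⟩).le
      have b1 := div_nonneg_of_nonpos a2 hdβ.le
      have b2 := (div_le_one_of_neg hdβ).2 a1
      rw [abs_of_nonneg (by linarith)]; linarith)
  refine ⟨f, f', hf', hf, fun u hu => ?_⟩
  have := abs_le.1 (hmain u hu)
  simp only [sub_zero] at this
  rw [abs_le]
  constructor <;> linarith [this.1, this.2]

end DoubleWell
/-- Averaging the corrector identity over a period shows that its constant is close to the mean
kinetic energy of the periodic orbit. -/
lemma abs_mean_sub_le {p : ℝ} (hp : 1 < p) {W v v' f f' : ℝ → ℝ} {ξ κ η T : ℝ}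
    (hW : Continuous W) (hW' : Continuous (deriv W)) (hW1 : W 1 < ξ) (hWm1 : W (-1) < ξ)
    (hf'c : Continuous f') (hf : ∀ u, HasDerivAt f (f' u) u)
    (hmain : ∀ u ∈ Icc (-1 : ℝ) 1, ξ ≤ W u →
      |p / (p - 1) * (W u - ξ) * f' u + deriv W u * f u - (W u - ξ - κ)| ≤ η)
    (hv : IsSolAuto p 1 W v v') (hen : ∀ x, -(1 / 1) * Lfun p (v' x) + W (v x) = ξ)
    (hv0 : v 0 = 0) (hT : 0 < T) (hper : Function.Periodic v T) :
    |1 / T * (∫ y in (0 : ℝ)..T, Lfun p (v' y)) - κ| ≤ η := by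
  obtain ⟨-, hvd, g, -, hg, hgeq⟩ := hv
  have hL : ∀ x, Lfun p (v' x) = W (v x) - ξ := fun x => by
    have := hen x; norm_num at this; linarith
  have hWv : ∀ x, ξ ≤ W (v x) := fun x => by
    have := Lfun_nonneg hp (v' x); rw [hL] at this; linarith
  have hvc : Continuous v := continuous_iff_continuousAt.2 fun x => (hvd x).continuousAt
  have hfc : Continuous f := continuous_iff_continuousAt.2 fun x => (hf x).continuousAt
  have hmem : ∀ x, v x ∈ Icc (-1 : ℝ) 1 := fun x => by
    by_contra hx
    rw [mem_Icc, not_and_or, not_le, not_le] at hx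
    have hiv := intermediate_value_univ 0 x hvc
    have hiv' := intermediate_value_univ x 0 hvc
    rcases hx with hx | hx
    · obtain ⟨y, hy⟩ := hiv' (show (-1 : ℝ) ∈ Icc (v x) (v 0) from ⟨hx.le, by rw [hv0]; norm_num⟩)
      have := hWv y
      rw [hy] at this; linarith
    · obtain ⟨y, hy⟩ := hiv (show (1 : ℝ) ∈ Icc (v 0) (v x) from ⟨by rw [hv0]; norm_num, hx.le⟩)
      have := hWv y
      rw [hy] at this; linarith
  have hv'T : v' T = v' 0 := by
    have h1 : HasDerivAt (fun x => v (x + T)) (v' (0 + T)) 0 :=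
      HasDerivAt.comp_add_const 0 T (hvd (0 + T))
    have h2 : (fun x => v (x + T)) = v := funext hper
    rw [h2, zero_add] at h1
    exact h1.unique (hvd 0)
  let Φ : ℝ → ℝ := fun u => p / (p - 1) * (W u - ξ) * f' u + deriv W u * f u
  have hΦc : Continuous Φ := by fun_prop
  have hd : ∀ x, HasDerivAt (fun y => f (v y) * phip p (v' y)) (Φ (v x)) x := fun x => by
    refine (((hf (v x)).comp x (hvd x)).mul (hg x)).congr_deriv ?_
    simp only [Φ, hgeq, Function.comp_apply]
    linear_combination f' (v x) * mul_phip_eq_Lfun hp (v' x) + p / (p - 1) * f' (v x) * hL x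
  have hintegral : ∫ y in (0 : ℝ)..T, Φ (v y) = 0 := by
    rw [integral_eq_sub_of_hasDerivAt (fun x _ => hd x)
      ((hΦc.comp hvc).intervalIntegrable _ _)]
    have : v T = v 0 := by simpa using hper 0
    rw [this, hv'T, sub_self]
  have hLc : Continuous fun y => W (v y) - ξ := by fun_prop
  have hR : |∫ y in (0 : ℝ)..T, (Φ (v y) - (W (v y) - ξ - κ))| ≤ η * |T - 0| := by
    rw [← Real.norm_eq_abs]
    exact norm_integral_le_of_norm_le_const fun y _ => hmain (v y) (hmem y) (hWv y)
  have iΦ : IntervalIntegrable (fun y => Φ (v y)) volume 0 T :=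
    (hΦc.comp hvc).intervalIntegrable _ _
  have iL : IntervalIntegrable (fun y => W (v y) - ξ - κ) volume 0 T :=
    (hLc.sub continuous_const).intervalIntegrable _ _
  rw [intervalIntegral.integral_sub iΦ iL, hintegral,
    intervalIntegral.integral_sub (hLc.intervalIntegrable _ _) intervalIntegrable_const,
    intervalIntegral.integral_const, sub_zero, abs_of_pos hT, smul_eq_mul, zero_sub, abs_neg] at hR
  simp only [hL]
  have e : 1 / T * (∫ y in (0 : ℝ)..T, W (v y) - ξ) - κ
      = ((∫ y in (0 : ℝ)..T, W (v y) - ξ) - T * κ) / T := by field_simp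
  rw [e, abs_div, abs_of_pos hT, div_le_iff₀ hT]
  exact hR

lemma DoubleWell.exists_corrector_mean {p : ℝ} {W : ℝ → ℝ} {W0 : ℝ} (h : DoubleWell p W W0)
    (hp : 1 < p) {T K : ℝ → ℝ}
    (hTK : ∀ ξ ∈ Set.Ioo 0 W0, ∃ v v' : ℝ → ℝ,
      IsSolAuto p 1 W v v' ∧ (∀ x, -(1 / 1) * Lfun p (v' x) + W (v x) = ξ) ∧
      v 0 = 0 ∧ 0 < v' 0 ∧
      IsLeast {c : ℝ | 0 < c ∧ Function.Periodic v c} (T ξ) ∧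
      K ξ = (1 / T ξ) * ∫ y in (0:ℝ)..(T ξ), Lfun p (v' y))
    (hK0 : K 0 = 0) (hKW0 : K W0 = 0) {ξ : ℝ} (hξ : ξ ∈ Icc 0 W0) {η : ℝ} (hη : 0 < η) :
    ∃ f f' : ℝ → ℝ, Continuous f' ∧ (∀ u, HasDerivAt f (f' u) u) ∧
      ∀ u ∈ Icc (-1 : ℝ) 1, ξ ≤ W u →
        |p / (p - 1) * (W u - ξ) * f' u + deriv W u * f u - (W u - ξ - K ξ)| ≤ η := by
  rcases hξ.1.eq_or_lt with rfl | h0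
  · obtain ⟨f, f', hf', hf, hmain⟩ := h.exists_corrector_zero hp hη
    exact ⟨f, f', hf', hf, fun u hu _ => by simpa [hK0] using hmain u hu⟩
  rcases hξ.2.eq_or_lt with rfl | h1
  · refine ⟨fun _ => 0, fun _ => 0, continuous_const, fun u => hasDerivAt_const u _,
      fun u hu hu' => ?_⟩
    have : W u = ξ := le_antisymm (h.mem_range hu).2 hu'
    simp [this, hKW0, hη.le]
  obtain ⟨κ, f, f', hf', hf, hmain⟩ := h.exists_corrector_of_mem_Ioo hp ⟨h0, h1⟩ (half_pos hη)
  obtain ⟨v, v', hv, hen, hv0, -, hT, hK⟩ := hTK ξ ⟨h0, h1⟩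
  have hm := abs_mean_sub_le hp h.continuous h.continuous_deriv (by rwa [h.one])
    (by rwa [h.neg_one]) hf' hf hmain hv hen hv0 hT.1.1 hT.1.2
  rw [← hK] at hm
  refine ⟨f, f', hf', hf, fun u hu hu' => ?_⟩
  have := abs_le.1 (hmain u hu hu')
  have := abs_le.1 hm
  rw [abs_le]
  constructor <;> linarith
lemma energy_eq {p ε x : ℝ} {a W u u' : ℝ → ℝ} :
    W (u x) - Ener p ε a W u u' x = Lfun p (ε * u' x) / a x := by
  rw [Ener]; ring

lemma hasDerivWithinAt_energy {p : ℝ} (hp : 1 < p) {ε : ℝ} {a W u u' : ℝ → ℝ} {W0 : ℝ}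
    (hW : DoubleWell p W W0) (ha : Differentiable ℝ a) (hapos : ∀ x ∈ Icc (0 : ℝ) 1, 0 < a x)
    (hsol : IsNeumann p ε a W u u') {x : ℝ} (hx : x ∈ Icc (0 : ℝ) 1) :
    HasDerivWithinAt (Ener p ε a W u u')
      (deriv a x / a x * (W (u x) - Ener p ε a W u u' x)) (Icc 0 1) x := by
  obtain ⟨⟨-, hu, g, -, hg, hgeq⟩, -, -⟩ := hsol
  have hax := hapos x hx
  have h1 := (hg x hx).Lfun_of_phip hp
  have h2 := (ha x).hasDerivAt.hasDerivWithinAt (s := Icc (0 : ℝ) 1)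
  have h3 := (hW.hasDerivAt (u x)).comp_hasDerivWithinAt x (hu x hx)
  have h4 := h3.sub (h1.div h2 hax.ne')
  have e : Ener p ε a W u u' = fun y => W (u y) - Lfun p (ε * u' y) / a y := by
    funext y; rw [Ener]; ring
  rw [energy_eq, e]
  refine h4.congr_deriv ?_
  have h5 : ε * u' x * g x = u' x * (a x * deriv W (u x)) := by rw [← hgeq x hx]; ring
  rw [h5]
  field_simp
  ring

lemma hasDerivWithinAt_corrector {p : ℝ} (hp : 1 < p) {ε : ℝ} {a W u u' f f' : ℝ → ℝ}
    (ha : Differentiable ℝ a) (hapos : ∀ x ∈ Icc (0 : ℝ) 1, 0 < a x)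
    (hf : ∀ u, HasDerivAt f (f' u) u)
    (hsol : IsNeumann p ε a W u u') {x : ℝ} (hx : x ∈ Icc (0 : ℝ) 1) :
    HasDerivWithinAt (fun y => ε * (f (u y) * phip p (ε * u' y) / a y))
      (p / (p - 1) * (W (u x) - Ener p ε a W u u' x) * f' (u x) + deriv W (u x) * f (u x)
        - ε * (f (u x) * phip p (ε * u' x) * (deriv a x / a x ^ 2))) (Icc 0 1) x := by
  obtain ⟨⟨-, hu, g, -, hg, hgeq⟩, -, -⟩ := hsol
  have hax := hapos x hx
  have h1 := ((hf (u x)).comp_hasDerivWithinAt x (hu x hx)).mul (hg x hx)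
  have h2 := (ha x).hasDerivAt.hasDerivWithinAt (s := Icc (0 : ℝ) 1)
  refine ((h1.div h2 hax.ne').const_mul ε).congr_deriv ?_
  have h3 := mul_phip_eq_Lfun hp (ε * u' x)
  have h4 := hgeq x hx
  rw [energy_eq]
  have h5 : p / (p - 1) * (Lfun p (ε * u' x) / a x)
      = ε * u' x * phip p (ε * u' x) / a x := by rw [h3]; ring
  have h6 : deriv W (u x) = ε * g x / a x := by rw [h4]; field_simp
  rw [h5, h6]
  simp only [Pi.mul_apply, Function.comp_apply]
  field_simp

/-- Neumann solutions `u n` for parameters `ε n → 0⁺` whose energies converge uniformly to `E`. -/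
structure NeumannSeq (p : ℝ) (a W : ℝ → ℝ) (W0 : ℝ) (ε : ℕ → ℝ) (u u' : ℕ → ℝ → ℝ)
    (E : ℝ → ℝ) : Prop where
  one_lt : 1 < p
  contDiff : ContDiff ℝ 1 a
  pos : ∀ x ∈ Icc (0 : ℝ) 1, 0 < a x
  well : DoubleWell p W W0
  eps_pos : ∀ n, 0 < ε n
  eps_tendsto : Tendsto ε atTop (𝓝 0)
  range : ∀ n, ∀ x ∈ Icc (0 : ℝ) 1, u n x ∈ Icc (-1 : ℝ) 1
  sol : ∀ n, IsNeumann p (ε n) a W (u n) (u' n)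
  conv : TendstoUniformlyOn (fun n x => Ener p (ε n) a W (u n) (u' n) x) E atTop (Icc 0 1)

namespace NeumannSeq

variable {p : ℝ} {a W : ℝ → ℝ} {W0 : ℝ} {ε : ℕ → ℝ} {u u' : ℕ → ℝ → ℝ} {E : ℝ → ℝ}

lemma differentiable (h : NeumannSeq p a W W0 ε u u' E) : Differentiable ℝ a :=
  h.contDiff.differentiable (by norm_num)

lemma continuousOn (h : NeumannSeq p a W W0 ε u u' E) : ContinuousOn E (Icc 0 1) :=
  h.conv.continuousOn (Eventually.frequently (Eventually.of_forall fun n _ hx =>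
    (hasDerivWithinAt_energy h.one_lt h.well h.differentiable h.pos (h.sol n)
      hx).continuousWithinAt))

lemma energy_le (h : NeumannSeq p a W W0 ε u u' E) (n : ℕ) {x : ℝ} (hx : x ∈ Icc (0 : ℝ) 1) :
    Ener p (ε n) a W (u n) (u' n) x ≤ W (u n x) := by
  have := div_nonneg (Lfun_nonneg h.one_lt (ε n * u' n x)) (h.pos x hx).le
  rw [← energy_eq (W := W) (u := u n)] at this
  linarith

lemma tendsto_energy (h : NeumannSeq p a W W0 ε u u' E) {x : ℝ} (hx : x ∈ Icc (0 : ℝ) 1) :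
    Tendsto (fun n => Ener p (ε n) a W (u n) (u' n) x) atTop (𝓝 (E x)) :=
  h.conv.tendsto_at hx

lemma le_max (h : NeumannSeq p a W W0 ε u u' E) {x : ℝ} (hx : x ∈ Icc (0 : ℝ) 1) : E x ≤ W0 :=
  le_of_tendsto' (h.tendsto_energy hx) fun n =>
    (h.energy_le n hx).trans (h.well.mem_range (h.range n x hx)).2

lemma eventually_energy_near (h : NeumannSeq p a W W0 ε u u' E) {x₀ : ℝ}
    (hx₀ : x₀ ∈ Icc (0 : ℝ) 1) {δ : ℝ} (hδ : 0 < δ) :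
    ∃ r > 0, ∀ᶠ n in atTop, ∀ x ∈ Icc (0 : ℝ) 1, |x - x₀| ≤ r →
      |Ener p (ε n) a W (u n) (u' n) x - E x₀| ≤ δ := by
  obtain ⟨r, hr, hE⟩ := Metric.continuousWithinAt_iff.1 (h.continuousOn x₀ hx₀) (δ / 2)
    (half_pos hδ)
  refine ⟨r / 2, half_pos hr, ?_⟩
  filter_upwards [Metric.tendstoUniformlyOn_iff.1 h.conv (δ / 2) (half_pos hδ)] with n hn x hx hxr
  have h1 := hn x hx
  have h2 := hE hx (by rw [Real.dist_eq]; linarith)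
  rw [dist_comm, Real.dist_eq] at h1
  rw [Real.dist_eq] at h2
  have := abs_sub_le (Ener p (ε n) a W (u n) (u' n) x) (E x) (E x₀)
  linarith

/-- Near `x₀`, the function `ε f(u) φ_p(εu') / a` is uniformly small while its derivative is
uniformly close to `p* (W(u) - E(x₀)) f'(u) + W'(u) f(u)`. -/
lemma eventually_corrector (h : NeumannSeq p a W W0 ε u u' E) {f f' : ℝ → ℝ}
    (hf'c : Continuous f') (hf : ∀ u, HasDerivAt f (f' u) u) {x₀ : ℝ}
    (hx₀ : x₀ ∈ Icc (0 : ℝ) 1) {η : ℝ} (hη : 0 < η) :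
    ∃ r > 0, ∃ C : ℝ, ∃ P D : ℕ → ℝ → ℝ, ∀ᶠ n in atTop, ∀ x ∈ Icc (0 : ℝ) 1, |x - x₀| ≤ r →
      |Ener p (ε n) a W (u n) (u' n) x - E x₀| ≤ η ∧
      |P n x| ≤ C * ε n ∧ HasDerivWithinAt (P n) (D n x) (Icc 0 1) x ∧
      |D n x - (p / (p - 1) * (W (u n x) - E x₀) * f' (u n x) + deriv W (u n x) * f (u n x))|
        ≤ η := by
  have hp := h.one_lt
  have hq := one_lt_conj hp
  set q := p / (p - 1) with hqdef
  have hfc : Continuous f := continuous_iff_continuousAt.2 fun x => (hf x).continuousAt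
  have hac : Continuous a := h.contDiff.continuous
  have hda : Continuous (deriv a) := h.contDiff.continuous_deriv le_rfl
  obtain ⟨c1, hc1⟩ := (isCompact_Icc (a := (-1 : ℝ)) (b := 1)).exists_bound_of_continuousOn
    hfc.continuousOn
  obtain ⟨c2, hc2⟩ := (isCompact_Icc (a := (-1 : ℝ)) (b := 1)).exists_bound_of_continuousOn
    hf'c.continuousOn
  obtain ⟨c3, hc3⟩ := (isCompact_Icc (a := (0 : ℝ)) (b := 1)).exists_bound_of_continuousOn
    hac.continuousOn
  obtain ⟨c4, hc4⟩ := (isCompact_Icc (a := (0 : ℝ)) (b := 1)).exists_bound_of_continuousOn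
    (f := fun x => 1 / a x)
    (continuousOn_const.div hac.continuousOn fun x hx => (h.pos x hx).ne')
  obtain ⟨c5, hc5⟩ := (isCompact_Icc (a := (0 : ℝ)) (b := 1)).exists_bound_of_continuousOn
    (f := fun x => deriv a x / a x ^ 2)
    (hda.continuousOn.div (hac.pow 2).continuousOn fun x hx => (pow_pos (h.pos x hx) 2).ne')
  simp only [Real.norm_eq_abs] at hc1 hc2 hc3 hc4 hc5
  have z1 : (0 : ℝ) ∈ Icc (-1 : ℝ) 1 := by norm_num
  have z2 : (0 : ℝ) ∈ Icc (0 : ℝ) 1 := by norm_num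
  have p1 : 0 ≤ c1 := (abs_nonneg _).trans (hc1 0 z1)
  have p2 : 0 ≤ c2 := (abs_nonneg _).trans (hc2 0 z1)
  have p3 : 0 ≤ c3 := (abs_nonneg _).trans (hc3 0 z2)
  have p4 : 0 ≤ c4 := (abs_nonneg _).trans (hc4 0 z2)
  have p5 : 0 ≤ c5 := (abs_nonneg _).trans (hc5 0 z2)
  set Q := 1 + q * (c3 * (W0 + |E x₀| + 1)) with hQ
  have hW0 := h.well.pos
  have hQ0 : 0 ≤ Q := by positivity
  set δ := min 1 (min η (η / (2 * (q * c2 + 1)))) with hδdef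
  have hδ : 0 < δ := by positivity
  obtain ⟨r, hr, hE⟩ := h.eventually_energy_near hx₀ hδ
  have hε : ∀ᶠ n in atTop, c1 * Q * c5 * ε n < η / 2 := by
    have : Tendsto (fun n => c1 * Q * c5 * ε n) atTop (𝓝 (c1 * Q * c5 * 0)) :=
      h.eps_tendsto.const_mul _
    rw [mul_zero] at this
    exact this.eventually_lt_const (half_pos hη)
  refine ⟨r, hr, c1 * Q * c4, fun n y => ε n * (f (u n y) * phip p (ε n * u' n y) / a y),
    fun n x => q * (W (u n x) - Ener p (ε n) a W (u n) (u' n) x) * f' (u n x)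
      + deriv W (u n x) * f (u n x)
        - ε n * (f (u n x) * phip p (ε n * u' n x) * (deriv a x / a x ^ 2)), ?_⟩
  filter_upwards [hE, hε] with n hEn hεn x hx hxr
  have hd := hEn x hx hxr
  have d1 : |Ener p (ε n) a W (u n) (u' n) x - E x₀| ≤ 1 := hd.trans (min_le_left _ _)
  have d2 : |Ener p (ε n) a W (u n) (u' n) x - E x₀| ≤ η :=
    hd.trans ((min_le_right _ _).trans (min_le_left _ _))
  have d3 : |Ener p (ε n) a W (u n) (u' n) x - E x₀| ≤ η / (2 * (q * c2 + 1)) :=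
    hd.trans ((min_le_right _ _).trans (min_le_right _ _))
  have hux := h.range n x hx
  have hεpos := h.eps_pos n
  have hphi : |phip p (ε n * u' n x)| ≤ Q := by
    set s := ε n * u' n x with hs
    have b1 : |s| ^ p ≤ q * (c3 * (W0 + |E x₀| + 1)) := by
      have e1 : |s| ^ p = q * (a x * (W (u n x) - Ener p (ε n) a W (u n) (u' n) x)) := by
        have := (h.pos x hx).ne'
        rw [energy_eq, ← mul_phip hp, mul_phip_eq_Lfun hp, mul_div_cancel₀ _ this]
      rw [e1]
      have e2 := h.energy_le n hx
      have e3 := (h.well.mem_range hux).2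
      have e4 := (le_abs_self _).trans (hc3 x hx)
      have e5 := neg_abs_le (E x₀)
      have e6 := (abs_le.1 d1).1
      refine mul_le_mul_of_nonneg_left ?_ (by linarith)
      exact mul_le_mul e4 (by linarith) (by linarith) p3
    rw [abs_phip hp, hQ]
    rcases le_total |s| 1 with hs1 | hs1
    · have := rpow_le_one (abs_nonneg s) hs1 (by linarith : 0 ≤ p - 1)
      have := (rpow_nonneg (abs_nonneg s) p).trans b1
      linarith
    · have := rpow_le_rpow_of_exponent_le hs1 (by linarith : p - 1 ≤ p)
      linarith
  have hfphi : |f (u n x) * phip p (ε n * u' n x)| ≤ c1 * Q := by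
    rw [abs_mul]; exact mul_le_mul (hc1 _ hux) hphi (abs_nonneg _) p1
  refine ⟨d2, ?_, hasDerivWithinAt_corrector hp h.differentiable h.pos hf (h.sol n) hx, ?_⟩
  · rw [abs_mul, abs_of_pos hεpos, div_eq_mul_one_div, abs_mul, mul_comm]
    exact mul_le_mul_of_nonneg_right
      (mul_le_mul hfphi (hc4 x hx) (abs_nonneg _) (by positivity)) hεpos.le
  · have e : q * (W (u n x) - Ener p (ε n) a W (u n) (u' n) x) * f' (u n x)
        + deriv W (u n x) * f (u n x)
        - ε n * (f (u n x) * phip p (ε n * u' n x) * (deriv a x / a x ^ 2))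
        - (q * (W (u n x) - E x₀) * f' (u n x) + deriv W (u n x) * f (u n x))
        = -(q * f' (u n x) * (Ener p (ε n) a W (u n) (u' n) x - E x₀))
          + -(f (u n x) * phip p (ε n * u' n x) * (deriv a x / a x ^ 2) * ε n) := by ring
    rw [e]
    have t1 : |q * f' (u n x) * (Ener p (ε n) a W (u n) (u' n) x - E x₀)| ≤ η / 2 := by
      rw [abs_mul, abs_mul, abs_of_pos (by linarith : 0 < q)]
      have m1 : q * |f' (u n x)| ≤ q * c2 + 1 := by
        have := mul_le_mul_of_nonneg_left (hc2 _ hux) (by linarith : 0 ≤ q)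
        linarith
      refine (mul_le_mul m1 d3 (abs_nonneg _) (by positivity)).trans (le_of_eq ?_)
      have : q * c2 + 1 ≠ 0 := by positivity
      field_simp
    have t2 : |f (u n x) * phip p (ε n * u' n x) * (deriv a x / a x ^ 2) * ε n| ≤ η / 2 := by
      rw [abs_mul, abs_mul, abs_of_pos hεpos]
      exact (mul_le_mul_of_nonneg_right
        (mul_le_mul hfphi (hc5 x hx) (abs_nonneg _) (by positivity)) hεpos.le).trans hεn.le
    refine (abs_add_le _ _).trans ?_
    rw [abs_neg, abs_neg]; linarith

lemma exists_ne_near {x r : ℝ} (hx : x ∈ Icc (0 : ℝ) 1) (hr : 0 < r) :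
    ∃ y ∈ Icc (0 : ℝ) 1, y ≠ x ∧ |y - x| ≤ r := by
  rcases hx.2.eq_or_lt with rfl | h1
  · refine ⟨max 0 (1 - r), ⟨le_max_left _ _, max_le (by norm_num) (by linarith)⟩,
      (max_lt (by norm_num) (by linarith)).ne, ?_⟩
    rw [abs_of_nonpos (sub_nonpos.2 (max_le (by norm_num) (by linarith)))]
    linarith [le_max_right 0 (1 - r)]
  · have h2 : x < min 1 (x + r) := lt_min h1 (by linarith)
    refine ⟨min 1 (x + r), ⟨hx.1.trans h2.le, min_le_left _ _⟩, h2.ne', ?_⟩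
    rw [abs_of_pos (sub_pos.2 h2)]
    linarith [min_le_right 1 (x + r)]

lemma nonneg (h : NeumannSeq p a W W0 ε u u' E) {x₀ : ℝ} (hx₀ : x₀ ∈ Icc (0 : ℝ) 1) :
    0 ≤ E x₀ := by
  by_contra! hneg
  have hq := one_lt_conj h.one_lt
  set q := p / (p - 1) with hqdef
  obtain ⟨B, hB⟩ := (isCompact_Icc (a := (-1 : ℝ)) (b := 1)).exists_bound_of_continuousOn
    h.well.continuous_deriv.continuousOn
  simp only [Real.norm_eq_abs] at hB
  have hB0 : 0 ≤ B := (abs_nonneg _).trans (hB 0 (by norm_num))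
  set l := (B + 1) / (q * -E x₀) with hl
  have hqE : 0 < q * -E x₀ := mul_pos (by linarith) (by linarith)
  have hl0 : 0 < l := by positivity
  have hf : ∀ u : ℝ, HasDerivAt (fun u => exp (l * u)) (l * exp (l * u)) u := fun u => by
    have := ((hasDerivAt_id u).const_mul l).exp
    simpa [mul_comm] using this
  have hc : 0 < exp (-l) := exp_pos _
  obtain ⟨r, hr, C, P, D, hev⟩ := h.eventually_corrector
    (f' := fun u => l * exp (l * u)) (by fun_prop) hf hx₀ (half_pos hc)
  obtain ⟨y₀, hy₀, hne, hyr⟩ := exists_ne_near hx₀ hr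
  set s := min x₀ y₀ with hs
  set t := max x₀ y₀ with ht
  have hst : s < t := min_lt_max.2 hne.symm
  have hsub : Icc s t ⊆ Icc (0 : ℝ) 1 :=
    Icc_subset_Icc (le_min hx₀.1 hy₀.1) (max_le hx₀.2 hy₀.2)
  have hnear : ∀ x ∈ Icc s t, |x - x₀| ≤ r := fun x hx =>
    (abs_sub_left_of_mem_uIcc (show x ∈ uIcc x₀ y₀ from hx)).trans hyr
  have hfinal : ∀ᶠ n in atTop, exp (-l) / 2 * (t - s) ≤ 2 * C * ε n := by
    filter_upwards [hev] with n hn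
    have hmono : MonotoneOn (fun x => P n x - exp (-l) / 2 * x) (Icc s t) := by
      have hder : ∀ x ∈ Icc s t, HasDerivWithinAt (fun x => P n x - exp (-l) / 2 * x)
          (D n x - exp (-l) / 2) (Icc s t) x := fun x hx => by
        have h1 := ((hn x (hsub hx) (hnear x hx)).2.2.1).mono hsub
        have h2 := ((hasDerivAt_id x).const_mul (exp (-l) / 2)).hasDerivWithinAt (s := Icc s t)
        exact (h1.sub h2).congr_deriv (by rw [mul_one])
      refine monotoneOn_of_hasDerivWithinAt_nonneg (f' := fun x => D n x - exp (-l) / 2)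
        (convex_Icc _ _) (fun x hx => (hder x hx).continuousWithinAt)
        (fun x hx => (hder x (interior_subset hx)).mono interior_subset) fun x hx => ?_
      have hx' := interior_subset hx
      have hux := h.range n x (hsub hx')
      have h1 := (abs_le.1 (hn x (hsub hx') (hnear x hx')).2.2.2).1
      have h2 := (h.well.mem_range hux).1
      have h3 := neg_le_of_abs_le (hB _ hux)
      have h4 : exp (-l) ≤ exp (l * u n x) := exp_le_exp.2 (by nlinarith [hux.1])
      have h5 : q * -E x₀ * l = B + 1 := by rw [hl, mul_div_cancel₀ _ hqE.ne']
      have h6 : q * -E x₀ * l ≤ q * (W (u n x) - E x₀) * l :=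
        mul_le_mul_of_nonneg_right
          (mul_le_mul_of_nonneg_left (by linarith) (by linarith)) hl0.le
      have h7 : exp (l * u n x) ≤ q * (W (u n x) - E x₀) * (l * exp (l * u n x))
          + deriv W (u n x) * exp (l * u n x) := by
        have := mul_le_mul_of_nonneg_right
          (show 1 ≤ q * (W (u n x) - E x₀) * l + deriv W (u n x) by linarith)
          (exp_pos (l * u n x)).le
        linarith
      linarith
    have ms : s ∈ Icc s t := ⟨le_rfl, hst.le⟩
    have mt : t ∈ Icc s t := ⟨hst.le, le_rfl⟩
    have h1 := hmono ms mt hst.le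
    have h2 := (abs_le.1 (hn s (hsub ms) (hnear s ms)).2.1).1
    have h3 := (abs_le.1 (hn t (hsub mt) (hnear t mt)).2.1).2
    simp only at h1
    linarith
  have hlim : Tendsto (fun n => 2 * C * ε n) atTop (𝓝 (2 * C * 0)) := h.eps_tendsto.const_mul _
  have := ge_of_tendsto hlim hfinal
  have := mul_pos (half_pos hc) (sub_pos.2 hst)
  linarith

lemma exists_slack {W R : ℝ → ℝ} (hW : Continuous W) (hR : Continuous R) {S : Set ℝ}
    (hS : IsCompact S) {ξ η : ℝ} (hη : 0 < η) (h : ∀ u ∈ S, ξ ≤ W u → |R u| ≤ η) :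
    ∃ δ > 0, ∀ u ∈ S, ξ - δ ≤ W u → |R u| ≤ 2 * η := by
  have hA : IsCompact (S ∩ {u | 2 * η ≤ |R u|}) :=
    hS.inter_right (isClosed_le continuous_const hR.abs)
  rcases (S ∩ {u | 2 * η ≤ |R u|}).eq_empty_or_nonempty with he | hne
  · refine ⟨1, one_pos, fun u hu _ => ?_⟩
    by_contra! hlt
    exact (he ▸ (⟨hu, hlt.le⟩ : u ∈ S ∩ {u | 2 * η ≤ |R u|}) : u ∈ (∅ : Set ℝ))
  · obtain ⟨w, hw, hmax⟩ := hA.exists_isMaxOn hne hW.continuousOn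
    have hwξ : W w < ξ := by
      by_contra! hle
      have := h w hw.1 hle
      have : 2 * η ≤ |R w| := hw.2
      linarith
    refine ⟨(ξ - W w) / 2, by linarith, fun u hu hWu => ?_⟩
    by_contra! hlt
    have : W u ≤ W w := hmax (show u ∈ S ∩ {u | 2 * η ≤ |R u|} from ⟨hu, hlt.le⟩)
    linarith

/-- Strict differentiability of the limit energy at `x₀`. -/
lemma strict_deriv (h : NeumannSeq p a W W0 ε u u' E) {x₀ k : ℝ} (hx₀ : x₀ ∈ Icc (0 : ℝ) 1)
    (hcorr : ∀ η > 0, ∃ f f' : ℝ → ℝ, Continuous f' ∧ (∀ u, HasDerivAt f (f' u) u) ∧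
      ∀ u ∈ Icc (-1 : ℝ) 1, E x₀ ≤ W u →
        |p / (p - 1) * (W u - E x₀) * f' u + deriv W u * f u - (W u - E x₀ - k)| ≤ η)
    {η : ℝ} (hη : 0 < η) :
    ∃ r > 0, ∀ x ∈ Icc (0 : ℝ) 1, ∀ y ∈ Icc (0 : ℝ) 1, |x - x₀| ≤ r → |y - x₀| ≤ r →
      |E y - E x - deriv a x₀ / a x₀ * k * (y - x)| ≤ η * |y - x| := by
  have hW0 := h.well.pos
  have hac : Continuous a := h.contDiff.continuous
  have hda : Continuous (deriv a) := h.contDiff.continuous_deriv le_rfl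
  set b : ℝ → ℝ := fun x => deriv a x / a x with hb
  set N := W0 + 1 + 4 * |b x₀| with hN
  have hN0 : 0 < N := by positivity
  set σ := min 1 (η / N) with hσdef
  have hσ : 0 < σ := by positivity
  have hσN : σ * N ≤ η := (le_div_iff₀ hN0).1 (min_le_right _ _)
  obtain ⟨f, f', hf'c, hf, hmain⟩ := hcorr σ hσ
  have hfc : Continuous f := continuous_iff_continuousAt.2 fun x => (hf x).continuousAt
  have hWc := h.well.continuous
  have hW'c := h.well.continuous_deriv
  obtain ⟨δ, hδ, hslack⟩ := exists_slack hWc (R := fun u =>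
    p / (p - 1) * (W u - E x₀) * f' u + deriv W u * f u - (W u - E x₀ - k)) (by fun_prop)
    isCompact_Icc hσ hmain
  obtain ⟨r1, hr1, C, P, D, hev⟩ := h.eventually_corrector hf'c hf hx₀ (lt_min hσ hδ)
  have hbc : ContinuousOn b (Icc 0 1) :=
    hda.continuousOn.div hac.continuousOn fun x hx => (h.pos x hx).ne'
  obtain ⟨r2, hr2, hbr⟩ := Metric.continuousWithinAt_iff.1 (hbc x₀ hx₀) σ hσ
  have hr : 0 < min r1 (r2 / 2) := lt_min hr1 (half_pos hr2)
  refine ⟨min r1 (r2 / 2), hr, fun x hx y hy hxr hyr => ?_⟩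
  set S := Icc (0 : ℝ) 1 ∩ Metric.closedBall x₀ (min r1 (r2 / 2)) with hS
  have hSconv : Convex ℝ S := (convex_Icc _ _).inter (convex_closedBall _ _)
  have hbound : ∀ᶠ n in atTop,
      |Ener p (ε n) a W (u n) (u' n) y - Ener p (ε n) a W (u n) (u' n) x - b x₀ * k * (y - x)|
        ≤ η * |y - x| + 2 * |b x₀| * C * ε n := by
    filter_upwards [hev] with n hn
    have hder : ∀ z ∈ S, HasDerivWithinAt
        (fun z => Ener p (ε n) a W (u n) (u' n) z - b x₀ * k * z - b x₀ * P n z)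
        (b z * (W (u n z) - Ener p (ε n) a W (u n) (u' n) z) - b x₀ * k - b x₀ * D n z)
        S z := fun z hz => by
      have hzr : |z - x₀| ≤ r1 := (show |z - x₀| ≤ _ from hz.2).trans (min_le_left _ _)
      have h1 := hasDerivWithinAt_energy h.one_lt h.well h.differentiable h.pos (h.sol n) hz.1
      have h2 := ((hasDerivAt_id z).const_mul (b x₀ * k)).hasDerivWithinAt (s := Icc (0 : ℝ) 1)
      have h3 := ((hn z hz.1 hzr).2.2.1).const_mul (b x₀)
      have := ((h1.sub h2).sub h3).mono (inter_subset_left : S ⊆ Icc 0 1)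
      exact this.congr_deriv (by rw [mul_one])
    have hle : ∀ z ∈ S,
        ‖b z * (W (u n z) - Ener p (ε n) a W (u n) (u' n) z) - b x₀ * k - b x₀ * D n z‖
          ≤ η := fun z hz => by
      have hzr : |z - x₀| ≤ min r1 (r2 / 2) := hz.2
      obtain ⟨e1, -, -, e2⟩ := hn z hz.1 (hzr.trans (min_le_left _ _))
      have hbz : |b z - b x₀| ≤ σ :=
        (hbr hz.1 (by
          rw [Real.dist_eq]
          linarith [hzr.trans (min_le_right _ _)])).le
      have huz := h.range n z hz.1
      have en := h.energy_le n hz.1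
      have wl := (h.well.mem_range huz).2
      have e1σ := e1.trans (min_le_left _ _)
      have e1δ := e1.trans (min_le_right _ _)
      have e2σ := e2.trans (min_le_left _ _)
      have hR := hslack _ huz (by linarith [(abs_le.1 e1δ).1])
      have hσ1 : σ ≤ 1 := min_le_left _ _
      have E0 := h.nonneg hx₀
      set en' := Ener p (ε n) a W (u n) (u' n) z
      have t1 : |(b z - b x₀) * (W (u n z) - en')| ≤ σ * (W0 + 1) := by
        rw [abs_mul, abs_of_nonneg (by linarith : 0 ≤ W (u n z) - en')]
        exact mul_le_mul hbz (by linarith [(abs_le.1 e1σ).1]) (by linarith) hσ.le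
      have t2 : |W (u n z) - en' - k - D n z| ≤ 4 * σ := by
        have a1 := abs_le.1 e1σ
        have a2 := abs_le.1 e2σ
        have a3 := abs_le.1 hR
        rw [abs_le]
        constructor <;> linarith [a1.1, a1.2, a2.1, a2.2, a3.1, a3.2]
      have e : b z * (W (u n z) - en') - b x₀ * k - b x₀ * D n z
          = (b z - b x₀) * (W (u n z) - en') + b x₀ * (W (u n z) - en' - k - D n z) := by ring
      rw [Real.norm_eq_abs, e]
      refine (abs_add_le _ _).trans ?_
      rw [abs_mul (b x₀)]
      have t3 := mul_le_mul_of_nonneg_left t2 (abs_nonneg (b x₀))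
      have : σ * (W0 + 1) + |b x₀| * (4 * σ) = σ * N := by rw [hN]; ring
      linarith
    have key := hSconv.norm_image_sub_le_of_norm_hasDerivWithin_le hder hle
      (show x ∈ S from ⟨hx, hxr⟩) (show y ∈ S from ⟨hy, hyr⟩)
    rw [Real.norm_eq_abs, Real.norm_eq_abs] at key
    have p1 := (hn x hx (hxr.trans (min_le_left _ _))).2.1
    have p2 := (hn y hy (hyr.trans (min_le_left _ _))).2.1
    have p3 : |b x₀ * (P n y - P n x)| ≤ |b x₀| * (2 * C * ε n) := by
      rw [abs_mul]
      exact mul_le_mul_of_nonneg_left ((abs_sub _ _).trans (by linarith)) (abs_nonneg _)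
    have e : Ener p (ε n) a W (u n) (u' n) y - Ener p (ε n) a W (u n) (u' n) x
        - b x₀ * k * (y - x)
        = (Ener p (ε n) a W (u n) (u' n) y - b x₀ * k * y - b x₀ * P n y
          - (Ener p (ε n) a W (u n) (u' n) x - b x₀ * k * x - b x₀ * P n x))
          + b x₀ * (P n y - P n x) := by ring
    rw [e]
    refine (abs_add_le _ _).trans ?_
    linarith
  have l1 := (((h.tendsto_energy hy).sub (h.tendsto_energy hx)).sub_const
    (b x₀ * k * (y - x))).abs
  have l2 : Tendsto (fun n => η * |y - x| + 2 * |b x₀| * C * ε n) atTop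
      (𝓝 (η * |y - x| + 2 * |b x₀| * C * 0)) := (h.eps_tendsto.const_mul _).const_add _
  rw [mul_zero, add_zero] at l2
  exact le_of_tendsto_of_tendsto l1 l2 hbound

end NeumannSeq

/-- A function that is strictly differentiable within `[0, 1]` at each point is `C¹` there. -/
lemma contDiffOn_of_strict_deriv {E E' : ℝ → ℝ}
    (h : ∀ x₀ ∈ Icc (0 : ℝ) 1, ∀ η > 0, ∃ r > 0, ∀ x ∈ Icc (0 : ℝ) 1, ∀ y ∈ Icc (0 : ℝ) 1,
      |x - x₀| ≤ r → |y - x₀| ≤ r → |E y - E x - E' x₀ * (y - x)| ≤ η * |y - x|) :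
    ContinuousOn E' (Icc 0 1) ∧
      ∀ x ∈ Icc (0 : ℝ) 1, HasDerivWithinAt E (E' x) (Icc 0 1) x := by
  refine ⟨fun x₀ hx₀ => ?_, fun x₀ hx₀ => ?_⟩
  · rw [Metric.continuousWithinAt_iff]
    intro η hη
    obtain ⟨r, hr, h1⟩ := h x₀ hx₀ (η / 3) (by positivity)
    refine ⟨r / 2, half_pos hr, fun {x} hx hxr => ?_⟩
    rw [Real.dist_eq] at hxr ⊢
    obtain ⟨s, hs, h2⟩ := h x hx (η / 3) (by positivity)
    obtain ⟨y, hy, hne, hyx⟩ := NeumannSeq.exists_ne_near hx (lt_min hs (half_pos hr))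
    have b1 := h1 x hx y hy (by linarith) (by
      have := abs_sub_le y x x₀
      linarith [hyx.trans (min_le_right _ _)])
    have b2 := h2 x hx y hy (by simpa using hs.le) (hyx.trans (min_le_left _ _))
    have hpos : 0 < |y - x| := abs_pos.2 (sub_ne_zero.2 hne)
    have b3 : |E' x - E' x₀| * |y - x| ≤ 2 * (η / 3) * |y - x| := by
      rw [← abs_mul]
      have e : (E' x - E' x₀) * (y - x) =
          (E y - E x - E' x₀ * (y - x)) - (E y - E x - E' x * (y - x)) := by ring
      rw [e]
      exact (abs_sub _ _).trans (by linarith)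
    have := le_of_mul_le_mul_right b3 hpos
    linarith
  · rw [hasDerivWithinAt_iff_isLittleO, isLittleO_iff]
    intro η hη
    obtain ⟨r, hr, h1⟩ := h x₀ hx₀ η hη
    filter_upwards [self_mem_nhdsWithin,
      mem_nhdsWithin_of_mem_nhds (Metric.closedBall_mem_nhds x₀ hr)] with y hy hyr
    have := h1 x₀ hx₀ y hy (by simpa using hr.le) hyr
    rw [Real.norm_eq_abs, Real.norm_eq_abs, smul_eq_mul, mul_comm (y - x₀)]
    exact this

/-- The uniform limit `E` of the energies `E_{ε_n}` is `C¹` and satisfies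
the limit equation `E'(x) = (a'(x)/a(x)) K(E(x))` on `[0,1]`. -/
theorem limit_energy_equation
    (p : ℝ) (hp : 1 < p)
    (a : ℝ → ℝ) (haC : ContDiff ℝ 1 a) (hapos : ∀ x ∈ Set.Icc (0:ℝ) 1, 0 < a x)
    (W : ℝ → ℝ) (hW : ContDiff ℝ 1 W)
    (Cm1 C0 C1 W0 : ℝ) (hW1 : W1cond p W Cm1 C0 C1 W0) (hW2 : W2cond p W)
    -- the time map and averaged kinetic energy of the autonomous equation (with `a = 1`)
    (T K : ℝ → ℝ)
    (hTK : ∀ ξ ∈ Set.Ioo 0 W0, ∃ v v' : ℝ → ℝ,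
      IsSolAuto p 1 W v v' ∧ (∀ x, -(1 / 1) * Lfun p (v' x) + W (v x) = ξ) ∧
      v 0 = 0 ∧ 0 < v' 0 ∧
      IsLeast {c : ℝ | 0 < c ∧ Function.Periodic v c} (T ξ) ∧
      K ξ = (1 / T ξ) * ∫ y in (0:ℝ)..(T ξ), Lfun p (v' y))
    (hK0 : K 0 = 0) (hKW0 : K W0 = 0)
    (εn : ℕ → ℝ) (hεn : ∀ n, 0 < εn n) (hεn0 : Tendsto εn atTop (𝓝 0))
    (u u' : ℕ → ℝ → ℝ)
    (hrange : ∀ n, ∀ x ∈ Set.Icc (0:ℝ) 1, u n x ∈ Set.Icc (-1:ℝ) 1)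
    (hsol : ∀ n, IsNeumann p (εn n) a W (u n) (u' n))
    (E : ℝ → ℝ)
    (hconv : TendstoUniformlyOn (fun n x => Ener p (εn n) a W (u n) (u' n) x) E
      atTop (Set.Icc 0 1)) :
    ∃ E' : ℝ → ℝ, ContinuousOn E' (Set.Icc 0 1) ∧
      (∀ x ∈ Set.Icc (0:ℝ) 1, HasDerivWithinAt E (E' x) (Set.Icc 0 1) x) ∧
      ∀ x ∈ Set.Icc (0:ℝ) 1, E' x = deriv a x / a x * K (E x) := by
  have hwell := W1cond.doubleWell hp hW hW1 hW2
  have hseq : NeumannSeq p a W W0 εn u u' E :=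
    ⟨hp, haC, hapos, hwell, hεn, hεn0, hrange, hsol, hconv⟩
  obtain ⟨hc, hd⟩ := contDiffOn_of_strict_deriv (E := E)
    (E' := fun x => deriv a x / a x * K (E x)) fun x₀ hx₀ η hη =>
      hseq.strict_deriv hx₀ (fun σ hσ => hwell.exists_corrector_mean hp hTK hK0 hKW0
        ⟨hseq.nonneg hx₀, hseq.le_max hx₀⟩ hσ) hη
  exact ⟨_, hc, hd, fun x _ => rfl⟩
end
end

section
/- Let p>1, let a∈C^1([0,1]) with a(x)>0 on [0,1], and let W satisfy (W1) and (W2). Let E:[0,1]→[0,W_0] be a solution of E'(x)=(a'(x)/a(x))K(E(x)) vanishing somewhere on [0,1]. Then every connected component of {x∈[0,1] : E(x)>0} is an interval of one of the following types: (i) (s,t) with 0≤s<t≤1, a(s)=a(t) and a(x)>a(s) for all x∈(s,t); (ii) (s,1] with s∈[0,1) and a(x)>a(s) for all x∈(s,1]; (iii) [0,t) with t∈(0,1] and a(x)>a(t) for all x∈[0,t). Conversely, if A⊂[0,1] is a disjoint union of intervals of types (i), (ii), (iii), then there exists a solution E of the equation with E(x)=0 if and only if x∈[0,1]∖A; moreover,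 if A≠[0,1] such a solution is unique. -/
open Real Set Filter Topology MeasureTheory intervalIntegral Asymptotics

noncomputable section

/-- `E` solves the limit equation `E' = (a'/a) K(E)` on `[0,1]`, with values in `[0,W₀]`. -/
def IsEnergySol (a K : ℝ → ℝ) (W0 : ℝ) (E : ℝ → ℝ) : Prop :=
  (∀ x ∈ Set.Icc (0:ℝ) 1, E x ∈ Set.Icc 0 W0) ∧
  ∀ x ∈ Set.Icc (0:ℝ) 1,
    HasDerivWithinAt E (deriv a x / a x * K (E x)) (Set.Icc 0 1) x

/-- interval of type (i) -/
def TypeI (a : ℝ → ℝ) (S : Set ℝ) : Prop :=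
  ∃ s t : ℝ, 0 ≤ s ∧ s < t ∧ t ≤ 1 ∧ S = Set.Ioo s t ∧ a s = a t ∧
    ∀ x ∈ Set.Ioo s t, a s < a x

/-- interval of type (ii) -/
def TypeII (a : ℝ → ℝ) (S : Set ℝ) : Prop :=
  ∃ s : ℝ, 0 ≤ s ∧ s < 1 ∧ S = Set.Ioc s 1 ∧ ∀ x ∈ Set.Ioc s 1, a s < a x

/-- interval of type (iii) -/
def TypeIII (a : ℝ → ℝ) (S : Set ℝ) : Prop :=
  ∃ t : ℝ, 0 < t ∧ t ≤ 1 ∧ S = Set.Ico 0 t ∧ ∀ x ∈ Set.Ico 0 t, a t < a x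

lemma phip_pos {p s : ℝ} (hs : 0 < s) : 0 < phip p s :=
  mul_pos (rpow_pos_of_pos (abs_pos.2 hs.ne') _) hs

lemma phip_of_pos {p s : ℝ} (hs : 0 < s) : phip p s = s ^ (p - 1) := by
  rw [phip, abs_of_pos hs, ← rpow_add_one hs.ne']
  ring_nf

lemma phip_neg (p s : ℝ) : phip p (-s) = -phip p s := by
  simp [phip]

/-- Half of a double well: a profile on `[0,1]` decreasing from `W0` to `0`. -/
structure IsHalfWell (p W0 : ℝ) (V : ℝ → ℝ) : Prop where
  contDiff : ContDiff ℝ 1 V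
  zero_eq : V 0 = W0
  one_eq : V 1 = 0
  deriv_one : deriv V 1 = 0
  strictMonoOn : StrictMonoOn (fun u => deriv V u / phip p u) (Ioc (0:ℝ) 1)

namespace IsHalfWell

variable {p W0 : ℝ} {V : ℝ → ℝ}

lemma hasDerivAt (h : IsHalfWell p W0 V) (u : ℝ) : HasDerivAt V (deriv V u) u :=
  (h.contDiff.differentiable one_ne_zero u).hasDerivAt

lemma continuous (h : IsHalfWell p W0 V) : Continuous V := h.contDiff.continuous

lemma continuous_deriv (h : IsHalfWell p W0 V) : Continuous (deriv V) :=
  h.contDiff.continuous_deriv le_rfl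

lemma deriv_neg (h : IsHalfWell p W0 V) {u : ℝ} (hu : u ∈ Ioo (0:ℝ) 1) : deriv V u < 0 := by
  have h1 := h.strictMonoOn ⟨hu.1, hu.2.le⟩ (right_mem_Ioc.2 one_pos) hu.2
  simp only [h.deriv_one, zero_div] at h1
  exact (div_neg_iff.1 h1).elim (fun h => absurd h.2 (phip_pos hu.1).le.not_gt) And.left

lemma strictAntiOn (h : IsHalfWell p W0 V) : StrictAntiOn V (Icc (0:ℝ) 1) := by
  refine strictAntiOn_of_deriv_neg (convex_Icc 0 1) h.continuous.continuousOn fun u hu => ?_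
  rw [interior_Icc] at hu
  exact h.deriv_neg hu

lemma exists_eq (h : IsHalfWell p W0 V) {ξ : ℝ} (hξ : ξ ∈ Ioo 0 W0) :
    ∃ β ∈ Ioo (0:ℝ) 1, V β = ξ := by
  have := intermediate_value_Ioo' zero_le_one (h.continuous.continuousOn (s := Icc 0 1))
  rw [h.zero_eq, h.one_eq] at this
  exact this hξ

/-- The profile lies above a line through any of its points, with a slope depending
continuously on the point. -/
lemma le_sub (h : IsHalfWell p W0 V) (hp : 1 < p) {β s : ℝ} (hβ : β ∈ Ioo (0:ℝ) 1)
    (hs : s ∈ Icc (0:ℝ) 1) :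
    -deriv V β * β / p * (1 - s) ≤ V (β * s) - V β := by
  have hp0 : 0 < p := by linarith
  set m := -(deriv V β / phip p β) with hm
  have hφ : 0 < phip p β := phip_pos hβ.1
  have hm0 : 0 ≤ m := by
    rw [hm, ← neg_div]
    exact (div_pos (neg_pos.2 (h.deriv_neg hβ)) hφ).le
  have hd : ∀ u ∈ Ioo 0 β,
      HasDerivAt (fun u => V u + m * (u ^ p / p)) (deriv V u + m * u ^ (p - 1)) u := by
    intro u hu
    have := (hasDerivAt_rpow_const (p := p) (Or.inl hu.1.ne')).div_const p
    rw [mul_div_cancel_left₀ _ hp0.ne'] at this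
    exact (h.hasDerivAt u).add (this.const_mul m)
  have hanti : AntitoneOn (fun u => V u + m * (u ^ p / p)) (Icc 0 β) := by
    refine antitoneOn_of_deriv_nonpos (convex_Icc 0 β) ?_ ?_ ?_
    · exact (h.continuous.add (((continuous_id.rpow_const fun _ => Or.inr hp0.le).div_const
        p).const_mul m)).continuousOn
    · rw [interior_Icc]
      exact fun u hu => (hd u hu).differentiableAt.differentiableWithinAt
    · rw [interior_Icc]
      intro u hu
      rw [(hd u hu).deriv]
      have h1 := (h.strictMonoOn ⟨hu.1, (hu.2.trans hβ.2).le⟩ ⟨hβ.1, hβ.2.le⟩ hu.2).le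
      have h2 : deriv V u / phip p u ≤ -m := by simpa [hm] using h1
      rw [div_le_iff₀ (phip_pos hu.1), phip_of_pos hu.1] at h2
      linarith
  have hle := hanti (a := β * s) (b := β) ⟨mul_nonneg hβ.1.le hs.1, by nlinarith [hβ.1, hs.2]⟩
    ⟨hβ.1.le, le_rfl⟩ (by nlinarith [hβ.1, hs.2])
  simp only [mul_rpow hβ.1.le hs.1] at hle
  have hsp : s ^ p ≤ s := by
    simpa using rpow_le_rpow_of_exponent_ge_of_imp hs.1 hs.2 hp.le (fun _ => by simpa using hp0.ne')
  have hmβ : m * β ^ p = -deriv V β * β := by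
    have : β ^ p = phip p β * β := by
      rw [phip_of_pos hβ.1, ← rpow_add_one hβ.1.ne', sub_add_cancel]
    rw [this, hm]
    field_simp
  calc -deriv V β * β / p * (1 - s) = m * β ^ p / p * (1 - s) := by rw [hmβ]
    _ ≤ m * β ^ p / p * (1 - s ^ p) := by
        have : 0 ≤ m * β ^ p / p := by have := hβ.1.le; positivity
        gcongr
    _ = m * (β ^ p / p) - m * (β ^ p * s ^ p / p) := by ring
    _ ≤ _ := by linarith

lemma slope_pos (h : IsHalfWell p W0 V) (hp : 1 < p) {β : ℝ} (hβ : β ∈ Ioo (0:ℝ) 1) :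
    0 < -deriv V β * β / p :=
  div_pos (mul_pos (neg_pos.2 (h.deriv_neg hβ)) hβ.1) (by linarith)

lemma posPart_eq_zero (h : IsHalfWell p W0 V) {β u : ℝ} (hβ : β ∈ Ioo (0:ℝ) 1)
    (hu : u ∈ Icc β 1) : max (V u - V β) 0 = 0 := by
  refine max_eq_right (sub_nonpos.2 ?_)
  exact h.strictAntiOn.antitoneOn ⟨hβ.1.le, hβ.2.le⟩ ⟨hβ.1.le.trans hu.1, hu.2⟩ hu.1

lemma measurable_posPart_rpow (h : IsHalfWell p W0 V) (ξ k : ℝ) :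
    Measurable fun u => max (V u - ξ) 0 ^ k :=
  ((h.continuous.measurable.sub_const ξ).max measurable_const).pow_const k

/-- The singular integrand `(V - ξ)₊ ^ (-1/p)` is integrable. -/
lemma intervalIntegrable (h : IsHalfWell p W0 V) (hp : 1 < p) {ξ : ℝ} (hξ : ξ ∈ Ioo 0 W0) :
    IntervalIntegrable (fun u => max (V u - ξ) 0 ^ (-(1 / p))) volume 0 1 := by
  obtain ⟨β, hβ, rfl⟩ := h.exists_eq hξ
  have hp0 : 0 < p := by linarith
  have hk : -1 < -(1 / p) := by
    rw [neg_lt_neg_iff, div_lt_one hp0]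
    exact hp
  have hc := h.slope_pos hp hβ
  set c := -deriv V β * β / p
  refine IntervalIntegrable.trans (b := β) ?_ ?_
  · have hi : IntervalIntegrable (fun u => (c / β * (β - u)) ^ (-(1 / p))) volume 0 β := by
      have h1 := (intervalIntegrable_rpow' (a := 0) (b := β) hk).comp_sub_left β
      rw [sub_zero, sub_self] at h1
      refine (h1.symm.const_mul ((c / β) ^ (-(1 / p)))).congr fun u hu => ?_
      rw [uIoc_of_le hβ.1.le] at hu
      exact (mul_rpow (div_pos hc hβ.1).le (sub_nonneg.2 hu.2)).symm
    refine hi.mono_fun' (h.measurable_posPart_rpow _ _).aestronglyMeasurable ?_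
    rw [EventuallyLE, ae_restrict_iff' measurableSet_uIoc, uIoc_of_le hβ.1.le]
    refine Eventually.of_forall fun u hu => ?_
    rw [Real.norm_of_nonneg (rpow_nonneg (le_max_right _ _) _)]
    rcases hu.2.lt_or_eq with hlt | rfl
    · have h1 := h.le_sub hp hβ (s := u / β)
        ⟨div_nonneg hu.1.le hβ.1.le, (div_le_one hβ.1).2 hu.2⟩
      rw [mul_div_cancel₀ _ hβ.1.ne'] at h1
      have h2 : c * (1 - u / β) = c / β * (β - u) := by
        have := hβ.1.ne'
        field_simp
      rw [h2] at h1
      refine rpow_le_rpow_of_nonpos (mul_pos (div_pos hc hβ.1) (sub_pos.2 hlt))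
        (h1.trans (le_max_left _ _)) ?_
      rw [neg_nonpos]
      positivity
    · simp
  · refine (intervalIntegrable_const (c := (0:ℝ))).congr fun u hu => ?_
    rw [uIoc_of_le hβ.2.le] at hu
    simp only [h.posPart_eq_zero hβ (Ioc_subset_Icc_self hu)]
    rw [zero_rpow]
    exact neg_ne_zero.2 (one_div_pos.2 hp0).ne'

lemma integral_eq_integral_to (h : IsHalfWell p W0 V) {β k : ℝ} (hk : k ≠ 0)
    (hβ : β ∈ Ioo (0:ℝ) 1) :
    ∫ u in (0:ℝ)..1, max (V u - V β) 0 ^ k = ∫ u in (0:ℝ)..β, max (V u - V β) 0 ^ k := by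
  rw [integral_of_le zero_le_one, integral_of_le hβ.1.le]
  refine setIntegral_eq_of_subset_of_forall_sdiff_eq_zero measurableSet_Ioc
    (Ioc_subset_Ioc_right hβ.2.le) fun u hu => ?_
  have : β < u := not_le.1 fun hle => hu.2 ⟨hu.1.1, hle⟩
  rw [h.posPart_eq_zero hβ ⟨this.le, hu.1.2⟩, zero_rpow hk]

lemma integral_eq_scaled (h : IsHalfWell p W0 V) {β k : ℝ} (hk : k ≠ 0)
    (hβ : β ∈ Ioo (0:ℝ) 1) :
    ∫ u in (0:ℝ)..1, max (V u - V β) 0 ^ k =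
      ∫ s in (0:ℝ)..1, β * max (V (β * s) - V β) 0 ^ k := by
  rw [h.integral_eq_integral_to hk hβ, intervalIntegral.integral_const_mul,
    intervalIntegral.integral_comp_mul_left (fun u => max (V u - V β) 0 ^ k) hβ.1.ne', mul_zero,
    mul_one, smul_eq_mul, mul_inv_cancel_left₀ hβ.1.ne']

lemma integral_pos (h : IsHalfWell p W0 V) (hp : 1 < p) {ξ : ℝ} (hξ : ξ ∈ Ioo 0 W0) :
    0 < ∫ u in (0:ℝ)..1, max (V u - ξ) 0 ^ (-(1 / p)) := by
  have hi := h.intervalIntegrable hp hξ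
  obtain ⟨β, hβ, rfl⟩ := h.exists_eq hξ
  rw [h.integral_eq_integral_to (neg_ne_zero.2 (one_div_pos.2 (by linarith)).ne') hβ]
  refine intervalIntegral_pos_of_pos_on (hi.mono_set ?_) (fun u hu => ?_) hβ.1
  · rw [uIcc_of_le hβ.1.le, uIcc_of_le zero_le_one]
    exact Icc_subset_Icc_right hβ.2.le
  · refine rpow_pos_of_pos (lt_max_of_lt_left (sub_pos.2 ?_)) _
    exact h.strictAntiOn ⟨hu.1.le, (hu.2.trans hβ.2).le⟩ ⟨hβ.1.le, hβ.2.le⟩ hu.2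

lemma continuousAt_integral (h : IsHalfWell p W0 V) (hp : 1 < p) {ξ : ℝ}
    (hξ : ξ ∈ Ioo 0 W0) :
    ContinuousAt (fun ξ => ∫ u in (0:ℝ)..1, max (V u - ξ) 0 ^ (-(1 / p))) ξ := by
  obtain ⟨β₀, hβ₀, rfl⟩ := h.exists_eq hξ
  have hp0 : 0 < p := by linarith
  have hk0 : -(1 / p) < 0 := neg_neg_of_pos (one_div_pos.2 hp0)
  have hk : -1 < -(1 / p) := by
    rw [neg_lt_neg_iff, div_lt_one hp0]
    exact hp
  have hstrict : HasStrictDerivAt V (deriv V β₀) β₀ :=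
    h.contDiff.contDiffAt.hasStrictDerivAt one_ne_zero
  rw [ContinuousAt, ← hstrict.map_nhds_eq (h.deriv_neg hβ₀).ne, tendsto_map'_iff]
  have hmem : Ioo (0:ℝ) 1 ∈ 𝓝 β₀ := Ioo_mem_nhds hβ₀.1 hβ₀.2
  rw [h.integral_eq_scaled hk0.ne hβ₀]
  refine Tendsto.congr' (f₁ := fun β => ∫ s in (0:ℝ)..1, β * max (V (β * s) - V β) 0 ^ (-(1 / p)))
    (by filter_upwards [hmem] with β hβ using (h.integral_eq_scaled hk0.ne hβ).symm) ?_
  have hc₀ := h.slope_pos hp hβ₀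
  set c := fun β => -deriv V β * β / p with hc
  have hcc : Continuous c := (h.continuous_deriv.neg.mul continuous_id).div_const p
  have hev : ∀ᶠ β in 𝓝 β₀, c β₀ / 2 < c β :=
    hcc.continuousAt.eventually (lt_mem_nhds (half_lt_self hc₀))
  refine intervalIntegral.continuousAt_of_dominated_interval
    (bound := fun s => (c β₀ / 2) ^ (-(1 / p)) * (1 - s) ^ (-(1 / p))) ?_ ?_ ?_ ?_
  · refine Eventually.of_forall fun β => Measurable.aestronglyMeasurable ?_
    exact ((((h.continuous.comp (continuous_const.mul continuous_id)).measurable.sub_const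
      _).max measurable_const).pow_const _).const_mul _
  · filter_upwards [hmem, hev] with β hβ hcβ
    filter_upwards [compl_mem_ae_iff.2 (measure_singleton (1:ℝ))] with s hs1 hs
    rw [uIoc_of_le zero_le_one] at hs
    have hs1 : 0 < 1 - s := sub_pos.2 (lt_of_le_of_ne hs.2 hs1)
    rw [Real.norm_of_nonneg (mul_nonneg hβ.1.le (rpow_nonneg (le_max_right _ _) _)),
      ← mul_rpow (half_pos hc₀).le hs1.le]
    refine (mul_le_of_le_one_left (rpow_nonneg (le_max_right _ _) _) hβ.2.le).trans ?_
    refine rpow_le_rpow_of_nonpos (mul_pos (half_pos hc₀) hs1) ?_ hk0.le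
    refine le_trans ?_ ((h.le_sub hp hβ (Ioc_subset_Icc_self hs)).trans (le_max_left _ _))
    exact mul_le_mul_of_nonneg_right hcβ.le hs1.le
  · have h1 := (intervalIntegrable_rpow' (a := 0) (b := 1) hk).comp_sub_left 1
    rw [sub_zero, sub_self] at h1
    exact h1.symm.const_mul _
  · filter_upwards [compl_mem_ae_iff.2 (measure_singleton (1:ℝ))] with s hs1 hs
    rw [uIoc_of_le zero_le_one] at hs
    have hs1 : 0 < 1 - s := sub_pos.2 (lt_of_le_of_ne hs.2 hs1)
    have hpos := (mul_pos hc₀ hs1).trans_le (h.le_sub hp hβ₀ (Ioc_subset_Icc_self hs))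
    refine continuousAt_id.mul (ContinuousAt.rpow_const ?_ (Or.inl (lt_max_of_lt_left hpos).ne'))
    exact (((h.continuous.comp (continuous_id.mul continuous_const)).sub
      h.continuous).max continuous_const).continuousAt

/-- If the profile flattens at its bottom at least like `(1 - u) ^ p`, the singular integral
blows up at the bottom level. -/
lemma tendsto_integral_atTop (h : IsHalfWell p W0 V) (hp : 1 < p) {C δ : ℝ}
    (hC : 0 < C) (hδ : δ ∈ Ioo (0:ℝ) 1)
    (hV : ∀ u ∈ Icc (1 - δ) 1, V u ≤ C * (1 - u) ^ p) :
    Tendsto (fun ξ => ∫ u in (0:ℝ)..1, max (V u - ξ) 0 ^ (-(1 / p))) (𝓝[>] 0) atTop := by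
  have hp0 : 0 < p := by linarith
  have hk0 : -(1 / p) < 0 := neg_neg_of_pos (one_div_pos.2 hp0)
  rw [tendsto_atTop]
  intro M
  obtain ⟨η, hη0, hηδ, hηM⟩ : ∃ η, 0 < η ∧ η ≤ δ ∧ M ≤ C ^ (-(1 / p)) * Real.log (δ / η) := by
    refine ⟨δ * Real.exp (-(|M| / C ^ (-(1 / p)))), by have := hδ.1; positivity, ?_, ?_⟩
    · refine mul_le_of_le_one_right hδ.1.le (Real.exp_le_one_iff.2 ?_)
      rw [neg_nonpos]
      positivity
    · rw [div_mul_cancel_left₀ hδ.1.ne', ← Real.exp_neg, Real.log_exp, neg_neg,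
        mul_div_cancel₀ _ (rpow_pos_of_pos hC _).ne']
      exact le_abs_self M
  have hη1 : 1 - η ∈ Ioo (0:ℝ) 1 := ⟨by linarith [hδ.2], by linarith⟩
  have hVη : 0 < V (1 - η) := by
    rw [← h.one_eq]
    exact h.strictAntiOn ⟨hη1.1.le, hη1.2.le⟩ ⟨zero_le_one, le_rfl⟩ hη1.2
  have hVW : V (1 - η) < W0 := by
    rw [← h.zero_eq]
    exact h.strictAntiOn ⟨le_rfl, zero_le_one⟩ ⟨hη1.1.le, hη1.2.le⟩ hη1.1
  filter_upwards [Ioo_mem_nhdsGT hVη] with ξ hξ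
  have hfi := h.intervalIntegrable hp ⟨hξ.1, hξ.2.trans hVW⟩
  have hδη : 1 - δ ≤ 1 - η := by linarith
  have hlog : ∫ u in (1 - δ)..(1 - η), C ^ (-(1 / p)) * (1 - u)⁻¹ =
      C ^ (-(1 / p)) * Real.log (δ / η) := by
    rw [intervalIntegral.integral_const_mul,
      intervalIntegral.integral_comp_sub_left (fun x => x⁻¹) 1, sub_sub_cancel, sub_sub_cancel,
      integral_inv_of_pos hη0 hδ.1]
  calc M ≤ ∫ u in (1 - δ)..(1 - η), C ^ (-(1 / p)) * (1 - u)⁻¹ := hηM.trans_eq hlog.symm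
    _ ≤ ∫ u in (1 - δ)..(1 - η), max (V u - ξ) 0 ^ (-(1 / p)) := by
      refine integral_mono_on hδη ?_ (hfi.mono_set ?_) fun u hu => ?_
      · refine ContinuousOn.intervalIntegrable ?_
        rw [uIcc_of_le hδη]
        refine continuousOn_const.mul (ContinuousOn.inv₀ (by fun_prop) fun u hu => ?_)
        linarith [hu.2]
      · rw [uIcc_of_le hδη, uIcc_of_le zero_le_one]
        exact Icc_subset_Icc (by linarith [hδ.2]) hη1.2.le
      · have hu1 : 0 < 1 - u := by linarith [hu.2]
        have hVu : ξ < V u := hξ.2.trans_le <| h.strictAntiOn.antitoneOn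
          ⟨by linarith [hu.1, hδ.2], by linarith⟩ ⟨hη1.1.le, hη1.2.le⟩ hu.2
        have hinv : (1 - u)⁻¹ = ((1 - u) ^ p) ^ (-(1 / p)) := by
          rw [← rpow_mul hu1.le, ← rpow_neg_one]
          congr 1
          field_simp
        rw [hinv, ← mul_rpow hC.le (rpow_nonneg hu1.le _)]
        refine rpow_le_rpow_of_nonpos (lt_max_of_lt_left (sub_pos.2 hVu)) ?_ hk0.le
        have := hV u ⟨hu.1, by linarith⟩
        exact max_le (by linarith [hξ.1]) (by positivity)
    _ ≤ ∫ u in (0:ℝ)..1, max (V u - ξ) 0 ^ (-(1 / p)) := by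
      refine integral_mono_interval (by linarith [hδ.2]) hδη hη1.2.le ?_ hfi
      exact Eventually.of_forall fun u => rpow_nonneg (le_max_right _ _) _

end IsHalfWell

/-- The integral `∫ (W - ξ)₊ ^ (-1/p)`, proportional to the period at energy level `ξ`. -/
def periodIntegral (p : ℝ) (W : ℝ → ℝ) (ξ : ℝ) : ℝ :=
  ∫ u in (-1:ℝ)..1, max (W u - ξ) 0 ^ (-(1 / p))

/-- The integral `∫ (W - ξ)₊ ^ (1 - 1/p)`, proportional to the action at energy level `ξ`. -/
def actionIntegral (p : ℝ) (W : ℝ → ℝ) (ξ : ℝ) : ℝ :=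
  ∫ u in (-1:ℝ)..1, max (W u - ξ) 0 ^ (1 - 1 / p)

/-- A potential consisting of two half wells glued at the origin. -/
structure IsDoubleWell (p W0 : ℝ) (W : ℝ → ℝ) : Prop where
  right : IsHalfWell p W0 W
  left : IsHalfWell p W0 fun u => W (-u)

lemma eq_zero_of_isLittleO_rpow {p C c : ℝ} {W : ℝ → ℝ} {s : Set ℝ} (hp : 1 < p) (hc : c ∈ s)
    (h : (fun u => W u - C * |u - c| ^ p) =o[𝓝[s] c] fun u => |u - c| ^ p) : W c = 0 := by
  have := (h.bound one_pos).self_of_nhdsWithin hc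
  simpa [zero_rpow (by linarith : p ≠ 0)] using this

lemma deriv_eq_zero_of_isLittleO_rpow {p C c : ℝ} {W : ℝ → ℝ} {s : Set ℝ} (hp : 1 < p)
    (hc : c ∈ s) (hs : UniqueDiffWithinAt ℝ s c) (hW : DifferentiableAt ℝ W c)
    (h : (fun u => W u - C * |u - c| ^ p) =o[𝓝[s] c] fun u => |u - c| ^ p) :
    deriv W c = 0 := by
  have hpow : (fun u => |u - c| ^ p) =o[𝓝[s] c] fun u => u - c := by
    have h1 : Tendsto (fun u => |u - c| ^ (p - 1)) (𝓝[s] c) (𝓝 0) := by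
      have : Continuous fun u => |u - c| ^ (p - 1) :=
        (continuous_id.sub continuous_const).abs.rpow_const fun _ => Or.inr (by linarith)
      have h2 := (this.tendsto c).mono_left (nhdsWithin_le_nhds (s := s))
      rwa [sub_self, abs_zero, zero_rpow (by linarith)] at h2
    have h2 := ((isLittleO_one_iff ℝ).2 h1).mul_isBigO (isBigO_refl (fun u => |u - c|) (𝓝[s] c))
    refine IsLittleO.of_norm_right (h2.congr (fun u => ?_) fun u => one_mul _)
    rcases eq_or_ne (u - c) 0 with h0 | h0
    · simp [h0, zero_rpow (by linarith : p ≠ 0)]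
    · rw [← rpow_add_one (abs_ne_zero.2 h0), sub_add_cancel]
  have hd : HasDerivWithinAt W 0 s c := by
    rw [hasDerivWithinAt_iff_isLittleO]
    simp only [eq_zero_of_isLittleO_rpow hp hc h, smul_zero, sub_zero]
    refine ((h.trans hpow).add (hpow.const_mul_left C)).congr_left fun u => ?_
    ring
  rw [← hW.derivWithin hs]
  exact hd.derivWithin hs

lemma W1cond.isDoubleWell {p Cm1 C0 C1 W0 : ℝ} {W : ℝ → ℝ} (hp : 1 < p) (hW : ContDiff ℝ 1 W)
    (hW1 : W1cond p W Cm1 C0 C1 W0) (hW2 : W2cond p W) : IsDoubleWell p W0 W := by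
  obtain ⟨-, -, -, -, h1, hm1, h0⟩ := hW1
  have hdiff : Differentiable ℝ W := hW.differentiable one_ne_zero
  have hu : ∀ x ∈ Icc (-1:ℝ) 1, UniqueDiffWithinAt ℝ (Icc (-1:ℝ) 1) x :=
    uniqueDiffOn_Icc (by norm_num)
  have hmem1 : (1:ℝ) ∈ Icc (-1:ℝ) 1 := by norm_num
  have hmemm1 : (-1:ℝ) ∈ Icc (-1:ℝ) 1 := by norm_num
  have hm1' : (fun u => W u - Cm1 / p * |u - (-1)| ^ p) =o[𝓝[Icc (-1:ℝ) 1] (-1)]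
      fun u => |u - (-1)| ^ p := by simpa only [sub_neg_eq_add] using hm1
  have hzero : W 0 = W0 := by
    have h0' : (fun u => (W u - W0) - -(C0 / p) * |u - 0| ^ p) =o[𝓝[Icc (-1:ℝ) 1] 0]
        fun u => |u - 0| ^ p := by
      simp only [sub_zero]
      exact h0.congr_left fun u => by ring
    have := eq_zero_of_isLittleO_rpow (W := fun u => W u - W0) hp (by norm_num) h0'
    exact sub_eq_zero.1 this
  have hderiv : ∀ u, deriv (fun u => W (-u)) u = -deriv W (-u) := fun u => deriv_comp_neg ..
  refine ⟨⟨hW, hzero, eq_zero_of_isLittleO_rpow hp hmem1 h1,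
    deriv_eq_zero_of_isLittleO_rpow hp hmem1 (hu _ hmem1) (hdiff 1) h1, hW2.2⟩,
    ⟨hW.comp contDiff_neg, by simpa using hzero, eq_zero_of_isLittleO_rpow hp hmemm1 hm1', ?_, ?_⟩⟩
  · rw [hderiv, deriv_eq_zero_of_isLittleO_rpow hp hmemm1 (hu _ hmemm1) (hdiff _) hm1', neg_zero]
  · intro u hu v hv huv
    have := hW2.1 (show -v ∈ Ico (-1:ℝ) 0 from ⟨by linarith [hv.2], by linarith [hv.1]⟩)
      (show -u ∈ Ico (-1:ℝ) 0 from ⟨by linarith [hu.2], by linarith [hu.1]⟩) (by linarith)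
    simpa only [hderiv, phip_neg, div_neg, neg_div] using this

lemma W1cond.exists_le {p Cm1 C0 C1 W0 : ℝ} {W : ℝ → ℝ} (hW1 : W1cond p W Cm1 C0 C1 W0) :
    ∃ C > 0, ∃ δ ∈ Ioo (0:ℝ) 1, ∀ u ∈ Icc (1 - δ) 1, W u ≤ C * (1 - u) ^ p := by
  obtain ⟨-, -, -, -, h1, -, -⟩ := hW1
  have h2 := h1.bound one_pos
  rw [eventually_nhdsWithin_iff, Metric.eventually_nhds_iff] at h2
  obtain ⟨ε, hε, h2⟩ := h2
  refine ⟨|C1 / p| + 1, by positivity, min (ε / 2) (1 / 2), ⟨by positivity, ?_⟩, fun u hu => ?_⟩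
  · exact (min_le_right _ _).trans_lt (by norm_num)
  · have hm1 := min_le_left (ε / 2) (1 / 2)
    have hm2 := min_le_right (ε / 2) (1 / 2)
    have habs : |u - 1| = 1 - u := by rw [abs_sub_comm, abs_of_nonneg (by linarith [hu.2])]
    have h3 := h2 (y := u) (by rw [Real.dist_eq, habs]; linarith [hu.1])
      ⟨by linarith [hu.1], hu.2⟩
    rw [habs, one_mul, Real.norm_of_nonneg (rpow_nonneg (by linarith [hu.2]) _),
      Real.norm_eq_abs] at h3
    have h4 := (abs_le.1 h3).2
    have h5 := mul_le_mul_of_nonneg_right (le_abs_self (C1 / p))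
      (rpow_nonneg (by linarith [hu.2] : (0:ℝ) ≤ 1 - u) p)
    linarith

/-- The positive part of a power with exponent above `-1` is integrable, with the expected
primitive. -/
lemma intervalIntegrable_posPart_rpow {k : ℝ} (hk : -1 < k) (hk0 : k ≠ 0) (a b : ℝ) :
    IntervalIntegrable (fun x => max x 0 ^ k) volume a b := by
  refine (intervalIntegrable_rpow' hk).mono_fun
    ((measurable_id.max measurable_const).pow_const k).aestronglyMeasurable
    (Eventually.of_forall fun x => ?_)
  rcases le_total x 0 with hx | hx
  · simp [max_eq_right hx, zero_rpow hk0]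
  · simp [max_eq_left hx]

lemma integral_posPart_rpow {k : ℝ} (hk : -1 < k) (hk0 : k ≠ 0) (a b : ℝ) :
    ∫ x in a..b, max x 0 ^ k = max b 0 ^ (k + 1) / (k + 1) - max a 0 ^ (k + 1) / (k + 1) := by
  have hk1 : 0 < k + 1 := by linarith
  refine integral_eq_of_hasDerivAt_off_countable (fun x => max x 0 ^ (k + 1) / (k + 1)) _
    (countable_singleton 0) ?_ (fun x hx => ?_) (intervalIntegrable_posPart_rpow hk hk0 a b)
  · exact (((continuous_id.max continuous_const).rpow_const fun _ =>
      Or.inr hk1.le).div_const _).continuousOn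
  · rcases lt_or_gt_of_ne (show x ≠ 0 from hx.2) with h | h
    · rw [max_eq_right h.le, zero_rpow hk0]
      refine (hasDerivAt_const x (0:ℝ)).congr_of_eventuallyEq ?_
      filter_upwards [gt_mem_nhds h] with y hy
      rw [max_eq_right hy.le, zero_rpow hk1.ne', zero_div]
    · rw [max_eq_left h.le]
      have h1 := (hasDerivAt_rpow_const (p := k + 1) (Or.inl h.ne')).div_const (k + 1)
      rw [mul_div_cancel_left₀ _ hk1.ne', add_sub_cancel_right] at h1
      refine h1.congr_of_eventuallyEq ?_
      filter_upwards [lt_mem_nhds h] with y hy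
      rw [max_eq_left hy.le]

section exponents

variable {p : ℝ}

lemma neg_one_lt_neg_inv (hp : 1 < p) : -1 < -(1 / p) := by
  rw [neg_lt_neg_iff, div_lt_one (by linarith)]
  exact hp

lemma neg_inv_neg (hp : 1 < p) : -(1 / p) < 0 :=
  neg_neg_of_pos (one_div_pos.2 (by linarith))

lemma one_sub_inv_pos (hp : 1 < p) : 0 < 1 - 1 / p := by
  linarith [neg_one_lt_neg_inv hp]

end exponents

namespace IsDoubleWell

variable {p W0 : ℝ} {W : ℝ → ℝ}

lemma continuous (h : IsDoubleWell p W0 W) : Continuous W := h.right.continuous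

lemma intervalIntegrable_left (h : IsDoubleWell p W0 W) (hp : 1 < p) {ξ : ℝ}
    (hξ : ξ ∈ Ioo 0 W0) :
    IntervalIntegrable (fun u => max (W u - ξ) 0 ^ (-(1 / p))) volume (-1) 0 := by
  have := ((IntervalIntegrable.iff_comp_neg (by simp)).1 (h.left.intervalIntegrable hp hξ)).symm
  simpa using this

lemma intervalIntegrable (h : IsDoubleWell p W0 W) (hp : 1 < p) {ξ : ℝ} (hξ : ξ ∈ Ioo 0 W0) :
    IntervalIntegrable (fun u => max (W u - ξ) 0 ^ (-(1 / p))) volume (-1) 1 :=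
  (h.intervalIntegrable_left hp hξ).trans (h.right.intervalIntegrable hp hξ)

lemma periodIntegral_eq (h : IsDoubleWell p W0 W) (hp : 1 < p) {ξ : ℝ} (hξ : ξ ∈ Ioo 0 W0) :
    periodIntegral p W ξ = (∫ u in (0:ℝ)..1, max (W (-u) - ξ) 0 ^ (-(1 / p))) +
      ∫ u in (0:ℝ)..1, max (W u - ξ) 0 ^ (-(1 / p)) := by
  rw [periodIntegral, ← integral_add_adjacent_intervals (h.intervalIntegrable_left hp hξ)
    (h.right.intervalIntegrable hp hξ),
    intervalIntegral.integral_comp_neg fun u => max (W u - ξ) 0 ^ (-(1 / p)), neg_zero]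

lemma periodIntegral_pos (h : IsDoubleWell p W0 W) (hp : 1 < p) {ξ : ℝ} (hξ : ξ ∈ Ioo 0 W0) :
    0 < periodIntegral p W ξ := by
  rw [h.periodIntegral_eq hp hξ]
  exact add_pos (h.left.integral_pos hp hξ) (h.right.integral_pos hp hξ)

lemma continuousAt_periodIntegral (h : IsDoubleWell p W0 W) (hp : 1 < p) {ξ : ℝ}
    (hξ : ξ ∈ Ioo 0 W0) : ContinuousAt (periodIntegral p W) ξ := by
  refine ((h.left.continuousAt_integral hp hξ).add
    (h.right.continuousAt_integral hp hξ)).congr ?_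
  filter_upwards [Ioo_mem_nhds hξ.1 hξ.2] with ζ hζ using (h.periodIntegral_eq hp hζ).symm

lemma tendsto_periodIntegral_atTop (h : IsDoubleWell p W0 W) (hp : 1 < p) (hW0 : 0 < W0)
    (hflat : ∃ C > 0, ∃ δ ∈ Ioo (0:ℝ) 1, ∀ u ∈ Icc (1 - δ) 1, W u ≤ C * (1 - u) ^ p) :
    Tendsto (periodIntegral p W) (𝓝[>] 0) atTop := by
  obtain ⟨C, hC, δ, hδ, hle⟩ := hflat
  refine tendsto_atTop_mono' _ ?_ (h.right.tendsto_integral_atTop hp hC hδ hle)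
  filter_upwards [Ioo_mem_nhdsGT hW0] with ξ hξ
  rw [h.periodIntegral_eq hp hξ]
  linarith [h.left.integral_pos hp hξ]

lemma continuous_actionIntegrand (h : IsDoubleWell p W0 W) (hp : 1 < p) :
    Continuous (Function.uncurry fun ξ u => max (W u - ξ) 0 ^ (1 - 1 / p)) :=
  (((h.continuous.comp continuous_snd).sub continuous_fst).max continuous_const).rpow_const
    fun _ => Or.inr (one_sub_inv_pos hp).le

lemma continuous_actionIntegral (h : IsDoubleWell p W0 W) (hp : 1 < p) :
    Continuous (actionIntegral p W) :=
  continuous_parametric_intervalIntegral_of_continuous' (h.continuous_actionIntegrand hp) _ _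

lemma le_top (h : IsDoubleWell p W0 W) {u : ℝ} (hu : u ∈ Icc (-1:ℝ) 1) : W u ≤ W0 := by
  rcases le_total 0 u with h0 | h0
  · rw [← h.right.zero_eq]
    exact h.right.strictAntiOn.antitoneOn ⟨le_rfl, zero_le_one⟩ ⟨h0, hu.2⟩ h0
  · have := h.left.strictAntiOn.antitoneOn ⟨le_rfl, zero_le_one⟩
      ⟨neg_nonneg.2 h0, by linarith [hu.1]⟩ (neg_nonneg.2 h0)
    simp only [neg_neg] at this
    exact this.trans_eq h.left.zero_eq

lemma actionIntegral_top (h : IsDoubleWell p W0 W) (hp : 1 < p) : actionIntegral p W W0 = 0 := by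
  rw [actionIntegral]
  refine (intervalIntegral.integral_congr (g := fun _ => 0) fun u hu => ?_).trans
    intervalIntegral.integral_zero
  rw [uIcc_of_le (by norm_num)] at hu
  simp only [max_eq_right (sub_nonpos.2 (h.le_top hu)), zero_rpow (one_sub_inv_pos hp).ne']

lemma actionIntegral_sub (h : IsDoubleWell p W0 W) (hp : 1 < p) {ξ ζ : ℝ} (hξζ : ξ ≤ ζ) :
    actionIntegral p W ξ - actionIntegral p W ζ =
      (1 - 1 / p) * ∫ η in ξ..ζ, periodIntegral p W η := by
  have hq := one_sub_inv_pos hp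
  have hk := neg_one_lt_neg_inv hp
  have hk0 := (neg_inv_neg hp).ne
  have hcont : ∀ η, Continuous fun u => max (W u - η) 0 ^ (1 - 1 / p) := fun η =>
    (h.continuous_actionIntegrand hp).comp (continuous_const.prodMk continuous_id)
  have hsec : ∀ u, ∫ η in ξ..ζ, max (W u - η) 0 ^ (-(1 / p)) =
      (1 - 1 / p)⁻¹ * (max (W u - ξ) 0 ^ (1 - 1 / p) - max (W u - ζ) 0 ^ (1 - 1 / p)) := by
    intro u
    rw [intervalIntegral.integral_comp_sub_left (fun x => max x 0 ^ (-(1 / p))) (W u),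
      integral_posPart_rpow hk hk0, show -(1 / p) + 1 = 1 - 1 / p by ring]
    ring
  have hfi : Integrable (Function.uncurry fun u η => max (W u - η) 0 ^ (-(1 / p)))
      ((volume.restrict (uIoc (-1:ℝ) 1)).prod (volume.restrict (Ioc ξ ζ))) := by
    rw [integrable_prod_iff]
    · refine ⟨Eventually.of_forall fun u => ?_, ?_⟩
      · have := (intervalIntegrable_posPart_rpow hk hk0 (W u - ξ) (W u - ζ)).comp_sub_left (W u)
        rw [sub_sub_cancel, sub_sub_cancel] at this
        exact (intervalIntegrable_iff_integrableOn_Ioc_of_le hξζ).1 this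
      · have h1 : Continuous fun u => (1 - 1 / p)⁻¹ *
            (max (W u - ξ) 0 ^ (1 - 1 / p) - max (W u - ζ) 0 ^ (1 - 1 / p)) :=
          continuous_const.mul ((hcont ξ).sub (hcont ζ))
        refine (intervalIntegrable_iff.1 (h1.intervalIntegrable (-1) 1)).congr
          (Eventually.of_forall fun u => ?_)
        simp only [Function.uncurry, norm_of_nonneg (rpow_nonneg (le_max_right _ (0:ℝ)) _)]
        rw [← integral_of_le hξζ, hsec]
    · exact ((((h.continuous.comp continuous_fst).sub continuous_snd).max
        continuous_const).measurable.pow_const _).aestronglyMeasurable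
  have hswap := intervalIntegral_integral_swap hfi
  simp only [← integral_of_le hξζ, hsec] at hswap
  rw [intervalIntegral.integral_const_mul, intervalIntegral.integral_sub
    ((hcont ξ).intervalIntegrable _ _) ((hcont ζ).intervalIntegrable _ _)] at hswap
  simp only [actionIntegral, periodIntegral]
  rw [← hswap, mul_inv_cancel_left₀ hq.ne']

lemma hasStrictDerivAt_actionIntegral (h : IsDoubleWell p W0 W) (hp : 1 < p) {ξ : ℝ}
    (hξ : ξ ∈ Ioo 0 W0) :
    HasStrictDerivAt (actionIntegral p W) (-((1 - 1 / p) * periodIntegral p W ξ)) ξ := by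
  obtain ⟨ζ, hζ⟩ := exists_between hξ.2
  have hcont : ContinuousOn (periodIntegral p W) (Ioo 0 W0) := fun η hη =>
    (h.continuousAt_periodIntegral hp hη).continuousWithinAt
  have h1 : HasStrictDerivAt (fun x => ∫ η in x..ζ, periodIntegral p W η)
      (-periodIntegral p W ξ) ξ := by
    refine integral_hasStrictDerivAt_left ((hcont.mono ?_).intervalIntegrable)
      (hcont.stronglyMeasurableAtFilter isOpen_Ioo ξ hξ) (h.continuousAt_periodIntegral hp hξ)
    rw [uIcc_of_le hζ.1.le]
    exact fun x hx => ⟨hξ.1.trans_le hx.1, hx.2.trans_lt hζ.2⟩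
  have h2 := (h1.const_mul (1 - 1 / p)).const_add (actionIntegral p W ζ)
  rw [mul_neg] at h2
  refine h2.congr_of_eventuallyEq ?_
  filter_upwards [gt_mem_nhds hζ.1] with x hx
  rw [← h.actionIntegral_sub hp hx.le]
  ring

lemma strictAntiOn_actionIntegral (h : IsDoubleWell p W0 W) (hp : 1 < p) :
    StrictAntiOn (actionIntegral p W) (Icc 0 W0) := by
  refine strictAntiOn_of_deriv_neg (convex_Icc 0 W0)
    (h.continuous_actionIntegral hp).continuousOn fun ξ hξ => ?_
  rw [interior_Icc] at hξ
  rw [(h.hasStrictDerivAt_actionIntegral hp hξ).hasDerivAt.deriv]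
  exact neg_neg_of_pos (mul_pos (one_sub_inv_pos hp) (h.periodIntegral_pos hp hξ))

lemma actionIntegral_pos (h : IsDoubleWell p W0 W) (hp : 1 < p) {ξ : ℝ} (hξ : ξ ∈ Ico 0 W0) :
    0 < actionIntegral p W ξ := by
  rw [← h.actionIntegral_top hp]
  exact h.strictAntiOn_actionIntegral hp ⟨hξ.1, hξ.2.le⟩
    ⟨hξ.1.trans hξ.2.le, le_rfl⟩ hξ.2

end IsDoubleWell

namespace IsDoubleWell

variable {p W0 ξ : ℝ} {W v v' : ℝ → ℝ}

/-- Weight on energy level `ξ` whose integral over the well vanishes. -/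
def balancedWeight (p : ℝ) (W : ℝ → ℝ) (ξ u : ℝ) : ℝ :=
  periodIntegral p W ξ * max (W u - ξ) 0 ^ (1 - 1 / p) -
    actionIntegral p W ξ * max (W u - ξ) 0 ^ (-(1 / p))

/-- Primitive of `balancedWeight` from the left bottom of the well. -/
def balancedPrimitive (p : ℝ) (W : ℝ → ℝ) (ξ u : ℝ) : ℝ :=
  ∫ x in (-1:ℝ)..u, balancedWeight p W ξ x

lemma balancedWeight_eq_zero (hp : 1 < p) {u : ℝ} (hu : W u ≤ ξ) :
    balancedWeight p W ξ u = 0 := by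
  rw [balancedWeight, max_eq_right (sub_nonpos.2 hu), zero_rpow (one_sub_inv_pos hp).ne',
    zero_rpow (neg_inv_neg hp).ne, mul_zero, mul_zero, sub_zero]

lemma intervalIntegrable_balancedWeight (h : IsDoubleWell p W0 W) (hp : 1 < p)
    (hξ : ξ ∈ Ioo 0 W0) : IntervalIntegrable (balancedWeight p W ξ) volume (-1) 1 := by
  have hc : Continuous fun u => max (W u - ξ) 0 ^ (1 - 1 / p) :=
    (h.continuous_actionIntegrand hp).comp (continuous_const.prodMk continuous_id)
  exact ((hc.intervalIntegrable _ _).const_mul _).sub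
    ((h.intervalIntegrable hp hξ).const_mul _)

lemma balancedPrimitive_one (h : IsDoubleWell p W0 W) (hp : 1 < p) (hξ : ξ ∈ Ioo 0 W0) :
    balancedPrimitive p W ξ 1 = 0 := by
  have hc : Continuous fun u => max (W u - ξ) 0 ^ (1 - 1 / p) :=
    (h.continuous_actionIntegrand hp).comp (continuous_const.prodMk continuous_id)
  simp only [balancedPrimitive, balancedWeight]
  rw [intervalIntegral.integral_sub ((hc.intervalIntegrable _ _).const_mul _)
    ((h.intervalIntegrable hp hξ).const_mul _), intervalIntegral.integral_const_mul,
    intervalIntegral.integral_const_mul, ← actionIntegral, ← periodIntegral]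
  ring

lemma continuousOn_balancedPrimitive (h : IsDoubleWell p W0 W) (hp : 1 < p)
    (hξ : ξ ∈ Ioo 0 W0) : ContinuousOn (balancedPrimitive p W ξ) (Icc (-1:ℝ) 1) := by
  have := continuousOn_primitive_interval' (h.intervalIntegrable_balancedWeight hp hξ)
    left_mem_uIcc
  rwa [uIcc_of_le (by norm_num)] at this

lemma balancedPrimitive_eq_zero (h : IsDoubleWell p W0 W) (hp : 1 < p) (hξ : ξ ∈ Ioo 0 W0)
    {u : ℝ} (hu : u ∈ Ioo (-1:ℝ) 1) (huξ : W u = ξ) : balancedPrimitive p W ξ u = 0 := by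
  rcases le_total 0 u with h0 | h0
  · have hfi := h.intervalIntegrable_balancedWeight hp hξ
    have h1 : ∫ x in u..1, balancedWeight p W ξ x = 0 := by
      refine (intervalIntegral.integral_congr (g := fun _ => 0) fun x hx => ?_).trans
        intervalIntegral.integral_zero
      rw [uIcc_of_le hu.2.le] at hx
      refine balancedWeight_eq_zero hp (huξ ▸ ?_)
      exact h.right.strictAntiOn.antitoneOn ⟨h0, hu.2.le⟩ ⟨h0.trans hx.1, hx.2⟩ hx.1
    rw [← h.balancedPrimitive_one hp hξ, balancedPrimitive, balancedPrimitive,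
      ← integral_add_adjacent_intervals (b := u) (c := 1) (hfi.mono_set ?_) (hfi.mono_set ?_),
      h1, add_zero]
    all_goals
      rw [uIcc_of_le (a := (-1:ℝ)) (b := 1) (by norm_num)]
      exact uIcc_subset_Icc (by simp [hu.1.le, hu.2.le]) (by simp [hu.1.le, hu.2.le])
  · refine (intervalIntegral.integral_congr (g := fun _ => 0) fun x hx => ?_).trans
      intervalIntegral.integral_zero
    rw [uIcc_of_le hu.1.le] at hx
    refine balancedWeight_eq_zero hp (huξ ▸ ?_)
    have := h.left.strictAntiOn.antitoneOn (a := -u) (b := -x)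
      ⟨by linarith, by linarith [hu.1]⟩ ⟨by linarith [hx.2], by linarith [hx.1]⟩
      (by linarith [hx.2])
    simpa only [neg_neg] using this

lemma hasDerivAt_balancedPrimitive (h : IsDoubleWell p W0 W) (hp : 1 < p) (hξ : ξ ∈ Ioo 0 W0)
    {u : ℝ} (hu : u ∈ Ioo (-1:ℝ) 1) (huξ : ξ < W u) :
    HasDerivAt (balancedPrimitive p W ξ) (balancedWeight p W ξ u) u := by
  have hfi := h.intervalIntegrable_balancedWeight hp hξ
  have hpos : max (W u - ξ) 0 ≠ 0 := (lt_max_of_lt_left (sub_pos.2 huξ)).ne'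
  have hc : ContinuousAt (fun u => max (W u - ξ) 0) u :=
    ((h.continuous.sub continuous_const).max continuous_const).continuousAt
  refine integral_hasDerivAt_right (hfi.mono_set ?_) ?_ ?_
  · rw [uIcc_of_le (a := (-1:ℝ)) (b := 1) (by norm_num)]
    exact uIcc_subset_Icc (by simp) (by simp [hu.1.le, hu.2.le])
  · refine AEStronglyMeasurable.stronglyMeasurableAtFilter_of_mem (s := Ioo (-1:ℝ) 1) ?_
      (Ioo_mem_nhds hu.1 hu.2)
    exact ((intervalIntegrable_iff_integrableOn_Ioo_of_le (by norm_num)).1 hfi).1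
  · exact (continuousAt_const.mul (hc.rpow_const (Or.inl hpos))).sub
      (continuousAt_const.mul (hc.rpow_const (Or.inl hpos)))

lemma deriv_ne_zero (h : IsDoubleWell p W0 W) {u : ℝ} (hu : u ∈ Ioo (-1:ℝ) 1) (hu0 : u ≠ 0) :
    deriv W u ≠ 0 := by
  rcases lt_or_gt_of_ne hu0 with h0 | h0
  · have := h.left.deriv_neg (u := -u) ⟨by linarith, by linarith [hu.1]⟩
    rw [deriv_comp_neg, neg_neg] at this
    linarith
  · exact (h.right.deriv_neg ⟨h0, hu.2⟩).ne

lemma Lfun_eq (hp : 1 < p) (s : ℝ) : Lfun p s = (1 - 1 / p) * |s| ^ p := by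
  have hp0 : p ≠ 0 := by linarith
  have hp1 : p - 1 ≠ 0 := by linarith
  rw [Lfun]
  field_simp

/-- An orbit of positive energy starting at the top stays inside the well. -/
lemma orbit_mem (h : IsDoubleWell p W0 W) (hp : 1 < p) (hξ : 0 < ξ) (hv : Continuous v)
    (hE : ∀ x, -(1 / 1) * Lfun p (v' x) + W (v x) = ξ) (hv0 : v 0 = 0) (x : ℝ) :
    v x ∈ Ioo (-1:ℝ) 1 := by
  have hq := one_sub_inv_pos hp
  have hne : ∀ y, W (v y) ≠ 0 := by
    intro y hy
    have h1 := hE y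
    rw [hy, Lfun_eq hp] at h1
    have : 0 ≤ (1 - 1 / p) * |v' y| ^ p := by positivity
    linarith
  have hrange : (range v).OrdConnected := (isPreconnected_range hv).ordConnected
  have h0 : (0:ℝ) ∈ range v := ⟨0, hv0⟩
  constructor
  · by_contra! hle
    obtain ⟨y, hy⟩ := hrange.out ⟨x, rfl⟩ h0 ⟨hle, by norm_num⟩
    exact hne y (by rw [hy]; exact h.left.one_eq)
  · by_contra! hle
    obtain ⟨y, hy⟩ := hrange.out h0 ⟨x, rfl⟩ ⟨by norm_num, hle⟩
    exact hne y (by rw [hy]; exact h.right.one_eq)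

lemma countable_setOf_eq_zero_of_hasDerivAt {f g : ℝ → ℝ} (hf : ∀ x, HasDerivAt f (g x) x)
    (hg : ∀ x, f x = 0 → g x ≠ 0) : {x | f x = 0}.Countable := by
  refine (countable_setOfPred_isolated_right_within (s := {x | f x = 0})).mono fun x hx => ?_
  refine ⟨hx, ?_⟩
  have h1 := (hf x).eventually_ne (hg x hx) (c := 0)
  rw [← empty_mem_iff_bot]
  have h2 : ∀ᶠ z in 𝓝[{x | f x = 0} ∩ Ioi x] x, f z ≠ 0 :=
    h1.filter_mono (nhdsWithin_mono x fun z hz => (ne_of_gt hz.2 : z ≠ x))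
  filter_upwards [h2, self_mem_nhdsWithin] with z hz hz' using hz hz'.1

lemma integral_Lfun_mul_periodIntegral (h : IsDoubleWell p W0 W) (hp : 1 < p)
    (hξ : ξ ∈ Ioo 0 W0) (hsol : IsSolAuto p 1 W v v')
    (hE : ∀ x, -(1 / 1) * Lfun p (v' x) + W (v x) = ξ) (hv0 : v 0 = 0) {T : ℝ}
    (hT : Function.Periodic v T) :
    (∫ y in (0:ℝ)..T, Lfun p (v' y)) * periodIntegral p W ξ = T * actionIntegral p W ξ := by
  obtain ⟨hv'c, hv, g, -, hg, hgW⟩ := hsol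
  have hp0 : 0 < p := by linarith
  have hq := one_sub_inv_pos hp
  have hvc : Continuous v := continuous_iff_continuousAt.2 fun x => (hv x).continuousAt
  have hmem := h.orbit_mem hp hξ.1 hvc hE hv0
  have hL : ∀ y, Lfun p (v' y) = W (v y) - ξ := fun y => by linarith [hE y]
  have hL' : ∀ y, W (v y) - ξ = (1 - 1 / p) * |v' y| ^ p := fun y => by rw [← hL, Lfun_eq hp]
  have hpos : ∀ y, v' y ≠ 0 → ξ < W (v y) := fun y hy => by
    have := mul_pos hq (rpow_pos_of_pos (abs_pos.2 hy) p)
    linarith [hL' y]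
  have hzero : ∀ y, v' y = 0 → W (v y) = ξ := fun y hy => by
    have := hL' y
    rw [hy, abs_zero, zero_rpow hp0.ne', mul_zero] at this
    linarith
  have hv'T : v' T = v' 0 := by
    have h1 : HasDerivAt v (v' T) 0 := by
      have h2 : HasDerivAt (fun x => v (x + T)) (v' T) 0 := by
        refine HasDerivAt.comp_add_const 0 T ?_
        rw [zero_add]
        exact hv T
      rwa [show (fun x => v (x + T)) = v from funext hT] at h2
    exact h1.unique (hv 0)
  set c := (1 - 1 / p) ^ (-(1 / p)) with hc
  have hc0 : 0 < c := rpow_pos_of_pos hq _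
  have habs : ∀ y, v' y ≠ 0 → |v' y| * balancedWeight p W ξ (v y) =
      c * ((W (v y) - ξ) * periodIntegral p W ξ - actionIntegral p W ξ) := by
    intro y hy
    have hw : 0 < W (v y) - ξ := sub_pos.2 (hpos y hy)
    have h1 : |v' y| = c * (W (v y) - ξ) ^ (1 / p) := by
      rw [hL' y, mul_rpow hq.le (rpow_nonneg (abs_nonneg _) _), ← rpow_mul (abs_nonneg _),
        mul_one_div_cancel hp0.ne', rpow_one, hc, ← mul_assoc, ← rpow_add hq,
        neg_add_cancel, rpow_zero, one_mul]
    have h2 : (W (v y) - ξ) ^ (1 / p) * (W (v y) - ξ) ^ (1 - 1 / p) = W (v y) - ξ := by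
      rw [← rpow_add hw, add_sub_cancel, rpow_one]
    have h3 : (W (v y) - ξ) ^ (1 / p) * (W (v y) - ξ) ^ (-(1 / p)) = 1 := by
      rw [← rpow_add hw, add_neg_cancel, rpow_zero]
    rw [h1, balancedWeight, max_eq_left hw.le]
    linear_combination c * periodIntegral p W ξ * h2 - c * actionIntegral p W ξ * h3
  have hΦv : Continuous fun y => balancedPrimitive p W ξ (v y) :=
    (h.continuousOn_balancedPrimitive hp hξ).comp_continuous hvc
      fun y => Ioo_subset_Icc_self (hmem y)
  have hderiv : ∀ y, v' y ≠ 0 → HasDerivAt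
      (fun y => Real.sign (v' y) * balancedPrimitive p W ξ (v y))
      (c * ((W (v y) - ξ) * periodIntegral p W ξ - actionIntegral p W ξ)) y := by
    intro y hy
    have h1 : HasDerivAt (fun y => balancedPrimitive p W ξ (v y)) _ y :=
      (h.hasDerivAt_balancedPrimitive hp hξ (hmem y) (hpos y hy)).comp y (hv y)
    rw [← habs y hy]
    rcases lt_or_gt_of_ne hy with hy | hy
    · rw [abs_of_neg hy]
      have h3 := h1.neg
      rw [← mul_neg, mul_comm] at h3
      refine h3.congr_of_eventuallyEq ?_
      filter_upwards [hv'c.continuousAt.eventually (gt_mem_nhds hy)] with z hz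
      simp [Real.sign_of_neg hz]
    · rw [abs_of_pos hy, mul_comm]
      refine h1.congr_of_eventuallyEq ?_
      filter_upwards [hv'c.continuousAt.eventually (lt_mem_nhds hy)] with z hz
      simp [Real.sign_of_pos hz]
  have hcont : Continuous fun y => Real.sign (v' y) * balancedPrimitive p W ξ (v y) := by
    refine continuous_iff_continuousAt.2 fun y => ?_
    by_cases hy : v' y = 0
    · have h0 := h.balancedPrimitive_eq_zero hp hξ (hmem y) (hzero y hy)
      rw [ContinuousAt, h0, mul_zero]
      refine squeeze_zero_norm (fun z => ?_) (a := fun z => |balancedPrimitive p W ξ (v z)|) ?_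
      · rw [norm_mul, Real.norm_eq_abs, Real.norm_eq_abs]
        refine mul_le_of_le_one_left (abs_nonneg _) ?_
        rcases Real.sign_apply_eq (v' z) with h | h | h <;> simp [h]
      · have := (hΦv.abs.tendsto y)
        rwa [h0, abs_zero] at this
    · exact (hderiv y hy).continuousAt
  have hcount : {y | v' y = 0}.Countable := by
    have : {y | v' y = 0} ⊆ {y | phip p (v' y) = 0} := fun y hy => by
      have hy : v' y = 0 := hy
      simp [phip, hy]
    refine (countable_setOf_eq_zero_of_hasDerivAt hg fun y hy => ?_).mono this
    have hy' : v' y = 0 := by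
      rcases mul_eq_zero.1 hy with h1 | h1
      · by_contra hne
        exact (rpow_pos_of_pos (abs_pos.2 hne) _).ne' h1
      · exact h1
    rw [hgW, one_mul]
    refine h.deriv_ne_zero (hmem y) fun h0 => ?_
    have := hzero y hy'
    rw [h0, h.right.zero_eq] at this
    exact hξ.2.ne' this
  have hWv : Continuous fun y => W (v y) - ξ := (h.continuous.comp hvc).sub continuous_const
  have hFTC := integral_eq_of_hasDerivAt_off_countable
    (fun y => Real.sign (v' y) * balancedPrimitive p W ξ (v y))
    (fun y => c * ((W (v y) - ξ) * periodIntegral p W ξ - actionIntegral p W ξ))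
    (a := 0) (b := T) hcount hcont.continuousOn (fun y hy => hderiv y hy.2)
    ((continuous_const.mul ((hWv.mul continuous_const).sub continuous_const)).intervalIntegrable
      _ _)
  have hvT : v T = v 0 := by simpa using hT 0
  simp only [hv'T, hvT, sub_self] at hFTC
  rw [intervalIntegral.integral_const_mul, intervalIntegral.integral_sub
    ((hWv.intervalIntegrable _ _).mul_const _) intervalIntegrable_const,
    intervalIntegral.integral_mul_const, intervalIntegral.integral_const, smul_eq_mul,
    sub_zero] at hFTC
  simp only [hL]
  linarith [(mul_eq_zero.1 hFTC).resolve_left hc0.ne']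

end IsDoubleWell

/-- The properties of the function `J` integrating the equation `E' = (a'/a) K(E)`: the quantity
`a ^ q * J(E)` is conserved. -/
structure IsActionProfile (q W0 : ℝ) (J K : ℝ → ℝ) : Prop where
  q_pos : 0 < q
  top_pos : 0 < W0
  continuous : Continuous J
  strictAntiOn : StrictAntiOn J (Icc 0 W0)
  apply_top : J W0 = 0
  pos : ∀ ξ ∈ Ioo 0 W0, 0 < K ξ
  hasStrictDerivAt : ∀ ξ ∈ Ioo 0 W0, HasStrictDerivAt J (-(q * (J ξ / K ξ))) ξ
  apply_zero : K 0 = 0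
  tendsto_zero : Tendsto K (𝓝[>] 0) (𝓝 0)

/-- A function which is locally constant off its zero set takes the same value at both ends of an
interval. -/
lemma eq_endpoints_of_hasDerivAt_zero {F : ℝ → ℝ} {c d : ℝ} (hcd : c < d)
    (hF : ContinuousOn F (Icc c d)) (hF0 : ∀ x ∈ Icc c d, 0 ≤ F x)
    (hd : ∀ x ∈ Ioo c d, F x ≠ 0 → HasDerivAt F 0 x) : F c = F d := by
  by_contra hne
  have hc := hF0 c (left_mem_Icc.2 hcd.le)
  have hd' := hF0 d (right_mem_Icc.2 hcd.le)
  set ε := (F c + F d) / 2 with hε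
  have hε0 : 0 < ε := by
    rcases lt_or_gt_of_ne hne with h | h <;> linarith
  have hderiv : ∀ x ∈ Ioo c d, HasDerivAt (fun x => max (F x - ε) 0 ^ 2) 0 x := by
    intro x hx
    have hFx : ContinuousAt F x :=
      hF.continuousAt (Icc_mem_nhds hx.1 hx.2)
    rcases lt_trichotomy (F x) ε with h | h | h
    · refine (hasDerivAt_const x (0:ℝ)).congr_of_eventuallyEq ?_
      filter_upwards [hFx.eventually (gt_mem_nhds h)] with y hy
      rw [max_eq_right (sub_nonpos.2 (le_of_lt hy)), sq, zero_mul]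
    · have h1 : HasDerivAt (fun t : ℝ => max (t - ε) 0 ^ 2) 0 (F x) := by
        rw [hasDerivAt_iff_isLittleO, h]
        simp only [sub_self, max_self, smul_zero, sub_zero, ne_eq, OfNat.ofNat_ne_zero,
          not_false_eq_true, zero_pow]
        have h2 : (fun t : ℝ => max (t - ε) 0 ^ 2) =O[𝓝 ε] fun t => (t - ε) ^ 2 := by
          refine IsBigO.of_norm_le fun t => ?_
          rw [norm_pow, Real.norm_of_nonneg (le_max_right _ _), ← sq_abs (t - ε)]
          gcongr
          exact max_le (le_abs_self _) (abs_nonneg _)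
        refine h2.trans_isLittleO ?_
        have h3 : Tendsto (fun t => t - ε) (𝓝 ε) (𝓝 0) :=
          tendsto_sub_nhds_zero_iff.2 tendsto_id
        simpa [sq] using ((isLittleO_one_iff ℝ).2 h3).mul_isBigO (isBigO_refl (fun t => t - ε) _)
      have h2 := h1.comp x (hd x hx (by rw [h]; exact hε0.ne'))
      rwa [mul_zero] at h2
    · have h1 := ((hd x hx (hε0.trans h).ne').sub_const ε).pow 2
      simp only [mul_zero] at h1
      refine h1.congr_of_eventuallyEq ?_
      filter_upwards [hFx.eventually (lt_mem_nhds h)] with y hy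
      simp [max_eq_left (sub_nonneg.2 (le_of_lt hy))]
  obtain ⟨x, hx, hslope⟩ := exists_hasDerivAt_eq_slope (fun x => max (F x - ε) 0 ^ 2) (fun _ => 0)
    hcd (((hF.sub continuousOn_const).sup continuousOn_const).pow 2) hderiv
  rw [eq_comm, div_eq_zero_iff, or_iff_left (sub_pos.2 hcd).ne', sub_eq_zero,
    pow_left_inj₀ (le_max_right _ _) (le_max_right _ _) two_ne_zero] at hslope
  rcases lt_or_gt_of_ne hne with h | h
  · rw [max_eq_right (by linarith : F c - ε ≤ 0), max_eq_left (by linarith : 0 ≤ F d - ε)] at hslope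
    linarith
  · rw [max_eq_right (by linarith : F d - ε ≤ 0), max_eq_left (by linarith : 0 ≤ F c - ε)] at hslope
    linarith

namespace IsActionProfile

variable {q W0 : ℝ} {J K a E : ℝ → ℝ}

lemma pos_of_lt (h : IsActionProfile q W0 J K) {ξ : ℝ} (hξ : ξ ∈ Ico 0 W0) : 0 < J ξ := by
  rw [← h.apply_top]
  exact h.strictAntiOn ⟨hξ.1, hξ.2.le⟩ ⟨h.top_pos.le, le_rfl⟩ hξ.2

lemma nonneg (h : IsActionProfile q W0 J K) {ξ : ℝ} (hξ : ξ ∈ Icc 0 W0) : 0 ≤ J ξ := by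
  rw [← h.apply_top]
  exact h.strictAntiOn.antitoneOn hξ ⟨h.top_pos.le, le_rfl⟩ hξ.2

lemma conserved (h : IsActionProfile q W0 J K) (ha : Differentiable ℝ a)
    (hapos : ∀ x ∈ Icc (0:ℝ) 1, 0 < a x) (hE : IsEnergySol a K W0 E) {c d : ℝ} (hc : 0 ≤ c)
    (hcd : c < d) (hd : d ≤ 1) (hpos : ∀ x ∈ Ioo c d, 0 < E x) :
    a c ^ q * J (E c) = a d ^ q * J (E d) := by
  have hsub : Icc c d ⊆ Icc 0 1 := Icc_subset_Icc hc hd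
  refine eq_endpoints_of_hasDerivAt_zero (F := fun x => a x ^ q * J (E x)) hcd ?_
    (fun x hx => ?_) fun x hx hne => ?_
  · refine ContinuousOn.mul (ha.continuous.continuousOn.rpow_const fun _ _ => Or.inr h.q_pos.le) ?_
    exact h.continuous.comp_continuousOn fun x hx =>
      ((hE.2 x (hsub hx)).continuousWithinAt).mono hsub
  · exact mul_nonneg (rpow_nonneg (hapos x (hsub hx)).le _) (h.nonneg (hE.1 x (hsub hx)))
  · have hx01 := hsub (Ioo_subset_Icc_self hx)
    have hax := hapos x hx01
    have hEx : E x ∈ Ioo 0 W0 := by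
      refine ⟨hpos x hx, lt_of_le_of_ne (hE.1 x hx01).2 fun heq => hne ?_⟩
      simp only [heq, h.apply_top, mul_zero]
    have hEd : HasDerivAt E (deriv a x / a x * K (E x)) x :=
      (hE.2 x hx01).hasDerivAt (Icc_mem_nhds (hc.trans_lt hx.1) (hx.2.trans_le hd))
    have h1 := ((ha x).hasDerivAt.rpow_const (p := q) (Or.inl hax.ne')).mul
      ((h.hasStrictDerivAt _ hEx).hasDerivAt.comp x hEd)
    refine h1.congr_deriv ?_
    have hK := (h.pos _ hEx).ne'
    rw [rpow_sub_one hax.ne']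
    simp only [Function.comp_apply]
    field_simp
    ring

/-- The profile of solutions of the equation emanating from zero, as a function of the ratio of
the values of the coefficient. -/
lemma exists_profile (h : IsActionProfile q W0 J K) :
    ∃ G : ℝ → ℝ, (∀ r ≤ 1, G r = 0) ∧ (∀ r, 1 < r → G r ∈ Ioo 0 W0) ∧
      ∀ r, 0 < r → HasDerivAt G (K (G r) / r) r := by
  have hJ0 : 0 < J 0 := h.pos_of_lt ⟨le_rfl, h.top_pos⟩
  have hex : ∀ r : ℝ, ∃ ξ, 1 < r → ξ ∈ Ioo 0 W0 ∧ J ξ = J 0 * r ^ (-q) := by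
    intro r
    by_cases hr : 1 < r
    · have hr0 : 0 < r := one_pos.trans hr
      have h1 := intermediate_value_Ioo' h.top_pos.le (h.continuous.continuousOn (s := Icc 0 W0))
      rw [h.apply_top] at h1
      obtain ⟨ξ, hξ, hξr⟩ := h1 (show J 0 * r ^ (-q) ∈ Ioo 0 (J 0) from ⟨by positivity,
        mul_lt_of_lt_one_right hJ0 (rpow_lt_one_of_one_lt_of_neg hr (neg_neg_of_pos h.q_pos))⟩)
      exact ⟨ξ, fun _ => ⟨hξ, hξr⟩⟩
    · exact ⟨0, fun hr' => absurd hr' hr⟩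
  choose g hg using hex
  set G : ℝ → ℝ := fun r => if 1 < r then g r else 0 with hGdef
  have hG0 : ∀ r ≤ 1, G r = 0 := fun r hr => if_neg hr.not_gt
  have hG1 : ∀ r, 1 < r → G r ∈ Ioo 0 W0 ∧ J (G r) = J 0 * r ^ (-q) := fun r hr => by
    simpa only [hGdef, if_pos hr] using hg r hr
  set N : ℝ → ℝ := fun ξ => (J 0 / J ξ) ^ q⁻¹ with hN
  have hNpow : ∀ ξ ∈ Ioo 0 W0, N ξ ^ (-q) = J ξ / J 0 := fun ξ hξ => by
    have hJξ := h.pos_of_lt ⟨hξ.1.le, hξ.2⟩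
    rw [hN, ← rpow_mul (by positivity), mul_neg, inv_mul_cancel₀ h.q_pos.ne', rpow_neg_one,
      inv_div]
  have hN1 : ∀ ξ ∈ Ioo 0 W0, 1 < N ξ := fun ξ hξ => by
    have hJξ := h.pos_of_lt ⟨hξ.1.le, hξ.2⟩
    refine one_lt_rpow ((one_lt_div hJξ).2 ?_) (inv_pos.2 h.q_pos)
    exact h.strictAntiOn ⟨le_rfl, h.top_pos.le⟩ ⟨hξ.1.le, hξ.2.le⟩ hξ.1
  have hGN : ∀ ξ ∈ Ioo 0 W0, G (N ξ) = ξ := fun ξ hξ => by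
    obtain ⟨h1, h2⟩ := hG1 _ (hN1 ξ hξ)
    rw [hNpow ξ hξ, mul_div_cancel₀ _ hJ0.ne'] at h2
    exact h.strictAntiOn.injOn (Ioo_subset_Icc_self h1) (Ioo_subset_Icc_self hξ) h2
  have hNG : ∀ r, 1 < r → N (G r) = r := fun r hr => by
    have hr0 : 0 < r := one_pos.trans hr
    simp only [hN]
    rw [(hG1 r hr).2, div_mul_cancel_left₀ hJ0.ne', ← rpow_neg hr0.le, neg_neg,
      rpow_rpow_inv hr0.le h.q_pos.ne']
  have hNd : ∀ ξ ∈ Ioo 0 W0, HasStrictDerivAt N (N ξ / K ξ) ξ := fun ξ hξ => by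
    have hJξ := h.pos_of_lt ⟨hξ.1.le, hξ.2⟩
    have hfrac : 0 < J 0 / J ξ := div_pos hJ0 hJξ
    have h1 := (hasStrictDerivAt_const ξ (J 0)).div (h.hasStrictDerivAt ξ hξ) hJξ.ne'
    have h2 := (hasStrictDerivAt_rpow_const_of_ne hfrac.ne' q⁻¹).comp ξ h1
    refine h2.congr_deriv ?_
    have hK := (h.pos ξ hξ).ne'
    have hq := h.q_pos.ne'
    rw [rpow_sub_one hfrac.ne']
    simp only [hN]
    field_simp
    ring
  have hGd : ∀ r, 1 < r → HasDerivAt G (K (G r) / r) r := by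
    intro r hr
    have hmem := (hG1 r hr).1
    have hr0 : 0 < r := one_pos.trans hr
    have hne : N (G r) / K (G r) ≠ 0 := by
      rw [hNG r hr]
      exact (div_pos hr0 (h.pos _ hmem)).ne'
    have hcont : ContinuousAt G r := by
      have hmap := (hNd _ hmem).map_nhds_eq hne
      rw [hNG r hr] at hmap
      rw [ContinuousAt, ← hmap, tendsto_map'_iff]
      refine tendsto_id.congr' ?_
      filter_upwards [Ioo_mem_nhds hmem.1 hmem.2] with ξ hξ using (hGN ξ hξ).symm
    have h1 := HasDerivAt.of_local_left_inverse hcont (hNd _ hmem).hasDerivAt hne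
      (by filter_upwards [lt_mem_nhds hr] with y hy using hNG y hy)
    rwa [hNG r hr, inv_div] at h1
  have hGt : Tendsto G (𝓝[>] 1) (𝓝[>] 0) := by
    refine tendsto_nhdsWithin_iff.2 ⟨tendsto_order.2 ⟨fun b hb => ?_, fun b hb => ?_⟩, ?_⟩
    · filter_upwards [self_mem_nhdsWithin] with r hr using hb.trans (hG1 r hr).1.1
    · obtain ⟨ε, hε⟩ := exists_between (lt_min hb h.top_pos)
      have hε' : ε ∈ Ioo 0 W0 := ⟨hε.1, hε.2.trans_le (min_le_right _ _)⟩
      filter_upwards [Ioo_mem_nhdsGT (hN1 ε hε')] with r hr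
      refine lt_trans ?_ (hε.2.trans_le (min_le_left _ _))
      obtain ⟨h1, h2⟩ := hG1 r hr.1
      refine (h.strictAntiOn.lt_iff_gt (Ioo_subset_Icc_self hε') (Ioo_subset_Icc_self h1)).1 ?_
      have h3 := rpow_lt_rpow_of_neg (one_pos.trans hr.1) hr.2 (neg_neg_of_pos h.q_pos)
      rw [hNpow ε hε', div_lt_iff₀ hJ0, mul_comm] at h3
      rwa [h2]
    · filter_upwards [self_mem_nhdsWithin] with r hr using (hG1 r hr).1.1
  refine ⟨G, hG0, fun r hr => (hG1 r hr).1, fun r hr => ?_⟩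
  rcases lt_trichotomy r 1 with hr1 | rfl | hr1
  · rw [hG0 r hr1.le, h.apply_zero, zero_div]
    refine (hasDerivAt_const r (0:ℝ)).congr_of_eventuallyEq ?_
    filter_upwards [gt_mem_nhds hr1] with y hy using hG0 y hy.le
  · rw [hG0 1 le_rfl, h.apply_zero, zero_div]
    have hleft : HasDerivWithinAt G 0 (Iic 1) 1 :=
      (hasDerivWithinAt_const 1 (Iic 1) (0:ℝ)).congr hG0 (hG0 1 le_rfl)
    have hright : HasDerivWithinAt G 0 (Ici 1) 1 := by
      refine hasDerivWithinAt_Ici_of_tendsto_deriv (s := Ioi 1)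
        (fun r hr => (hGd r hr).differentiableAt.differentiableWithinAt) ?_ self_mem_nhdsWithin ?_
      · rw [ContinuousWithinAt, hG0 1 le_rfl]
        exact hGt.mono_right nhdsWithin_le_nhds
      · have h1 : Tendsto (fun r => K (G r) / r) (𝓝[>] 1) (𝓝 (0 / 1)) :=
          (h.tendsto_zero.comp hGt).div (tendsto_id.mono_left nhdsWithin_le_nhds) one_ne_zero
        rw [zero_div] at h1
        refine h1.congr' ?_
        filter_upwards [self_mem_nhdsWithin] with r hr using (hGd r hr).deriv.symm
    have := hleft.union hright
    rwa [Iic_union_Ici, hasDerivWithinAt_univ] at this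
  · exact hGd r hr1

end IsActionProfile

lemma connectedComponentIn_eq_of_separated {P S : Set ℝ} {x : ℝ} (hS : IsPreconnected S)
    (hx : x ∈ S) (hSP : S ⊆ P) (hsep : ∀ y ∈ P, y ∉ S → ∃ z ∈ uIcc x y, z ∉ P) :
    connectedComponentIn P x = S := by
  refine Subset.antisymm (fun y hy => ?_) (hS.subset_connectedComponentIn hx hSP)
  by_contra hyS
  obtain ⟨z, hz, hzP⟩ := hsep y (connectedComponentIn_subset P x hy) hyS
  have hord : (connectedComponentIn P x).OrdConnected :=
    isPreconnected_connectedComponentIn.ordConnected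
  exact hzP (connectedComponentIn_subset P x
    (hord.uIcc_subset (mem_connectedComponentIn (hSP hx)) hy hz))

lemma exists_last_zero {E : ℝ → ℝ} {z x : ℝ} (hE : ContinuousOn E (Icc z x)) (hzx : z ≤ x)
    (hE0 : ∀ y ∈ Icc z x, 0 ≤ E y) (hz : E z = 0) (hx : 0 < E x) :
    ∃ s ∈ Ico z x, E s = 0 ∧ ∀ y ∈ Ioc s x, 0 < E y := by
  have hcl : IsCompact (Icc z x ∩ E ⁻¹' {0}) :=
    isCompact_Icc.of_isClosed_subset (hE.preimage_isClosed_of_isClosed isClosed_Icc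
      isClosed_singleton) inter_subset_left
  obtain ⟨s, ⟨hs, hs0⟩, hmax⟩ := hcl.exists_isGreatest ⟨z, left_mem_Icc.2 hzx, hz⟩
  have hs0 : E s = 0 := hs0
  refine ⟨s, ⟨hs.1, lt_of_le_of_ne hs.2 fun h => ?_⟩, hs0, fun y hy => ?_⟩
  · rw [h] at hs0
    exact hx.ne' hs0
  · have hy' : y ∈ Icc z x := ⟨hs.1.trans hy.1.le, hy.2⟩
    exact lt_of_le_of_ne (hE0 y hy') fun h => hy.1.not_ge (hmax ⟨hy', h.symm⟩)

lemma exists_first_zero {E : ℝ → ℝ} {z x : ℝ} (hE : ContinuousOn E (Icc x z)) (hxz : x ≤ z)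
    (hE0 : ∀ y ∈ Icc x z, 0 ≤ E y) (hz : E z = 0) (hx : 0 < E x) :
    ∃ t ∈ Ioc x z, E t = 0 ∧ ∀ y ∈ Ico x t, 0 < E y := by
  have hmaps : MapsTo (fun y => -y) (Icc (-z) (-x)) (Icc x z) := fun y hy =>
    ⟨by linarith [hy.2], by linarith [hy.1]⟩
  obtain ⟨s, hs, hs0, hpos⟩ := exists_last_zero (E := fun y => E (-y)) (z := -z) (x := -x)
    (hE.comp continuous_neg.continuousOn hmaps) (by linarith) (fun y hy => hE0 _ (hmaps hy))
    (by simpa using hz) (by simpa using hx)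
  refine ⟨-s, ⟨by linarith [hs.2], by linarith [hs.1]⟩, hs0, fun y hy => ?_⟩
  have := hpos (-y) ⟨by linarith [hy.2], by linarith [hy.1]⟩
  rwa [neg_neg] at this

/-- What is used of an interval of one of the three types: `b` is the value of `a` at its
endpoints not belonging to it. -/
lemma exists_base_of_type {a : ℝ → ℝ} {S : Set ℝ} (hS : TypeI a S ∨ TypeII a S ∨ TypeIII a S) :
    ∃ b, (∃ e ∈ Icc (0:ℝ) 1, a e = b) ∧ S ⊆ Icc 0 1 ∧ (∀ x ∈ S, b < a x) ∧
      (∀ x ∈ S, S ∈ 𝓝[Icc (0:ℝ) 1] x) ∧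
      ∀ x ∈ Icc (0:ℝ) 1, x ∉ S → ∀ y ∈ S, ∃ e ∈ Icc (0:ℝ) 1, a e = b ∧ |y - e| ≤ |y - x| := by
  have hleft : ∀ {x s y : ℝ}, x ≤ s → s < y → |y - s| ≤ |y - x| := fun hxs hsy => by
    rw [abs_of_pos (by linarith), abs_of_pos (by linarith)]
    linarith
  have hright : ∀ {x t y : ℝ}, t ≤ x → y < t → |y - t| ≤ |y - x| := fun hxs hsy => by
    rw [abs_of_neg (by linarith), abs_of_neg (by linarith)]
    linarith
  rcases hS with ⟨s, t, hs, hst, ht, rfl, hat, hlt⟩ | ⟨s, hs, hs1, rfl, hlt⟩ |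
    ⟨t, ht, ht1, rfl, hlt⟩
  · have hsI : s ∈ Icc (0:ℝ) 1 := ⟨hs, by linarith⟩
    have htI : t ∈ Icc (0:ℝ) 1 := ⟨by linarith, ht⟩
    refine ⟨a s, ⟨s, hsI, rfl⟩, fun x hx => ⟨hs.trans hx.1.le, hx.2.le.trans ht⟩, hlt,
      fun x hx => mem_nhdsWithin_of_mem_nhds (Ioo_mem_nhds hx.1 hx.2), fun x hx hxS y hy => ?_⟩
    rcases le_or_gt x s with hxs | hxs
    · exact ⟨s, hsI, rfl, hleft hxs hy.1⟩
    · exact ⟨t, htI, hat.symm, hright (not_lt.1 fun h => hxS ⟨hxs, h⟩) hy.2⟩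
  · have hsI : s ∈ Icc (0:ℝ) 1 := ⟨hs, hs1.le⟩
    refine ⟨a s, ⟨s, hsI, rfl⟩, fun x hx => ⟨hs.trans hx.1.le, hx.2⟩, hlt, fun x hx => ?_,
      fun x hx hxS y hy => ⟨s, hsI, rfl, hleft (not_lt.1 fun h => hxS ⟨h, hx.2⟩) hy.1⟩⟩
    filter_upwards [self_mem_nhdsWithin, mem_nhdsWithin_of_mem_nhds (lt_mem_nhds hx.1)] with
      y hy hsy using ⟨hsy, hy.2⟩
  · have htI : t ∈ Icc (0:ℝ) 1 := ⟨ht.le, ht1⟩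
    refine ⟨a t, ⟨t, htI, rfl⟩, fun x hx => ⟨hx.1, hx.2.le.trans ht1⟩, hlt, fun x hx => ?_,
      fun x hx hxS y hy => ⟨t, htI, rfl, hright (not_lt.1 fun h => hxS ⟨hx.1, h⟩) hy.2⟩⟩
    filter_upwards [self_mem_nhdsWithin, mem_nhdsWithin_of_mem_nhds (gt_mem_nhds hx.2)] with
      y hy hsy using ⟨hy.1, hsy⟩

lemma exists_abs_div_sub_one_le {a : ℝ → ℝ} (ha : ContDiff ℝ 1 a)
    (hapos : ∀ x ∈ Icc (0:ℝ) 1, 0 < a x) :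
    ∃ M > 0, ∀ y ∈ Icc (0:ℝ) 1, ∀ e ∈ Icc (0:ℝ) 1, |a y / a e - 1| ≤ M * |y - e| := by
  obtain ⟨z, hz, hmin⟩ := isCompact_Icc.exists_isMinOn (nonempty_Icc.2 zero_le_one)
    ha.continuous.continuousOn
  obtain ⟨C, hC⟩ := isCompact_Icc.exists_bound_of_continuousOn (s := Icc (0:ℝ) 1)
    (ha.continuous_deriv le_rfl).continuousOn
  have hm := hapos z hz
  have hC0 : 0 ≤ C := (norm_nonneg _).trans (hC z hz)
  refine ⟨(C + 1) / a z, by positivity, fun y hy e he => ?_⟩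
  have hae := hapos e he
  have h1 := (convex_Icc (0:ℝ) 1).norm_image_sub_le_of_norm_deriv_le
    (fun x _ => ha.differentiable one_ne_zero x) hC he hy
  rw [div_sub_one hae.ne', abs_div, abs_of_pos hae, div_mul_eq_mul_div]
  refine div_le_div₀ (by positivity) (h1.trans ?_) hm (hmin he)
  rw [Real.norm_eq_abs]
  gcongr
  linarith

namespace IsActionProfile

variable {q W0 : ℝ} {J K a E : ℝ → ℝ}

lemma lt_of_conserved (h : IsActionProfile q W0 J K) {α β ξ : ℝ} (hα : 0 < α) (hβ : 0 < β)
    (hξ : ξ ∈ Icc 0 W0) (hξ0 : 0 < ξ) (heq : α ^ q * J 0 = β ^ q * J ξ) : α < β := by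
  refine (rpow_lt_rpow_iff hα.le hβ.le h.q_pos).1 ?_
  have hJ0 : 0 < J 0 := h.pos_of_lt ⟨le_rfl, h.top_pos⟩
  have hJ := h.strictAntiOn ⟨le_rfl, h.top_pos.le⟩ hξ hξ0
  refine lt_of_mul_lt_mul_right ?_ hJ0.le
  rw [heq]
  exact mul_lt_mul_of_pos_left hJ (rpow_pos_of_pos hβ q)

/-- Structure of the positivity set of a solution vanishing somewhere. -/
lemma type_of_component (h : IsActionProfile q W0 J K) (ha : Differentiable ℝ a)
    (hapos : ∀ x ∈ Icc (0:ℝ) 1, 0 < a x) (hE : IsEnergySol a K W0 E)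
    (hzero : ∃ x ∈ Icc (0:ℝ) 1, E x = 0) {x : ℝ} (hx : x ∈ {y ∈ Icc (0:ℝ) 1 | 0 < E y}) :
    TypeI a (connectedComponentIn {y ∈ Icc (0:ℝ) 1 | 0 < E y} x) ∨
    TypeII a (connectedComponentIn {y ∈ Icc (0:ℝ) 1 | 0 < E y} x) ∨
    TypeIII a (connectedComponentIn {y ∈ Icc (0:ℝ) 1 | 0 < E y} x) := by
  obtain ⟨hx, hEx⟩ := hx
  have hEc : ContinuousOn E (Icc 0 1) := fun y hy => (hE.2 y hy).continuousWithinAt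
  have hleft : ∀ z ∈ Icc 0 x, E z = 0 → ∃ s ∈ Ico 0 x, E s = 0 ∧ ∀ y ∈ Ioc s x, 0 < E y := by
    intro z hz hz0
    have hsub : Icc z x ⊆ Icc 0 1 := Icc_subset_Icc hz.1 hx.2
    obtain ⟨s, hs, hs'⟩ := exists_last_zero (hEc.mono hsub) hz.2
      (fun y hy => (hE.1 y (hsub hy)).1) hz0 hEx
    exact ⟨s, ⟨hz.1.trans hs.1, hs.2⟩, hs'⟩
  have hright : ∀ z ∈ Icc x 1, E z = 0 → ∃ t ∈ Ioc x 1, E t = 0 ∧ ∀ y ∈ Ico x t, 0 < E y := by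
    intro z hz hz0
    have hsub : Icc x z ⊆ Icc 0 1 := Icc_subset_Icc hx.1 hz.2
    obtain ⟨t, ht, ht'⟩ := exists_first_zero (hEc.mono hsub) hz.1
      (fun y hy => (hE.1 y (hsub hy)).1) hz0 hEx
    exact ⟨t, ⟨ht.1, ht.2.trans hz.2⟩, ht'⟩
  have hnot : ∀ {z}, E z = 0 → z ∉ {y ∈ Icc (0:ℝ) 1 | 0 < E y} := fun hz hz' => hz'.2.ne' hz
  have hltl : ∀ s y, 0 ≤ s → s < y → y ≤ 1 → E s = 0 → (∀ z ∈ Ioc s y, 0 < E z) → a s < a y := by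
    intro s y hs hsy hy hs0 hpos
    have hyI : y ∈ Icc (0:ℝ) 1 := ⟨by linarith, hy⟩
    refine h.lt_of_conserved (hapos s ⟨hs, by linarith⟩) (hapos y hyI) (hE.1 y hyI)
      (hpos y ⟨hsy, le_rfl⟩) ?_
    rw [← hs0]
    exact h.conserved ha hapos hE hs hsy hy fun z hz => hpos z ⟨hz.1, hz.2.le⟩
  have hltr : ∀ t y, 0 ≤ y → y < t → t ≤ 1 → E t = 0 → (∀ z ∈ Ico y t, 0 < E z) → a t < a y := by
    intro t y hy hyt ht ht0 hpos
    have hyI : y ∈ Icc (0:ℝ) 1 := ⟨hy, by linarith⟩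
    refine h.lt_of_conserved (hapos t ⟨by linarith, ht⟩) (hapos y hyI) (hE.1 y hyI)
      (hpos y ⟨le_rfl, hyt⟩) ?_
    rw [← ht0]
    exact (h.conserved ha hapos hE hy hyt ht fun z hz => hpos z ⟨hz.1.le, hz.2⟩).symm
  by_cases hl : ∃ z ∈ Icc 0 x, E z = 0 <;> by_cases hr : ∃ z ∈ Icc x 1, E z = 0
  · left
    obtain ⟨z, hz, hz0⟩ := hl
    obtain ⟨s, hs, hs0, hsp⟩ := hleft z hz hz0
    obtain ⟨z, hz, hz0⟩ := hr
    obtain ⟨t, ht, ht0, htp⟩ := hright z hz hz0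
    have hpos : ∀ y ∈ Ioo s t, 0 < E y := fun y hy =>
      (le_total y x).elim (fun h => hsp y ⟨hy.1, h⟩) fun h => htp y ⟨h, hy.2⟩
    have hst : s < t := hs.2.trans ht.1
    refine ⟨s, t, hs.1, hst, ht.2, ?_, ?_, fun y hy => ?_⟩
    · refine connectedComponentIn_eq_of_separated isPreconnected_Ioo ⟨hs.2, ht.1⟩
        (fun y hy => ⟨⟨hs.1.trans hy.1.le, hy.2.le.trans ht.2⟩, hpos y hy⟩) fun y _ hyS => ?_
      rcases le_or_gt y s with hys | hys
      · exact ⟨s, mem_uIcc_of_ge hys hs.2.le, hnot hs0⟩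
      · exact ⟨t, mem_uIcc_of_le ht.1.le (not_lt.1 fun h => hyS ⟨hys, h⟩), hnot ht0⟩
    · have h1 := h.conserved ha hapos hE hs.1 hst ht.2 hpos
      have hJ0 : 0 < J 0 := h.pos_of_lt ⟨le_rfl, h.top_pos⟩
      rw [hs0, ht0] at h1
      exact (rpow_left_inj (hapos s ⟨hs.1, by linarith [ht.2]⟩).le
        (hapos t ⟨by linarith [hs.1], ht.2⟩).le h.q_pos.ne').1 (mul_right_cancel₀ hJ0.ne' h1)
    · exact hltl s y hs.1 hy.1 (hy.2.le.trans ht.2) hs0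
        fun z hz => hpos z ⟨hz.1, hz.2.trans_lt hy.2⟩
  · right; left
    obtain ⟨z, hz, hz0⟩ := hl
    obtain ⟨s, hs, hs0, hsp⟩ := hleft z hz hz0
    push Not at hr
    have hpos : ∀ y ∈ Ioc s 1, 0 < E y := fun y hy =>
      (le_total y x).elim (fun h => hsp y ⟨hy.1, h⟩) fun h =>
        lt_of_le_of_ne (hE.1 y ⟨hs.1.trans hy.1.le, hy.2⟩).1 (hr y ⟨h, hy.2⟩).symm
    refine ⟨s, hs.1, hs.2.trans_le hx.2, ?_, fun y hy => ?_⟩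
    · refine connectedComponentIn_eq_of_separated isPreconnected_Ioc ⟨hs.2, hx.2⟩
        (fun y hy => ⟨⟨hs.1.trans hy.1.le, hy.2⟩, hpos y hy⟩) fun y hy hyS => ?_
      exact ⟨s, mem_uIcc_of_ge (not_lt.1 fun h => hyS ⟨h, hy.1.2⟩) hs.2.le, hnot hs0⟩
    · exact hltl s y hs.1 hy.1 hy.2 hs0 fun z hz => hpos z ⟨hz.1, hz.2.trans hy.2⟩
  · right; right
    obtain ⟨z, hz, hz0⟩ := hr
    obtain ⟨t, ht, ht0, htp⟩ := hright z hz hz0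
    push Not at hl
    have hpos : ∀ y ∈ Ico 0 t, 0 < E y := fun y hy =>
      (le_total x y).elim (fun h => htp y ⟨h, hy.2⟩) fun h =>
        lt_of_le_of_ne (hE.1 y ⟨hy.1, hy.2.le.trans ht.2⟩).1 (hl y ⟨hy.1, h⟩).symm
    refine ⟨t, hx.1.trans_lt ht.1, ht.2, ?_, fun y hy => ?_⟩
    · refine connectedComponentIn_eq_of_separated isPreconnected_Ico ⟨hx.1, ht.1⟩
        (fun y hy => ⟨⟨hy.1, hy.2.le.trans ht.2⟩, hpos y hy⟩) fun y hy hyS => ?_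
      exact ⟨t, mem_uIcc_of_le ht.1.le (not_lt.1 fun h => hyS ⟨hy.1.1, h⟩), hnot ht0⟩
    · exact hltr t y hy.1 hy.2 ht.2 ht0 fun z hz => hpos z ⟨hy.1.trans hz.1, hz.2⟩
  · obtain ⟨z, hz, hz0⟩ := hzero
    exact (le_total z x).elim (fun h => absurd ⟨z, ⟨hz.1, h⟩, hz0⟩ hl)
      fun h => absurd ⟨z, ⟨h, hz.2⟩, hz0⟩ hr

/-- Solutions vanishing somewhere are determined by their zero sets. -/
lemma eqOn_of_zero_iff (h : IsActionProfile q W0 J K) (ha : Differentiable ℝ a)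
    (hapos : ∀ x ∈ Icc (0:ℝ) 1, 0 < a x) {E₁ E₂ : ℝ → ℝ} (h₁ : IsEnergySol a K W0 E₁)
    (h₂ : IsEnergySol a K W0 E₂) (hiff : ∀ x ∈ Icc (0:ℝ) 1, E₁ x = 0 ↔ E₂ x = 0)
    (hzero : ∃ x ∈ Icc (0:ℝ) 1, E₁ x = 0) : EqOn E₁ E₂ (Icc 0 1) := by
  intro x hx
  rcases (h₁.1 x hx).1.eq_or_lt with h0 | hpos
  · rw [← h0, (hiff x hx).1 h0.symm]
  obtain ⟨z, hz, hz0⟩ := hzero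
  have hEc : ContinuousOn E₁ (Icc 0 1) := fun y hy => (h₁.2 y hy).continuousWithinAt
  have hpos₂ : ∀ y ∈ Icc (0:ℝ) 1, 0 < E₁ y → 0 < E₂ y := fun y hy hy' =>
    lt_of_le_of_ne (h₂.1 y hy).1 fun h => hy'.ne' ((hiff y hy).2 h.symm)
  have hax : a x ^ q ≠ 0 := (rpow_pos_of_pos (hapos x hx) q).ne'
  refine h.strictAntiOn.injOn (h₁.1 x hx) (h₂.1 x hx) (mul_left_cancel₀ hax ?_)
  rcases le_total z x with hzx | hzx
  · have hsub : Icc z x ⊆ Icc 0 1 := Icc_subset_Icc hz.1 hx.2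
    obtain ⟨s, hs, hs0, hsp⟩ := exists_last_zero (hEc.mono hsub) hzx
      (fun y hy => (h₁.1 y (hsub hy)).1) hz0 hpos
    have hs2 : E₂ s = 0 := (hiff s (hsub ⟨hs.1, hs.2.le⟩)).1 hs0
    have hs' : 0 ≤ s := hz.1.trans hs.1
    rw [← h.conserved ha hapos h₁ hs' hs.2 hx.2 fun y hy => hsp y ⟨hy.1, hy.2.le⟩,
      ← h.conserved ha hapos h₂ hs' hs.2 hx.2 fun y hy =>
        hpos₂ y (hsub ⟨hs.1.trans hy.1.le, hy.2.le⟩) (hsp y ⟨hy.1, hy.2.le⟩), hs0, hs2]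
  · have hsub : Icc x z ⊆ Icc 0 1 := Icc_subset_Icc hx.1 hz.2
    obtain ⟨t, ht, ht0, htp⟩ := exists_first_zero (hEc.mono hsub) hzx
      (fun y hy => (h₁.1 y (hsub hy)).1) hz0 hpos
    have ht2 : E₂ t = 0 := (hiff t (hsub ⟨ht.1.le, ht.2⟩)).1 ht0
    have ht' : t ≤ 1 := ht.2.trans hz.2
    rw [h.conserved ha hapos h₁ hx.1 ht.1 ht' fun y hy => htp y ⟨hy.1.le, hy.2⟩,
      h.conserved ha hapos h₂ hx.1 ht.1 ht' fun y hy =>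
        hpos₂ y (hsub ⟨hy.1.le, hy.2.le.trans ht.2⟩) (htp y ⟨hy.1.le, hy.2⟩), ht0, ht2]

/-- A solution with prescribed zero set. -/
lemma exists_solution (h : IsActionProfile q W0 J K) (ha : ContDiff ℝ 1 a)
    (hapos : ∀ x ∈ Icc (0:ℝ) 1, 0 < a x) {𝒮 : Set (Set ℝ)} (hdisj : 𝒮.PairwiseDisjoint id)
    (htype : ∀ S ∈ 𝒮, TypeI a S ∨ TypeII a S ∨ TypeIII a S) :
    ∃ E : ℝ → ℝ, IsEnergySol a K W0 E ∧
      ∀ x ∈ Icc (0:ℝ) 1, (E x = 0 ↔ x ∈ Icc (0:ℝ) 1 \ ⋃₀ 𝒮) := by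
  classical
  obtain ⟨G, hG0, hG1, hGd⟩ := h.exists_profile
  obtain ⟨M, hM, hratio⟩ := exists_abs_div_sub_one_le ha hapos
  choose! b hbase _ hlt hopen hend using fun S hS => exists_base_of_type (htype S hS)
  have hbpos : ∀ S ∈ 𝒮, 0 < b S := fun S hS => by
    obtain ⟨e, he, hae⟩ := hbase S hS
    exact hae ▸ hapos e he
  have hGmem : ∀ r, G r ∈ Icc 0 W0 := fun r => (le_or_gt r 1).elim
    (fun hr => by rw [hG0 r hr]; exact ⟨le_rfl, h.top_pos.le⟩)
    fun hr => Ioo_subset_Icc_self (hG1 r hr)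
  set E : ℝ → ℝ := fun x => if hx : ∃ S ∈ 𝒮, x ∈ S then G (a x / b hx.choose) else 0 with hEdef
  have hE1 : ∀ S ∈ 𝒮, ∀ x ∈ S, E x = G (a x / b S) := by
    intro S hS x hx
    have hex : ∃ S ∈ 𝒮, x ∈ S := ⟨S, hS, hx⟩
    have : hex.choose = S :=
      hdisj.elim hex.choose_spec.1 hS (not_disjoint_iff.2 ⟨x, hex.choose_spec.2, hx⟩)
    simp only [hEdef, dif_pos hex, this]
  have hE0 : ∀ x ∉ ⋃₀ 𝒮, E x = 0 := fun x hx => dif_neg fun ⟨S, hS, hxS⟩ => hx ⟨S, hS, hxS⟩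
  refine ⟨E, ⟨fun x _ => ?_, fun x hx => ?_⟩, fun x hx => ⟨fun h0 => ⟨hx, ?_⟩, fun h0 => hE0 x h0.2⟩⟩
  · by_cases hx : x ∈ ⋃₀ 𝒮
    · obtain ⟨S, hS, hxS⟩ := hx
      rw [hE1 S hS x hxS]
      exact hGmem _
    · rw [hE0 x hx]
      exact ⟨le_rfl, h.top_pos.le⟩
  · by_cases hxA : x ∈ ⋃₀ 𝒮
    · obtain ⟨S, hS, hxS⟩ := hxA
      have hb := hbpos S hS
      have hax := hapos x hx
      have h1 : HasDerivAt (fun y => G (a y / b S)) _ x := (hGd _ (div_pos hax hb)).comp x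
        ((ha.differentiable one_ne_zero x).hasDerivAt.div_const (b S))
      have h2 : HasDerivWithinAt E (K (G (a x / b S)) / (a x / b S) * (deriv a x / b S))
          (Icc 0 1) x := by
        refine h1.hasDerivWithinAt.congr_of_eventuallyEq ?_ (hE1 S hS x hxS)
        filter_upwards [hopen S hS x hxS] with y hy using hE1 S hS y hy
      refine h2.congr_deriv ?_
      rw [hE1 S hS x hxS]
      field_simp
    · rw [hE0 x hxA, h.apply_zero, mul_zero, hasDerivWithinAt_iff_isLittleO]
      simp only [hE0 x hxA, smul_zero, sub_zero]
      have hGo := hGd 1 one_pos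
      rw [hG0 1 le_rfl, h.apply_zero, zero_div, hasDerivAt_iff_isLittleO] at hGo
      simp only [hG0 1 le_rfl, smul_zero, sub_zero] at hGo
      refine IsLittleO.of_bound fun ε hε => ?_
      obtain ⟨δ, hδ, hGδ⟩ := Metric.eventually_nhds_iff.1 (hGo.bound (div_pos hε hM))
      filter_upwards [self_mem_nhdsWithin,
        mem_nhdsWithin_of_mem_nhds (Metric.ball_mem_nhds x (div_pos hδ hM))] with y hy hyx
      by_cases hyA : y ∈ ⋃₀ 𝒮
      · obtain ⟨S, hS, hyS⟩ := hyA
        obtain ⟨e, he, hae, hle⟩ := hend S hS x hx (fun hxS => hxA ⟨S, hS, hxS⟩) y hyS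
        have h1 : |a y / b S - 1| ≤ M * |y - x| := by
          rw [← hae]
          exact (hratio y hy e he).trans (by gcongr)
        rw [Metric.mem_ball, Real.dist_eq, lt_div_iff₀ hM, mul_comm] at hyx
        have h2 := hGδ (y := a y / b S) (by rw [Real.dist_eq]; exact h1.trans_lt hyx)
        rw [hE1 S hS y hyS]
        calc ‖G (a y / b S)‖ ≤ ε / M * |a y / b S - 1| := h2
          _ ≤ ε / M * (M * |y - x|) := by gcongr
          _ = ε * ‖y - x‖ := by
            rw [Real.norm_eq_abs]
            field_simp
      · rw [hE0 y hyA, norm_zero]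
        positivity
  · rintro ⟨S, hS, hxS⟩
    rw [hE1 S hS x hxS] at h0
    exact (hG1 _ ((one_lt_div (hbpos S hS)).2 (hlt S hS x hxS))).1.ne' h0

end IsActionProfile

lemma subset_Icc_of_type {a : ℝ → ℝ} {S : Set ℝ} (hS : TypeI a S ∨ TypeII a S ∨ TypeIII a S) :
    S ⊆ Icc 0 1 := by
  obtain ⟨-, -, h, -⟩ := exists_base_of_type hS
  exact h

lemma IsDoubleWell.isActionProfile {p W0 : ℝ} {W T K : ℝ → ℝ} (h : IsDoubleWell p W0 W)
    (hp : 1 < p) (hW0 : 0 < W0)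
    (hflat : ∃ C > 0, ∃ δ ∈ Ioo (0:ℝ) 1, ∀ u ∈ Icc (1 - δ) 1, W u ≤ C * (1 - u) ^ p)
    (hTK : ∀ ξ ∈ Set.Ioo 0 W0, ∃ v v' : ℝ → ℝ,
      IsSolAuto p 1 W v v' ∧ (∀ x, -(1 / 1) * Lfun p (v' x) + W (v x) = ξ) ∧
      v 0 = 0 ∧ 0 < v' 0 ∧
      IsLeast {c : ℝ | 0 < c ∧ Function.Periodic v c} (T ξ) ∧
      K ξ = (1 / T ξ) * ∫ y in (0:ℝ)..(T ξ), Lfun p (v' y))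
    (hK0 : K 0 = 0) : IsActionProfile (1 - 1 / p) W0 (actionIntegral p W) K := by
  have hK : ∀ ξ ∈ Ioo 0 W0, K ξ = actionIntegral p W ξ / periodIntegral p W ξ := by
    intro ξ hξ
    obtain ⟨v, v', hsol, hE, hv0, -, ⟨⟨hT0, hT⟩, -⟩, hKξ⟩ := hTK ξ hξ
    have h1 := h.integral_Lfun_mul_periodIntegral hp hξ hsol hE hv0 hT
    rw [hKξ, eq_div_iff (h.periodIntegral_pos hp hξ).ne', mul_assoc, h1, one_div,
      inv_mul_cancel_left₀ hT0.ne']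
  have hJ : ∀ ξ ∈ Ioo 0 W0, 0 < actionIntegral p W ξ := fun ξ hξ =>
    h.actionIntegral_pos hp ⟨hξ.1.le, hξ.2⟩
  refine ⟨one_sub_inv_pos hp, hW0, h.continuous_actionIntegral hp,
    h.strictAntiOn_actionIntegral hp, h.actionIntegral_top hp, fun ξ hξ => ?_, fun ξ hξ => ?_,
    hK0, ?_⟩
  · rw [hK ξ hξ]
    exact div_pos (hJ ξ hξ) (h.periodIntegral_pos hp hξ)
  · rw [hK ξ hξ, div_div_cancel₀ (hJ ξ hξ).ne']
    exact h.hasStrictDerivAt_actionIntegral hp hξ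
  · have h1 := (((h.continuous_actionIntegral hp).tendsto 0).mono_left
      (nhdsWithin_le_nhds (s := Ioi 0))).div_atTop
      (h.tendsto_periodIntegral_atTop hp hW0 hflat)
    refine h1.congr' ?_
    filter_upwards [Ioo_mem_nhdsGT hW0] with ξ hξ using (hK ξ hξ).symm

/-- Description of the connected components of `{E > 0}` for solutions of
the limit equation vanishing somewhere, and the converse existence/uniqueness statement. -/
theorem limit_equation_solutions_structure
    (p : ℝ) (hp : 1 < p)
    (a : ℝ → ℝ) (haC : ContDiff ℝ 1 a) (hapos : ∀ x ∈ Set.Icc (0:ℝ) 1, 0 < a x)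
    (W : ℝ → ℝ) (hW : ContDiff ℝ 1 W)
    (Cm1 C0 C1 W0 : ℝ) (hW1 : W1cond p W Cm1 C0 C1 W0) (hW2 : W2cond p W)
    (T K : ℝ → ℝ)
    (hTK : ∀ ξ ∈ Set.Ioo 0 W0, ∃ v v' : ℝ → ℝ,
      IsSolAuto p 1 W v v' ∧ (∀ x, -(1 / 1) * Lfun p (v' x) + W (v x) = ξ) ∧
      v 0 = 0 ∧ 0 < v' 0 ∧
      IsLeast {c : ℝ | 0 < c ∧ Function.Periodic v c} (T ξ) ∧
      K ξ = (1 / T ξ) * ∫ y in (0:ℝ)..(T ξ), Lfun p (v' y))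
    (hK0 : K 0 = 0) (hKW0 : K W0 = 0) :
    -- direct statement: structure of the connected components of `{E > 0}`
    (∀ E : ℝ → ℝ, IsEnergySol a K W0 E → (∃ x ∈ Set.Icc (0:ℝ) 1, E x = 0) →
      ∀ x ∈ {y ∈ Set.Icc (0:ℝ) 1 | 0 < E y},
        TypeI a (connectedComponentIn {y ∈ Set.Icc (0:ℝ) 1 | 0 < E y} x) ∨
        TypeII a (connectedComponentIn {y ∈ Set.Icc (0:ℝ) 1 | 0 < E y} x) ∨
        TypeIII a (connectedComponentIn {y ∈ Set.Icc (0:ℝ) 1 | 0 < E y} x)) ∧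
    -- converse statement: existence and (if `A ≠ [0,1]`) uniqueness
    (∀ (A : Set ℝ) (𝒮 : Set (Set ℝ)), 𝒮.PairwiseDisjoint id →
      (∀ S ∈ 𝒮, TypeI a S ∨ TypeII a S ∨ TypeIII a S) → A = ⋃₀ 𝒮 →
      (∃ E : ℝ → ℝ, IsEnergySol a K W0 E ∧
        ∀ x ∈ Set.Icc (0:ℝ) 1, (E x = 0 ↔ x ∈ Set.Icc (0:ℝ) 1 \ A)) ∧
      (A ≠ Set.Icc (0:ℝ) 1 →
        ∀ E1 E2 : ℝ → ℝ,
          (IsEnergySol a K W0 E1 ∧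
            ∀ x ∈ Set.Icc (0:ℝ) 1, (E1 x = 0 ↔ x ∈ Set.Icc (0:ℝ) 1 \ A)) →
          (IsEnergySol a K W0 E2 ∧
            ∀ x ∈ Set.Icc (0:ℝ) 1, (E2 x = 0 ↔ x ∈ Set.Icc (0:ℝ) 1 \ A)) →
          Set.EqOn E1 E2 (Set.Icc 0 1))) := by
  have hprof := (hW1.isDoubleWell hp hW hW2).isActionProfile hp hW1.2.2.2.1 hW1.exists_le hTK hK0
  have ha : Differentiable ℝ a := haC.differentiable one_ne_zero
  refine ⟨fun E hE hzero x hx => hprof.type_of_component ha hapos hE hzero hx, ?_⟩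
  rintro A 𝒮 hdisj htype rfl
  refine ⟨hprof.exists_solution haC hapos hdisj htype, fun hA E1 E2 h1 h2 => ?_⟩
  have hsub : ⋃₀ 𝒮 ⊆ Icc (0:ℝ) 1 := sUnion_subset fun S hS => subset_Icc_of_type (htype S hS)
  obtain ⟨x, hx, hxA⟩ := not_subset.1 fun h => hA (hsub.antisymm h)
  exact hprof.eqOn_of_zero_iff ha hapos h1.1 h2.1
    (fun y hy => (h1.2 y hy).trans (h2.2 y hy).symm) ⟨x, hx, (h1.2 x hx).2 ⟨hx, hxA⟩⟩
end
end
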